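/- Let n ∈ {2,3}, let X ⊂ ℝ^{n+1} be a convex surface, and let ∅ ≠ K ⊆ X be closed. Set d_K(z) := inf_{y ∈ K} dist_X(z, y) and, for r > 0, K_r := {x ∈ X : d_K(x) = r}. Then there exists a compact set N ⊆ [0,∞) with (n−1)/2-dimensional Hausdorff measure H^{(n−1)/2}(N) = 0 such that for every r ∈ (0,∞) ∖ N, the r-boundary K_r is either empty or an (n−1)-dimensional DC surface in ℝ^{n+1}. -/

import Mathlib

open MeasureTheory
open scoped NNReal

open Set

/-- `f` is DC on the convex set `C`: a difference of two continuous convex functions on `C`. -/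
def IsDCOn {E : Type*} [NormedAddCommGroup E] [NormedSpace ℝ E]
    (C : Set E) (f : E → ℝ) : Prop :=
  ∃ g h : E → ℝ, ConvexOn ℝ C g ∧ ConvexOn ℝ C h ∧
    ContinuousOn g C ∧ ContinuousOn h C ∧ ∀ x ∈ C, f x = g x - h x

/-- A mapping `F : C → F'` is DC if `ℓ ∘ F` is DC for every linear functional `ℓ`. -/
def IsDCMapOn {E F' : Type*} [NormedAddCommGroup E] [NormedSpace ℝ E]
    [NormedAddCommGroup F'] [NormedSpace ℝ F'] (C : Set E) (F : E → F') : Prop :=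
  ∀ ℓ : F' →ₗ[ℝ] ℝ, IsDCOn C (fun x => ℓ (F x))

/-- `F` is locally DC on the open set `U`: every point of `U` has an open convex
neighborhood contained in `U` on which `F` is DC. -/
def LocallyDCMapOn {E F' : Type*} [NormedAddCommGroup E] [NormedSpace ℝ E]
    [NormedAddCommGroup F'] [NormedSpace ℝ F'] (U : Set E) (F : E → F') : Prop :=
  ∀ x ∈ U, ∃ V : Set E, IsOpen V ∧ Convex ℝ V ∧ x ∈ V ∧ V ⊆ U ∧ IsDCMapOn V F

/-- A `k`-dimensional DC surface: a nonempty set which is locally the graph of a locally DC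
mapping from (an open subset of) a `k`-dimensional linear subspace `Q` to `Qᗮ`. -/
def IsDCSurface {E : Type*} [NormedAddCommGroup E] [InnerProductSpace ℝ E]
    (k : ℕ) (T : Set E) : Prop :=
  T.Nonempty ∧ ∀ x ∈ T, ∃ Q : Submodule ℝ E, Module.finrank ℝ Q = k ∧
    ∃ W : Set E, IsOpen W ∧ x ∈ W ∧ ∃ G : Set Q, IsOpen G ∧
      ∃ h : Q → Qᗮ, LocallyDCMapOn G h ∧
        T ∩ W = (fun u : Q => (u : E) + ((h u : Qᗮ) : E)) '' G

/-- A convex body: a compact convex set with nonempty interior. -/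
def IsConvexBody {E : Type*} [NormedAddCommGroup E] [NormedSpace ℝ E] (C : Set E) : Prop :=
  IsCompact C ∧ Convex ℝ C ∧ (interior C).Nonempty

/-- A convex surface: the boundary of a convex body. -/
def IsConvexSurface {E : Type*} [NormedAddCommGroup E] [NormedSpace ℝ E] (X : Set E) : Prop :=
  ∃ C : Set E, IsConvexBody C ∧ X = frontier C

/-- The intrinsic distance on `X ⊆ E`: the infimum of lengths (total variations) of
continuous curves `γ : [0,1] → E` joining `a` and `b` within `X`. -/
noncomputable def intrinsicDist {E : Type*} [NormedAddCommGroup E] [NormedSpace ℝ E]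
    (X : Set E) (a b : E) : ℝ :=
  (⨅ γ : {γ : ℝ → E // ContinuousOn γ (Set.Icc 0 1) ∧ γ 0 = a ∧ γ 1 = b ∧
      Set.MapsTo γ (Set.Icc 0 1) X},
    eVariationOn γ.1 (Set.Icc 0 1)).toReal

set_option linter.unusedSectionVars false

section ConvexBodies

variable {E : Type*} [NormedAddCommGroup E] [InnerProductSpace ℝ E] [FiniteDimensional ℝ E]

/-- The nearest point projection onto a convex body. -/
theorem IsConvexBody.exists_retraction {C : Set E} (hC : IsConvexBody C) :
    ∃ π : E → E, LipschitzWith 1 π ∧ (∀ x ∈ C, π x = x) ∧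
      ∀ x ∉ interior C, π x ∈ frontier C := by
  obtain ⟨hcp, hcv, hne⟩ := hC
  have hCne : C.Nonempty := hne.mono interior_subset
  have H : ∀ u : E, ∃ v ∈ C, ∀ w ∈ C, inner ℝ (u - v) (w - v) ≤ 0 := by
    intro u
    obtain ⟨v, hv, h⟩ := exists_norm_eq_iInf_of_complete_convex hCne hcp.isClosed.isComplete hcv u
    exact ⟨v, hv, (norm_eq_iInf_iff_real_inner_le_zero hcv hv).1 h⟩
  choose π hπC hπ using H
  have hid : ∀ x ∈ C, π x = x := by
    intro x hx
    have := hπ x x hx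
    rw [real_inner_self_eq_norm_sq] at this
    have h0 : ‖x - π x‖ = 0 := by nlinarith [norm_nonneg (x - π x)]
    exact (sub_eq_zero.1 (norm_eq_zero.1 h0)).symm
  refine ⟨π, ?_, hid, ?_⟩
  · refine LipschitzWith.of_dist_le_mul fun x y => ?_
    have h1 := hπ x (π y) (hπC y)
    have h2 := hπ y (π x) (hπC x)
    have h3 : ‖π x - π y‖ ^ 2 ≤ inner ℝ (x - y) (π x - π y) := by
      rw [← real_inner_self_eq_norm_sq]
      simp only [inner_sub_left, inner_sub_right, real_inner_comm] at *
      linarith [real_inner_comm (π x) (π y)]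
    have h4 := real_inner_le_norm (x - y) (π x - π y)
    rw [dist_eq_norm, dist_eq_norm, NNReal.coe_one, one_mul]
    by_contra! hlt
    nlinarith [norm_nonneg (x - y), norm_nonneg (π x - π y)]
  · intro x hx
    refine ⟨subset_closure (hπC x), fun hint => ?_⟩
    have hxC : x ∉ C := fun h => hx (by rwa [hid x h] at hint)
    have hne' : x - π x ≠ 0 := fun h => hxC (by rw [sub_eq_zero.1 h]; exact hπC x)
    have hc : Filter.Tendsto (fun t : ℝ => π x + t • (x - π x)) (nhds 0) (nhds (π x)) := by
      have : Continuous (fun t : ℝ => π x + t • (x - π x)) := by fun_prop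
      simpa using this.tendsto 0
    have hev := hc.eventually (isOpen_interior.mem_nhds hint)
    obtain ⟨δ, hδ, hball⟩ := Metric.eventually_nhds_iff.1 hev
    have hmem := interior_subset (hball (y := δ / 2)
      (by rw [Real.dist_eq, sub_zero, abs_of_pos (by positivity)]; linarith))
    have h := hπ x _ hmem
    rw [add_sub_cancel_left, inner_smul_right, real_inner_self_eq_norm_sq] at h
    have : 0 < ‖x - π x‖ := norm_pos_iff.2 hne'
    have : 0 < δ / 2 * ‖x - π x‖ ^ 2 := by positivity
    linarith

omit [InnerProductSpace ℝ E] [FiniteDimensional ℝ E] in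
theorem IsConvexBody.exists_balls [NormedSpace ℝ E] {C : Set E} (hC : IsConvexBody C) :
    ∃ o ∈ interior C, ∃ r R : ℝ, 0 < r ∧ 0 < R ∧ Metric.ball o r ⊆ C ∧
      C ⊆ Metric.closedBall o R := by
  obtain ⟨hcp, hcv, o, ho⟩ := hC
  obtain ⟨r, hr, hb⟩ := Metric.isOpen_iff.1 isOpen_interior o ho
  obtain ⟨R, hR⟩ := hcp.isBounded.subset_closedBall o
  exact ⟨o, ho, r, max R 1, hr, by positivity, hb.trans interior_subset,
    hR.trans (Metric.closedBall_subset_closedBall (le_max_left _ _))⟩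

omit [FiniteDimensional ℝ E] in
theorem notMem_of_dist_lt {C : Set E} (hcv : Convex ℝ C) {o x z : E} {r η : ℝ}
    (hball : Metric.ball o r ⊆ C) (hx : x ∉ interior C) (hη : 0 ≤ η)
    (hz : ‖z - (x + η • (x - o))‖ < η * r) : z ∉ C := by
  intro hzC
  have hη' : 0 < η := by
    rcases hη.eq_or_lt with h | h
    · rw [← h, zero_mul] at hz
      exact absurd hz (norm_nonneg _).not_gt
    · exact h
  apply hx
  have hd : o - η⁻¹ • (z - (x + η • (x - o))) ∈ interior C := by
    refine interior_maximal hball Metric.isOpen_ball ?_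
    rw [Metric.mem_ball, dist_eq_norm, sub_sub_cancel_left, norm_neg, norm_smul, norm_inv,
      Real.norm_of_nonneg hη, inv_mul_lt_iff₀ hη']
    exact hz
  have h := hcv.combo_self_interior_mem_interior hzC hd (a := 1 / (1 + η)) (b := η / (1 + η))
    (by positivity) (by positivity) (by field_simp)
  convert h using 1
  have h1 : (1 + η) ≠ 0 := by positivity
  have : (η / (1 + η)) * η⁻¹ = 1 / (1 + η) := by field_simp
  rw [smul_sub, smul_smul, this]
  match_scalars <;> field_simp <;> ring

omit [FiniteDimensional ℝ E] in
theorem ray_notMem_interior {C : Set E} (hcv : Convex ℝ C) {x y : E} {s : ℝ}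
    (hx : x ∉ interior C) (hy : y ∈ interior C) (hs : 0 ≤ s) :
    x + s • (x - y) ∉ interior C := by
  rcases hs.eq_or_lt with rfl | hs'
  · simpa using hx
  intro h
  apply hx
  have h := hcv.combo_self_interior_mem_interior (interior_subset h) hy (a := 1 / (1 + s))
    (b := s / (1 + s)) (by positivity) (by positivity) (by field_simp)
  convert h using 1
  match_scalars
  · field_simp
  · field_simp
    ring

end ConvexBodies

section Polygons

variable {E : Type*} [NormedAddCommGroup E] [NormedSpace ℝ E]

/-- The first `N` segments of the polygonal line with vertices `r` lie in `S`. -/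
def PolygonIn (S : Set E) (N : ℕ) (r : ℕ → E) : Prop :=
  ∀ j < N, segment ℝ (r j) (r (j + 1)) ⊆ S

/-- The total length of the first `N` segments of the polygonal line with vertices `r`. -/
noncomputable def polygonLength (N : ℕ) (r : ℕ → E) : ℝ :=
  ∑ j ∈ Finset.range N, ‖r j - r (j + 1)‖

/-- The points `a` and `b` are joined by a polygonal line in `S` of length at most `L`. -/
def PolygonJoin (S : Set E) (a b : E) (L : ℝ) : Prop :=
  ∃ (N : ℕ) (r : ℕ → E), r 0 = a ∧ r N = b ∧ PolygonIn S N r ∧ polygonLength N r ≤ L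

theorem polygonLength_nonneg (N : ℕ) (r : ℕ → E) : 0 ≤ polygonLength N r :=
  Finset.sum_nonneg fun _ _ => norm_nonneg _

theorem polygonLength_succ (N : ℕ) (r : ℕ → E) :
    polygonLength (N + 1) r = ‖r 0 - r 1‖ + polygonLength N (fun j => r (j + 1)) := by
  simp [polygonLength, Finset.sum_range_succ', add_comm]

theorem PolygonJoin.cons {S : Set E} {a b c : E} {L : ℝ} (hab : segment ℝ a b ⊆ S)
    (h : PolygonJoin S b c L) : PolygonJoin S a c (‖a - b‖ + L) := by
  obtain ⟨N, r, h0, hN, hS, hL⟩ := h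
  refine ⟨N + 1, fun j => Nat.casesOn j a r, rfl, hN, ?_, ?_⟩
  · rintro (_ | j) hj
    · simpa [h0] using hab
    · exact hS j (by omega)
  · rw [polygonLength_succ]
    change ‖a - r 0‖ + polygonLength N r ≤ _
    rw [h0]
    gcongr

theorem PolygonJoin.snoc {S : Set E} {a b c : E} {L : ℝ} (hbc : segment ℝ b c ⊆ S)
    (h : PolygonJoin S a b L) : PolygonJoin S a c (L + ‖b - c‖) := by
  obtain ⟨N, r, h0, hN, hS, hL⟩ := h
  refine ⟨N + 1, fun j => if j ≤ N then r j else c, by simpa using h0, by simp, ?_, ?_⟩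
  · intro j hj
    rcases Nat.lt_succ_iff_lt_or_eq.1 hj with h | rfl
    · simpa [h.le, Nat.succ_le_iff, h] using hS j h
    · simpa [hN] using hbc
  · rw [polygonLength, Finset.sum_range_succ]
    have : ∑ x ∈ Finset.range N, ‖(if x ≤ N then r x else c) -
        (if x + 1 ≤ N then r (x + 1) else c)‖ = polygonLength N r := by
      refine Finset.sum_congr rfl fun j hj => ?_
      have := Finset.mem_range.1 hj
      rw [if_pos this.le, if_pos (by omega)]
    rw [this]
    simpa [hN] using hL

end Polygons

section IntrinsicDistance

variable {E : Type*} [NormedAddCommGroup E]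

/-- The extended-real valued intrinsic distance. -/
noncomputable def intrinsicEDist (X : Set E) (a b : E) : ENNReal :=
  ⨅ γ : {γ : ℝ → E // ContinuousOn γ (Set.Icc 0 1) ∧ γ 0 = a ∧ γ 1 = b ∧
      Set.MapsTo γ (Set.Icc 0 1) X},
    eVariationOn γ.1 (Set.Icc 0 1)

theorem toReal_intrinsicEDist [NormedSpace ℝ E] (X : Set E) (a b : E) :
    (intrinsicEDist X a b).toReal = intrinsicDist X a b := rfl

theorem intrinsicEDist_le {X : Set E} {a b : E} {γ : ℝ → E} (hγ : ContinuousOn γ (Icc 0 1))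
    (h0 : γ 0 = a) (h1 : γ 1 = b) (hX : MapsTo γ (Icc 0 1) X) :
    intrinsicEDist X a b ≤ eVariationOn γ (Icc 0 1) :=
  iInf_le (fun γ : {γ : ℝ → E // ContinuousOn γ (Set.Icc 0 1) ∧ γ 0 = a ∧ γ 1 = b ∧
      Set.MapsTo γ (Set.Icc 0 1) X} => eVariationOn γ.1 (Set.Icc 0 1)) ⟨γ, hγ, h0, h1, hX⟩

theorem intrinsicEDist_self {X : Set E} {a : E} (ha : a ∈ X) : intrinsicEDist X a a = 0 := by
  refine le_antisymm ((intrinsicEDist_le (γ := fun _ => a) continuousOn_const rfl rfl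
    fun _ _ => ha).trans (le_of_eq ?_)) bot_le
  exact eVariationOn.constant_on (by
    rintro _ ⟨x, _, rfl⟩ _ ⟨y, _, rfl⟩; rfl)

theorem intrinsicEDist_triangle (X : Set E) (a b c : E) :
    intrinsicEDist X a c ≤ intrinsicEDist X a b + intrinsicEDist X b c := by
  refine ENNReal.le_iInf_add_iInf fun ⟨γ, hγ, h0, h1, hX⟩ ⟨δ, hδ, k0, k1, kX⟩ => ?_
  set f : ℝ → ℝ := fun t => 2 * t
  set g : ℝ → ℝ := fun t => 2 * t - 1
  set ω : ℝ → E := fun t => if t ≤ 1 / 2 then γ (f t) else δ (g t)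
  have e1 : EqOn ω (γ ∘ f) (Icc 0 (1 / 2)) := fun t ht => if_pos ht.2
  have e2 : EqOn ω (δ ∘ g) (Icc (1 / 2) 1) := by
    intro t ht
    rcases ht.1.eq_or_lt with rfl | h
    · simp [ω, f, g, h1, k0]
    · exact if_neg (not_le.2 h)
  have mf : MapsTo f (Icc 0 (1 / 2)) (Icc 0 1) := fun t ht => by
    constructor <;> simp only [f] <;> linarith [ht.1, ht.2]
  have mg : MapsTo g (Icc (1 / 2) 1) (Icc 0 1) := fun t ht => by
    constructor <;> simp only [g] <;> linarith [ht.1, ht.2]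
  have hu : Icc (0 : ℝ) 1 = Icc 0 (1 / 2) ∪ Icc (1 / 2) 1 :=
    (Icc_union_Icc_eq_Icc (by norm_num) (by norm_num)).symm
  have c1 : ContinuousOn ω (Icc 0 (1 / 2)) :=
    (hγ.comp (by fun_prop) mf).congr e1
  have c2 : ContinuousOn ω (Icc (1 / 2) 1) :=
    (hδ.comp (by fun_prop) mg).congr e2
  refine (intrinsicEDist_le (γ := ω) ?_ ?_ ?_ ?_).trans ?_
  · rw [hu]
    exact c1.union_of_isClosed c2 isClosed_Icc isClosed_Icc
  · simp [ω, f, h0]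
  · have := e2 (⟨by norm_num, le_rfl⟩ : (1 : ℝ) ∈ Icc (1 / 2) 1)
    rw [this]
    simp only [g, Function.comp]
    norm_num [k1]
  · rw [hu]
    rintro t (ht | ht)
    · rw [e1 ht]; exact hX (mf ht)
    · rw [e2 ht]; exact kX (mg ht)
  · have := eVariationOn.Icc_add_Icc ω (s := univ) (a := 0) (b := 1 / 2) (c := (1 : ℝ))
      (by norm_num) (by norm_num) (mem_univ _)
    simp only [univ_inter] at this
    rw [← this, eVariationOn.congr e1, eVariationOn.congr e2]
    refine add_le_add (eVariationOn.comp_le_of_monotoneOn _ _ ?_ mf)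
      (eVariationOn.comp_le_of_monotoneOn _ _ ?_ mg)
    · intro x _ y _ hxy; simp only [f]; linarith
    · intro x _ y _ hxy; simp only [g]; linarith

end IntrinsicDistance

section DistanceBounds

variable {E : Type*} [NormedAddCommGroup E] [InnerProductSpace ℝ E] [FiniteDimensional ℝ E]

theorem segment_lineMap_mem {S : Set E} {a b : E} (h : segment ℝ a b ⊆ S) {t : ℝ}
    (ht : t ∈ Icc (0 : ℝ) 1) : AffineMap.lineMap a b t ∈ S :=
  h (by rw [segment_eq_image_lineMap]; exact ⟨t, ht, rfl⟩)

theorem intrinsicEDist_proj_le {C : Set E} {π : E → E} (hπ : LipschitzWith 1 π)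
    (hfr : ∀ x ∉ interior C, π x ∈ frontier C) {a b : E}
    (hab : segment ℝ a b ⊆ (interior C)ᶜ) :
    intrinsicEDist (frontier C) (π a) (π b) ≤ ENNReal.ofReal ‖a - b‖ := by
  have hL : LipschitzWith (nndist a b) (fun t : ℝ => π (AffineMap.lineMap a b t)) := by
    have := hπ.comp (lipschitzWith_lineMap (𝕜 := ℝ) a b)
    rwa [one_mul] at this
  refine (intrinsicEDist_le (γ := fun t : ℝ => π (AffineMap.lineMap a b t))
    hL.continuous.continuousOn (by simp) (by simp)
    fun t ht => hfr _ (segment_lineMap_mem hab ht)).trans ?_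
  have h1 := hL.lipschitzOnWith.comp_eVariationOn_le (g := (id : ℝ → ℝ))
    (s := Icc (0 : ℝ) 1) (t := univ) (mapsTo_univ _ _)
  refine h1.trans ?_
  have h2 : eVariationOn (id : ℝ → ℝ) (Icc 0 1) ≤ ENNReal.ofReal (1 - 0) := by
    have := (monotoneOn_id (α := ℝ) (s := Icc 0 1)).eVariationOn_eq (a := 0) (b := 1)
      (by simp) (by simp)
    rw [inter_self] at this
    exact this.le
  calc _ ≤ (nndist a b : ENNReal) * ENNReal.ofReal (1 - 0) := by gcongr
    _ = _ := by
      rw [sub_zero, ENNReal.ofReal_one, mul_one, ← dist_eq_norm, ← edist_dist, edist_nndist]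

theorem IsConvexBody.intrinsicEDist_le_of_polygonJoin {C : Set E} (hC : IsConvexBody C)
    {a b : E} (ha : a ∈ frontier C) (hb : b ∈ frontier C) {L : ℝ}
    (h : PolygonJoin (interior C)ᶜ a b L) :
    intrinsicEDist (frontier C) a b ≤ ENNReal.ofReal L := by
  obtain ⟨π, hπ, hid, hfr⟩ := hC.exists_retraction
  have hfC : ∀ x ∈ frontier C, π x = x := fun x hx => hid x (hC.1.isClosed.frontier_subset hx)
  obtain ⟨N, r, rfl, rfl, hS, hL⟩ := h
  have key : ∀ M ≤ N, intrinsicEDist (frontier C) (r 0) (π (r M)) ≤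
      ENNReal.ofReal (polygonLength M r) := by
    intro M
    induction M with
    | zero => 
      intro _
      rw [hfC _ ha, intrinsicEDist_self ha]
      exact bot_le
    | succ M ih =>
      intro hM
      refine (intrinsicEDist_triangle _ _ (π (r M)) _).trans ?_
      rw [polygonLength, Finset.sum_range_succ, ENNReal.ofReal_add
        (Finset.sum_nonneg fun _ _ => norm_nonneg _) (norm_nonneg _)]
      exact add_le_add (ih (by omega)) (intrinsicEDist_proj_le hπ hfr (hS M (by omega)))
  have := key N le_rfl
  rw [hfC _ hb] at this
  exact this.trans (ENNReal.ofReal_le_ofReal hL)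

theorem PolygonJoin.refl {S : Set E} (a : E) : PolygonJoin S a a 0 :=
  ⟨0, fun _ => a, rfl, rfl, fun _ h => absurd h (Nat.not_lt_zero _), by simp [polygonLength]⟩

theorem PolygonJoin.mono {S : Set E} {a b : E} {L L' : ℝ} (h : PolygonJoin S a b L)
    (hL : L ≤ L') : PolygonJoin S a b L' := by
  obtain ⟨N, r, h0, hN, hS, h⟩ := h
  exact ⟨N, r, h0, hN, hS, h.trans hL⟩

theorem segment_ray_subset {C : Set E} (hcv : Convex ℝ C) {x y : E} {s : ℝ}
    (hx : x ∉ interior C) (hy : y ∈ interior C) (hs : 0 ≤ s) :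
    segment ℝ x (x + s • (x - y)) ⊆ (interior C)ᶜ := by
  rw [segment_eq_image']
  rintro _ ⟨t, ht, rfl⟩
  have := ray_notMem_interior hcv hx hy (s := t * s) (mul_nonneg ht.1 hs)
  simpa [smul_smul] using this

theorem norm_frontier_sub_le {C : Set E} (hC : IsConvexBody C) {o : E} {R : ℝ}
    (hR : C ⊆ Metric.closedBall o R) {x : E} (hx : x ∈ frontier C) : ‖x - o‖ ≤ R := by
  simpa [dist_eq_norm] using hR (hC.1.isClosed.frontier_subset hx)

/-- Intrinsic and Euclidean distance are locally comparable. -/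
theorem IsConvexBody.exists_intrinsicEDist_le_mul {C : Set E} (hC : IsConvexBody C) :
    ∃ M δ : ℝ, 0 < M ∧ 0 < δ ∧ ∀ a ∈ frontier C, ∀ b ∈ frontier C, ‖a - b‖ < δ →
      intrinsicEDist (frontier C) a b ≤ ENNReal.ofReal (M * ‖a - b‖) := by
  obtain ⟨o, ho, r, R, hr, hR, hball, hsub⟩ := hC.exists_balls
  refine ⟨4 * R / r + 2, r / 2, by positivity, by positivity, fun a ha b hb hab => ?_⟩
  rcases eq_or_ne a b with rfl | hne
  · rw [intrinsicEDist_self ha]; exact bot_le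
  have hpos : 0 < ‖a - b‖ := norm_pos_iff.2 (sub_ne_zero.2 hne)
  set η := 2 * ‖a - b‖ / r with hη
  have hη0 : 0 < η := by positivity
  have hηr : η * r = 2 * ‖a - b‖ := by rw [hη]; field_simp
  have hη1 : η < 1 := by rw [hη, div_lt_one hr]; linarith
  have ha' : a ∉ interior C := fun h => ha.2 h
  have hb' : b ∉ interior C := fun h => hb.2 h
  have hmid : segment ℝ (a + η • (a - o)) (b + η • (b - o)) ⊆ (interior C)ᶜ := by
    rw [segment_eq_image']
    rintro _ ⟨t, ht, rfl⟩ hint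
    refine notMem_of_dist_lt hC.2.1 hball ha' hη0.le ?_ (interior_subset hint)
    have : (a + η • (a - o) + t • (b + η • (b - o) - (a + η • (a - o)))) - (a + η • (a - o)) =
      -((t * (1 + η)) • (a - b)) := by module
    rw [this, norm_neg, norm_smul, hηr, Real.norm_of_nonneg
      (mul_nonneg ht.1 (by positivity))]
    have : t * (1 + η) < 2 := by nlinarith [ht.1, ht.2]
    nlinarith
  have hseg1 := segment_ray_subset hC.2.1 ha' ho hη0.le
  have hseg2 := segment_ray_subset hC.2.1 hb' ho hη0.le
  rw [segment_symm] at hseg2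
  refine hC.intrinsicEDist_le_of_polygonJoin ha hb (PolygonJoin.mono
    (PolygonJoin.cons hseg1 (PolygonJoin.cons hmid (PolygonJoin.cons hseg2
      (PolygonJoin.refl b)))) ?_)
  have e1 : a - (a + η • (a - o)) = -(η • (a - o)) := by module
  have e2 : a + η • (a - o) - (b + η • (b - o)) = (1 + η) • (a - b) := by module
  have e3 : b + η • (b - o) - b = η • (b - o) := by module
  rw [e1, e2, e3, norm_neg, norm_smul, norm_smul, norm_smul, Real.norm_of_nonneg hη0.le,
    Real.norm_of_nonneg (by positivity)]
  have n1 := norm_frontier_sub_le hC hsub ha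
  have n2 := norm_frontier_sub_le hC hsub hb
  have e4 : (4 * R / r + 2) * ‖a - b‖ = η * R + η * R + 2 * ‖a - b‖ := by
    rw [hη]; field_simp; ring
  rw [e4]
  nlinarith

theorem norm_frontier_sub_ge {C : Set E} {o : E} {r : ℝ}
    (hr : Metric.ball o r ⊆ C) {x : E} (hx : x ∈ frontier C) : r ≤ ‖x - o‖ := by
  by_contra! h
  exact hx.2 (interior_maximal hr Metric.isOpen_ball (by simpa [dist_eq_norm] using h))

theorem exists_unit_orthogonal_pair (hdim : 3 ≤ Module.finrank ℝ E) (u v : E) :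
    ∃ w : E, ‖w‖ = 1 ∧ inner ℝ u w = 0 ∧ inner ℝ v w = 0 := by
  classical
  set S := Submodule.span ℝ (({u, v} : Finset E) : Set E)
  have hS : Module.finrank ℝ S ≤ 2 := (finrank_span_finset_le_card _).trans Finset.card_le_two
  have hSc := S.finrank_add_finrank_orthogonal
  have : Nontrivial Sᗮ := Module.nontrivial_of_finrank_pos (R := ℝ) (by omega)
  obtain ⟨w, hw⟩ := exists_ne (0 : Sᗮ)
  have hw0 : ‖(w : E)‖ ≠ 0 := by simpa using hw
  have hmem := (Submodule.mem_orthogonal S (w : E)).1 w.2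
  refine ⟨(‖(w : E)‖)⁻¹ • (w : E), by rw [norm_smul, norm_inv, norm_norm, inv_mul_cancel₀ hw0],
    ?_, ?_⟩ <;> rw [inner_smul_right, hmem _ (Submodule.subset_span (by simp)), mul_zero]

/-- In dimension at least three the intrinsic distance is bounded. -/
theorem IsConvexBody.exists_intrinsicEDist_le {C : Set E} (hC : IsConvexBody C)
    (hdim : 3 ≤ Module.finrank ℝ E) :
    ∃ D : ℝ, 0 ≤ D ∧ ∀ a ∈ frontier C, ∀ b ∈ frontier C,
      intrinsicEDist (frontier C) a b ≤ ENNReal.ofReal D := by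
  obtain ⟨o, ho, r, R, hr, hR, hball, hsub⟩ := hC.exists_balls
  set T := 2 * R / r with hT
  have hT0 : 0 < T := by positivity
  have hTr : T * r = 2 * R := by rw [hT]; field_simp
  refine ⟨2 * (T * R + T * (R + r)), by positivity, fun a ha b hb => ?_⟩
  obtain ⟨w, hw1, hwa, hwb⟩ := exists_unit_orthogonal_pair hdim (a - o) (b - o)
  have hRr : 1 ≤ T := by
    have h1 := norm_frontier_sub_le hC hsub ha
    have h2 := norm_frontier_sub_ge hball ha
    rw [hT, le_div_iff₀ hr]; linarith
  have hmid : ∀ x ∈ frontier C, inner ℝ (x - o) w = 0 →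
      segment ℝ (x + (T - 1) • (x - o)) (o + (T * r) • w) ⊆ (interior C)ᶜ := by
    intro x hx hxw
    rw [segment_eq_image']
    rintro _ ⟨t, ht, rfl⟩ hint
    have h1 := hsub (interior_subset hint)
    rw [Metric.mem_closedBall, dist_eq_norm] at h1
    have e : x + (T - 1) • (x - o) + t • (o + (T * r) • w - (x + (T - 1) • (x - o))) - o =
      T • ((1 - t) • (x - o) + (t * r) • w) := by module
    rw [e, norm_smul, Real.norm_of_nonneg hT0.le] at h1
    have h2 : ‖(1 - t) • (x - o) + (t * r) • w‖ ^ 2 =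
        (1 - t) ^ 2 * ‖x - o‖ ^ 2 + t ^ 2 * r ^ 2 := by
      rw [norm_add_sq_real, norm_smul, norm_smul, inner_smul_left, inner_smul_right, hxw, hw1,
        Real.norm_eq_abs, Real.norm_eq_abs, mul_pow, mul_pow, sq_abs, sq_abs]
      simp; ring
    have h3 := norm_frontier_sub_ge hball hx
    set n := ‖(1 - t) • (x - o) + (t * r) • w‖
    have h4 : r / 2 < n := by
      refine lt_of_pow_lt_pow_left₀ 2 (norm_nonneg _) ?_
      rw [h2]
      have : (1 - t) ^ 2 * r ^ 2 ≤ (1 - t) ^ 2 * ‖x - o‖ ^ 2 := by gcongr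
      nlinarith [sq_nonneg (r * (1 - 2 * t)), pow_pos hr 2]
    nlinarith
  have hlen : ∀ x ∈ frontier C, ‖x + (T - 1) • (x - o) - (o + (T * r) • w)‖ ≤ T * (R + r) := by
    intro x hx
    have e : x + (T - 1) • (x - o) - (o + (T * r) • w) = T • ((x - o) - r • w) := by module
    rw [e, norm_smul, Real.norm_of_nonneg hT0.le]
    gcongr
    refine (norm_sub_le _ _).trans (add_le_add (norm_frontier_sub_le hC hsub hx) ?_)
    rw [norm_smul, hw1, mul_one, Real.norm_of_nonneg hr.le]
  have hray : ∀ x ∈ frontier C, segment ℝ x (x + (T - 1) • (x - o)) ⊆ (interior C)ᶜ := fun x hx =>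
    segment_ray_subset hC.2.1 (fun h => hx.2 h) ho (by linarith)
  have hrlen : ∀ x ∈ frontier C, ‖x - (x + (T - 1) • (x - o))‖ ≤ T * R := by
    intro x hx
    rw [sub_add_cancel_left, norm_neg, norm_smul, Real.norm_of_nonneg (by linarith)]
    exact mul_le_mul (by linarith) (norm_frontier_sub_le hC hsub hx) (norm_nonneg _) hT0.le
  have s3 := hmid b hb hwb
  have s4 := hray b hb
  have l3 := hlen b hb
  have l4 := hrlen b hb
  rw [segment_symm] at s3 s4
  rw [norm_sub_rev] at l3 l4
  refine hC.intrinsicEDist_le_of_polygonJoin ha hb (PolygonJoin.mono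
    (.cons (hray a ha) (.cons (hmid a ha hwa) (.cons s3 (.cons s4 (.refl b))))) ?_)
  linarith [hlen a ha, hrlen a ha]

end DistanceBounds

section SurfaceDistance

variable {E : Type*} [NormedAddCommGroup E] [InnerProductSpace ℝ E] [FiniteDimensional ℝ E]

/-- The intrinsic distance from `q` to the set `K`. -/
noncomputable def surfDist (X K : Set E) (q : E) : ℝ :=
  ⨅ y : K, intrinsicDist X q (y : E)

/-- A convex body `C` in a space of dimension at least three and a nonempty closed subset `K` of
its boundary. -/
structure SurfacePair (C K : Set E) : Prop where
  body : IsConvexBody C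
  dim : 3 ≤ Module.finrank ℝ E
  nonempty : K.Nonempty
  closed : IsClosed K
  subset : K ⊆ frontier C

namespace SurfacePair

variable {C K : Set E}

theorem notMem_interior {x : E} (hx : x ∈ frontier C) : x ∉ interior C := fun h => hx.2 h

theorem mem_of_frontier (h : SurfacePair C K) {x : E} (hx : x ∈ frontier C) : x ∈ C :=
  h.body.1.isClosed.frontier_subset hx

theorem intrinsicEDist_ne_top (h : SurfacePair C K) {a b : E} (ha : a ∈ frontier C)
    (hb : b ∈ frontier C) : intrinsicEDist (frontier C) a b ≠ ⊤ := by
  obtain ⟨D, -, hD⟩ := h.body.exists_intrinsicEDist_le h.dim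
  exact ne_top_of_le_ne_top ENNReal.ofReal_ne_top (hD a ha b hb)

theorem intrinsicDist_nonneg (X : Set E) (a b : E) : 0 ≤ intrinsicDist X a b :=
  ENNReal.toReal_nonneg

theorem surfDist_nonneg (X K : Set E) (q : E) : 0 ≤ surfDist X K q :=
  Real.iInf_nonneg fun _ => intrinsicDist_nonneg _ _ _

theorem surfDist_le_intrinsicDist (X : Set E) {K : Set E} (q : E) {y : E} (hy : y ∈ K) :
    surfDist X K q ≤ intrinsicDist X q y :=
  ciInf_le (f := fun y : K => intrinsicDist X q (y : E))
    ⟨0, by rintro _ ⟨y, rfl⟩; exact intrinsicDist_nonneg _ _ _⟩ ⟨y, hy⟩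

theorem surfDist_le_of_eVariationOn {X : Set E} {q y : E} (hy : y ∈ K) {γ : ℝ → E}
    (hγ : ContinuousOn γ (Icc 0 1)) (h0 : γ 0 = q) (h1 : γ 1 = y) (hX : MapsTo γ (Icc 0 1) X)
    {L : ℝ} (hL : 0 ≤ L) (hvar : eVariationOn γ (Icc 0 1) ≤ ENNReal.ofReal L) :
    surfDist X K q ≤ L :=
  (surfDist_le_intrinsicDist X q hy).trans
    (ENNReal.toReal_le_of_le_ofReal hL ((intrinsicEDist_le hγ h0 h1 hX).trans hvar))

theorem surfDist_le_add (h : SurfacePair C K) {a b : E}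
    (hb : b ∈ frontier C) {L : ℝ} (hL : 0 ≤ L)
    (hab : intrinsicEDist (frontier C) a b ≤ ENNReal.ofReal L) :
    surfDist (frontier C) K a ≤ L + surfDist (frontier C) K b := by
  have : Nonempty K := h.nonempty.to_subtype
  rw [← sub_le_iff_le_add']
  refine le_ciInf fun y => ?_
  have h1 := surfDist_le_intrinsicDist (frontier C) a y.2
  have hy := h.subset y.2
  have h2 : intrinsicDist (frontier C) a y ≤ L + intrinsicDist (frontier C) b y := by
    refine ENNReal.toReal_le_of_le_ofReal (add_nonneg hL (intrinsicDist_nonneg _ _ _)) ?_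
    refine (intrinsicEDist_triangle _ a b y).trans ?_
    rw [ENNReal.ofReal_add hL (intrinsicDist_nonneg _ _ _), ← toReal_intrinsicEDist,
      ENNReal.ofReal_toReal (h.intrinsicEDist_ne_top hb hy)]
    gcongr
  linarith

theorem exists_surfDist_le (h : SurfacePair C K) :
    ∃ D : ℝ, 0 ≤ D ∧ ∀ q ∈ frontier C, surfDist (frontier C) K q ≤ D := by
  obtain ⟨D, hD0, hD⟩ := h.body.exists_intrinsicEDist_le h.dim
  obtain ⟨y, hy⟩ := h.nonempty
  exact ⟨D, hD0, fun q hq => (surfDist_le_intrinsicDist _ q hy).trans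
    (ENNReal.toReal_le_of_le_ofReal hD0 (hD q hq y (h.subset hy)))⟩

theorem surfDist_eq_zero (h : SurfacePair C K) {y : E} (hy : y ∈ K) :
    surfDist (frontier C) K y = 0 := by
  refine le_antisymm ((surfDist_le_intrinsicDist _ y hy).trans (le_of_eq ?_))
    (surfDist_nonneg _ _ _)
  rw [← toReal_intrinsicEDist, intrinsicEDist_self (h.subset hy), ENNReal.toReal_zero]

theorem surfDist_le_of_polygonJoin (h : SurfacePair C K) {q y : E} (hq : q ∈ frontier C)
    (hy : y ∈ K) {L : ℝ} (hL : PolygonJoin (interior C)ᶜ q y L) :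
    surfDist (frontier C) K q ≤ L := by
  have hL0 : 0 ≤ L := by
    obtain ⟨N, r, -, -, -, h⟩ := hL
    exact (polygonLength_nonneg N r).trans h
  exact (surfDist_le_intrinsicDist _ q hy).trans (ENNReal.toReal_le_of_le_ofReal hL0
    (h.body.intrinsicEDist_le_of_polygonJoin hq (h.subset hy) hL))

theorem continuousOn_surfDist (h : SurfacePair C K) :
    ContinuousOn (surfDist (frontier C) K) (frontier C) := by
  obtain ⟨M, δ, hM, hδ, hMδ⟩ := h.body.exists_intrinsicEDist_le_mul
  refine Metric.continuousOn_iff.2 fun b hb ε hε => ⟨min δ (ε / (2 * M)), by positivity, ?_⟩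
  intro a ha hab
  rw [dist_eq_norm, lt_min_iff] at hab
  have h1 := h.surfDist_le_add hb (by positivity) (hMδ a ha b hb hab.1)
  have h2 := h.surfDist_le_add ha (by positivity)
    (hMδ b hb a ha (by rw [norm_sub_rev]; exact hab.1))
  rw [norm_sub_rev] at h2
  have h3 : M * ‖a - b‖ < ε := by
    have := hab.2
    rw [lt_div_iff₀ (by positivity)] at this
    nlinarith
  rw [Real.dist_eq, abs_lt]
  constructor <;> linarith

theorem exists_curve (h : SurfacePair C K) {q : E} (hq : q ∈ frontier C) {ε : ℝ} (hε : 0 < ε) :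
    ∃ y ∈ K, ∃ γ : ℝ → E, ContinuousOn γ (Icc 0 1) ∧ γ 0 = q ∧ γ 1 = y ∧
      MapsTo γ (Icc 0 1) (frontier C) ∧
      eVariationOn γ (Icc 0 1) ≤ ENNReal.ofReal (surfDist (frontier C) K q + ε) := by
  have : Nonempty K := h.nonempty.to_subtype
  obtain ⟨⟨y, hy⟩, hlt⟩ := exists_lt_of_ciInf_lt
    (show surfDist (frontier C) K q < surfDist (frontier C) K q + ε by linarith)
  have hlt' : intrinsicEDist (frontier C) q y <
      ENNReal.ofReal (surfDist (frontier C) K q + ε) := by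
    rw [← ENNReal.ofReal_toReal (h.intrinsicEDist_ne_top hq (h.subset hy))]
    exact ENNReal.ofReal_lt_ofReal_iff'.2
      ⟨hlt, by linarith [surfDist_nonneg (frontier C) K q]⟩
  obtain ⟨⟨γ, hγ, h0, h1, hX⟩, hγ'⟩ := iInf_lt_iff.1 hlt'
  exact ⟨y, hy, γ, hγ, h0, h1, hX, hγ'.le⟩

/-- Near-optimal curves can be replaced by polygonal lines avoiding the interior. -/
theorem exists_polygonJoin (h : SurfacePair C K) {q : E} (hq : q ∈ frontier C) {ε : ℝ}
    (hε : 0 < ε) :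
    ∃ y ∈ K, PolygonJoin (interior C)ᶜ q y (surfDist (frontier C) K q + ε) := by
  obtain ⟨y, hy, γ, hγ, h0, h1, hX, hvar⟩ := h.exists_curve hq (half_pos hε)
  obtain ⟨o, ho, r, R, hr, hR, hball, hsub⟩ := h.body.exists_balls
  set L := surfDist (frontier C) K q + ε / 2 with hL
  have hL0 : 0 < L := by linarith [surfDist_nonneg (frontier C) K q]
  set η := ε / 2 / (2 * R + L) with hη
  have hη0 : 0 < η := by positivity
  have hηL : η * (2 * R + L) = ε / 2 := by rw [hη]; field_simp
  have hyX := h.subset hy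
  have huc := isCompact_Icc.uniformContinuousOn_of_continuous hγ
  obtain ⟨δ, hδ, hδγ⟩ := Metric.uniformContinuousOn_iff.1 huc (η * r / (1 + η)) (by positivity)
  obtain ⟨m, hm⟩ := exists_nat_one_div_lt hδ
  set u : ℕ → ℝ := fun i => min ((i : ℝ) / (m + 1)) 1 with hu
  have huI : ∀ i, u i ∈ Icc (0 : ℝ) 1 := fun i => ⟨by positivity, min_le_right _ _⟩
  have humono : Monotone u := fun i j hij => by
    simp only [hu]; gcongr
  set w : ℕ → E := fun i => γ (u i) + η • (γ (u i) - o) with hw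
  have hseg : PolygonIn (interior C)ᶜ (m + 1) w := by
    intro j hj
    rw [segment_eq_image']
    rintro _ ⟨t, ht, rfl⟩ hint
    refine notMem_of_dist_lt h.body.2.1 hball (notMem_interior (hX (huI j))) hη0.le ?_
      (interior_subset hint)
    have e : w j + t • (w (j + 1) - w j) - (γ (u j) + η • (γ (u j) - o)) =
      (t * (1 + η)) • (γ (u (j + 1)) - γ (u j)) := by simp only [hw]; module
    rw [e, norm_smul, Real.norm_of_nonneg (mul_nonneg ht.1 (by positivity))]
    have hd : dist (γ (u (j + 1))) (γ (u j)) < η * r / (1 + η) := by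
      refine hδγ _ (huI _) _ (huI _) ?_
      refine lt_of_le_of_lt ?_ hm
      simp only [hu, Real.dist_eq]
      refine (abs_min_sub_min_le_max _ _ _ _).trans ?_
      rw [sub_self, abs_zero, ← sub_div]
      push_cast
      rw [add_sub_cancel_left, abs_of_pos (by positivity)]
      simp only [max_le_iff, le_refl, true_and]
      positivity
    rw [dist_eq_norm, lt_div_iff₀ (by positivity)] at hd
    have hn := norm_nonneg (γ (u (j + 1)) - γ (u j))
    have : t * (1 + η) * ‖γ (u (j + 1)) - γ (u j)‖ ≤ 1 * (1 + η) * ‖γ (u (j + 1)) - γ (u j)‖ := by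
      gcongr
      exact ht.2
    linarith
  have hlen : polygonLength (m + 1) w ≤ (1 + η) * L := by
    have h2 := (eVariationOn.sum_le (f := γ) (n := m + 1) humono huI).trans hvar
    have h3 : polygonLength (m + 1) w =
        (1 + η) * ∑ i ∈ Finset.range (m + 1), dist (γ (u (i + 1))) (γ (u i)) := by
      rw [polygonLength, Finset.mul_sum]
      refine Finset.sum_congr rfl fun i _ => ?_
      have e : w i - w (i + 1) = -((1 + η) • (γ (u (i + 1)) - γ (u i))) := by
        simp only [hw]; module
      rw [e, norm_neg, norm_smul, Real.norm_of_nonneg (by positivity), dist_eq_norm]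
    rw [h3]
    simp only [edist_dist] at h2
    rw [← ENNReal.ofReal_sum_of_nonneg (fun _ _ => dist_nonneg),
      ENNReal.ofReal_le_ofReal_iff hL0.le] at h2
    gcongr
  have hu0 : u 0 = 0 := by simp [hu]
  have hum : u (m + 1) = 1 := by
    simp only [hu]; push_cast; rw [div_self (by positivity), min_self]
  have hw0 : w 0 = q + η • (q - o) := by simp only [hw, hu0, h0]
  have hwm : w (m + 1) = y + η • (y - o) := by simp only [hw, hum, h1]
  have s1 := segment_ray_subset h.body.2.1 (notMem_interior hq) ho hη0.le
  have s2 := segment_ray_subset h.body.2.1 (notMem_interior hyX) ho hη0.le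
  rw [segment_symm] at s2
  have J : PolygonJoin (interior C)ᶜ (q + η • (q - o)) (y + η • (y - o)) ((1 + η) * L) :=
    ⟨m + 1, w, hw0, hwm, hseg, hlen⟩
  refine ⟨y, hy, ((J.cons s1).snoc s2).mono ?_⟩
  rw [sub_add_cancel_left, add_sub_cancel_left, norm_neg, norm_smul, norm_smul,
    Real.norm_of_nonneg hη0.le]
  have n1 := mul_le_mul_of_nonneg_left (norm_frontier_sub_le h.body hsub hq) hη0.le
  have n2 := mul_le_mul_of_nonneg_left (norm_frontier_sub_le h.body hsub hyX) hη0.le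
  linarith

/-- Moving a distance `ρ` along a nearly shortest curve decreases the distance by almost `ρ`. -/
theorem exists_descent (h : SurfacePair C K) {p : E} (hp : p ∈ frontier C) {ρ ε : ℝ}
    (hρ : 0 < ρ) (hK : ∀ y ∈ K, ρ < dist y p) (hε : 0 < ε) :
    ∃ q ∈ frontier C, dist q p = ρ ∧
      surfDist (frontier C) K q ≤ surfDist (frontier C) K p - ρ + ε := by
  obtain ⟨y, hy, γ, hγ, h0, h1, hX, hvar⟩ := h.exists_curve hp hε
  have hd : ContinuousOn (fun t => dist (γ t) p) (Icc 0 1) :=  by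
    fun_prop
  obtain ⟨t, ht, hteq⟩ := intermediate_value_Icc zero_le_one hd
    (show ρ ∈ Icc _ _ by simp only [h0, h1, dist_self]; exact ⟨hρ.le, (hK y hy).le⟩)
  replace hteq : dist (γ t) p = ρ := hteq
  refine ⟨γ t, hX ht, hteq, ?_⟩
  have hadd := eVariationOn.Icc_add_Icc γ (s := univ) (a := 0) (b := t) (c := (1 : ℝ))
      ht.1 ht.2 (mem_univ _)
  simp only [univ_inter] at hadd
  have hlow : ENNReal.ofReal ρ ≤ eVariationOn γ (Icc 0 t) := by
    have := eVariationOn.edist_le γ (s := Icc 0 t) (x := t) (y := 0) ⟨ht.1, le_rfl⟩ ⟨le_rfl, ht.1⟩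
    rwa [h0, edist_dist, hteq] at this
  set L := surfDist (frontier C) K p + ε
  have hL0 : 0 < L := by linarith [surfDist_nonneg (frontier C) K p]
  have hsum : ENNReal.ofReal ρ + eVariationOn γ (Icc t 1) ≤ ENNReal.ofReal L :=
    (add_le_add hlow le_rfl).trans (hadd.le.trans hvar)
  have hρL : ρ ≤ L := (ENNReal.ofReal_le_ofReal_iff hL0.le).1 (le_self_add.trans hsum)
  have htail : eVariationOn γ (Icc t 1) ≤ ENNReal.ofReal (L - ρ) := by
    rw [ENNReal.ofReal_sub _ hρ.le]
    exact ENNReal.le_sub_of_add_le_left ENNReal.ofReal_ne_top hsum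
  have hmaps : MapsTo (fun s : ℝ => t + s * (1 - t)) (Icc 0 1) (Icc t 1) := fun s hs =>
    ⟨by nlinarith [hs.1, ht.2], by nlinarith [hs.2, ht.2]⟩
  have := surfDist_le_of_eVariationOn (K := K) (X := frontier C) (q := γ t) hy
    (γ := γ ∘ fun s : ℝ => t + s * (1 - t))
    ((hγ.mono (Icc_subset_Icc_left ht.1)).comp (by fun_prop) hmaps) (by simp) (by simp [h1])
    (fun s hs => hX (Icc_subset_Icc_left ht.1 (hmaps hs))) (sub_nonneg.2 hρL)
    ((eVariationOn.comp_le_of_monotoneOn γ _ (fun a _ b _ hab => by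
      have : 0 ≤ 1 - t := by linarith [ht.2]
      show t + a * (1 - t) ≤ t + b * (1 - t)
      gcongr) hmaps).trans htail)
  linarith

end SurfacePair

end SurfaceDistance

section Chart

variable {E : Type*} [NormedAddCommGroup E] [InnerProductSpace ℝ E] [FiniteDimensional ℝ E]

/-- The set of points whose line in direction `e` meets the interior of `C`. -/
def shadow (C : Set E) (e : E) : Set E := {z | ∃ t : ℝ, z + t • e ∈ interior C}

/-- The height above `z`, in direction `e`, of the lower boundary of `C`. -/
noncomputable def height (C : Set E) (e z : E) : ℝ := sInf {t : ℝ | z + t • e ∈ C}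

/-- The point of the lower boundary of `C` (in direction `e`) above `z`. -/
noncomputable def lowerPoint (C : Set E) (e z : E) : E := z + height C e z • e

theorem isOpen_shadow (C : Set E) (e : E) : IsOpen (shadow C e) := by
  have : shadow C e = ⋃ t : ℝ, (fun z => z + t • e) ⁻¹' interior C := by
    ext z; simp [shadow]
  rw [this]
  exact isOpen_iUnion fun t => isOpen_interior.preimage (by fun_prop)

theorem convex_shadow {C : Set E} (hC : Convex ℝ C) (e : E) : Convex ℝ (shadow C e) := by
  rintro x ⟨s, hs⟩ y ⟨t, ht⟩ a b ha hb hab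
  refine ⟨a * s + b * t, ?_⟩
  have := hC.interior hs ht ha hb hab
  convert this using 1
  module

theorem add_smul_mem_shadow {C : Set E} {e z : E} (hz : z ∈ shadow C e) (a : ℝ) :
    z + a • e ∈ shadow C e := by
  obtain ⟨t, ht⟩ := hz
  refine ⟨t - a, ?_⟩
  convert ht using 1
  module

namespace IsConvexBody

variable {C : Set E} {e : E}

theorem isCompact_heights (hC : IsConvexBody C) (he : ‖e‖ = 1) (z : E) :
    IsCompact {t : ℝ | z + t • e ∈ C} := by
  refine Metric.isCompact_of_isClosed_isBounded
    (hC.1.isClosed.preimage (f := fun t : ℝ => z + t • e) (by fun_prop)) ?_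
  obtain ⟨R, hR⟩ := hC.1.isBounded.subset_closedBall z
  refine (Metric.isBounded_closedBall (x := (0 : ℝ)) (r := R)).subset fun t ht => ?_
  have := hR ht
  simpa [dist_eq_norm, norm_smul, he] using this

theorem lowerPoint_mem (hC : IsConvexBody C) (he : ‖e‖ = 1) {z : E} (hz : z ∈ shadow C e) :
    lowerPoint C e z ∈ C := by
  obtain ⟨t, ht⟩ := hz
  exact (hC.isCompact_heights he z).sInf_mem
    ⟨t, show z + t • e ∈ C from interior_subset ht⟩

theorem height_le (hC : IsConvexBody C) (he : ‖e‖ = 1) {z : E} {t : ℝ} (ht : z + t • e ∈ C) :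
    height C e z ≤ t :=
  csInf_le (hC.isCompact_heights he z).bddBelow ht

theorem lowerPoint_mem_frontier (hC : IsConvexBody C) (he : ‖e‖ = 1) {z : E}
    (hz : z ∈ shadow C e) : lowerPoint C e z ∈ frontier C := by
  refine ⟨subset_closure (hC.lowerPoint_mem he hz), fun hint => ?_⟩
  have hc : Filter.Tendsto (fun t : ℝ => z + (height C e z - t) • e) (nhds 0)
      (nhds (lowerPoint C e z)) := by
    have : Continuous (fun t : ℝ => z + (height C e z - t) • e) := by fun_prop
    simpa [lowerPoint] using this.tendsto 0
  obtain ⟨δ, hδ, hball⟩ :=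
    Metric.eventually_nhds_iff.1 (hc.eventually (isOpen_interior.mem_nhds hint))
  have hmem := interior_subset (hball (y := δ / 2)
      (by rw [Real.dist_eq, sub_zero, abs_of_pos (by positivity)]; linarith))
  have := hC.height_le he hmem
  linarith

theorem height_add_smul (hC : IsConvexBody C) (he : ‖e‖ = 1) {z : E} (hz : z ∈ shadow C e)
    (a : ℝ) : height C e (z + a • e) = height C e z - a := by
  refine le_antisymm (hC.height_le he ?_) (sub_le_iff_le_add.2 (hC.height_le he ?_))
  · convert hC.lowerPoint_mem he hz using 1
    rw [lowerPoint]; module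
  · convert hC.lowerPoint_mem he (add_smul_mem_shadow hz a) using 1
    rw [lowerPoint]; module

theorem height_eq_zero (hC : IsConvexBody C) (he : ‖e‖ = 1) {q : E} (hq : q ∈ frontier C)
    {ρ : ℝ} (hρ : 0 < ρ) (hint : q + ρ • e ∈ interior C) : height C e q = 0 := by
  have hz : q ∈ shadow C e := ⟨ρ, hint⟩
  have h1 : height C e q ≤ 0 :=
    hC.height_le he (by simpa using hC.1.isClosed.frontier_subset hq)
  by_contra hne
  have hlt : height C e q < 0 := lt_of_le_of_ne h1 hne
  set t := height C e q
  refine hq.2 ?_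
  have h := hC.2.1.combo_self_interior_mem_interior (hC.lowerPoint_mem he hz) hint
    (a := ρ / (ρ - t)) (b := -t / (ρ - t)) (div_nonneg hρ.le (by linarith))
    (div_pos (by linarith) (by linarith)) (by field_simp [show ρ - t ≠ 0 by linarith]; ring)
  have hne' : ρ - t ≠ 0 := by linarith
  convert h using 1
  rw [lowerPoint]
  match_scalars <;> field_simp <;> ring

theorem convexOn_height (hC : IsConvexBody C) (he : ‖e‖ = 1) :
    ConvexOn ℝ (shadow C e) (height C e) := by
  refine ⟨convex_shadow hC.2.1 e, fun x hx y hy a b ha hb hab => hC.height_le he ?_⟩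
  have := hC.2.1 (hC.lowerPoint_mem he hx) (hC.lowerPoint_mem he hy) ha hb hab
  convert this using 1
  simp only [lowerPoint, smul_eq_mul]
  module

theorem continuousOn_height (hC : IsConvexBody C) (he : ‖e‖ = 1) :
    ContinuousOn (height C e) (shadow C e) :=
  (hC.convexOn_height he).continuousOn (isOpen_shadow C e)

theorem continuousOn_lowerPoint (hC : IsConvexBody C) (he : ‖e‖ = 1) :
    ContinuousOn (lowerPoint C e) (shadow C e) := by
  have := hC.continuousOn_height he
  unfold lowerPoint
  fun_prop

theorem lowerPoint_eq_self (hC : IsConvexBody C) (he : ‖e‖ = 1) {q : E} (hq : q ∈ frontier C)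
    {ρ : ℝ} (hρ : 0 < ρ) (hint : q + ρ • e ∈ interior C) : lowerPoint C e q = q := by
  rw [lowerPoint, hC.height_eq_zero he hq hρ hint, zero_smul, add_zero]

theorem lowerPoint_add_smul (hC : IsConvexBody C) (he : ‖e‖ = 1) {z : E} (hz : z ∈ shadow C e)
    (a : ℝ) : lowerPoint C e (z + a • e) = lowerPoint C e z := by
  rw [lowerPoint, hC.height_add_smul he hz, lowerPoint]
  module

theorem exists_direction (hC : IsConvexBody C) {p : E} (hp : p ∈ frontier C) :
    ∃ e : E, ‖e‖ = 1 ∧ ∃ ρ : ℝ, 0 < ρ ∧ p + ρ • e ∈ interior C := by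
  obtain ⟨o, ho⟩ := hC.2.2
  have hne : o - p ≠ 0 := fun h => hp.2 (by rwa [← sub_eq_zero.1 h])
  have hpos : 0 < ‖o - p‖ := norm_pos_iff.2 hne
  refine ⟨‖o - p‖⁻¹ • (o - p), by rw [norm_smul, norm_inv, norm_norm, inv_mul_cancel₀ hpos.ne'],
    ‖o - p‖, hpos, ?_⟩
  rw [smul_smul, mul_inv_cancel₀ hpos.ne', one_smul, add_sub_cancel]
  exact ho

end IsConvexBody

end Chart

section Transport

variable {E : Type*} [NormedAddCommGroup E] [InnerProductSpace ℝ E]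

/-- The unit direction of the `j`-th edge of the polygonal line with vertices `r`. -/
noncomputable def edgeDir (r : ℕ → E) (j : ℕ) : E := ‖r (j + 1) - r j‖⁻¹ • (r (j + 1) - r j)

theorem norm_edgeDir {r : ℕ → E} {j : ℕ} (h : r j ≠ r (j + 1)) : ‖edgeDir r j‖ = 1 := by
  have : ‖r (j + 1) - r j‖ ≠ 0 := norm_ne_zero_iff.2 (sub_ne_zero.2 h.symm)
  rw [edgeDir, norm_smul, norm_inv, norm_norm, inv_mul_cancel₀ this]

theorem norm_smul_edgeDir {r : ℕ → E} {j : ℕ} (h : r j ≠ r (j + 1)) :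
    ‖r (j + 1) - r j‖ • edgeDir r j = r (j + 1) - r j := by
  have : ‖r (j + 1) - r j‖ ≠ 0 := norm_ne_zero_iff.2 (sub_ne_zero.2 h.symm)
  rw [edgeDir, smul_smul, mul_inv_cancel₀ this, one_smul]

theorem norm_smul_sub_le {w v : E} {l : ℝ} (hw : ‖w‖ = 1) (hl : 0 < l)
    (hv : inner ℝ v w ≤ l / 2) :
    ‖l • w - v‖ ≤ l - inner ℝ v w + (‖v‖ ^ 2 - inner ℝ v w ^ 2) / l := by
  set m := inner ℝ v w with hm
  have hP : 0 ≤ ‖v‖ ^ 2 - m ^ 2 := by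
    have := abs_real_inner_le_norm v w
    rw [hw, mul_one, ← hm] at this
    have := sq_le_sq' (by linarith [neg_abs_le m, abs_nonneg m]) ((le_abs_self m).trans this)
    linarith
  have hPl : 0 ≤ (‖v‖ ^ 2 - m ^ 2) / l := by positivity
  refine le_of_sq_le_sq ?_ (by linarith)
  have h1 : ‖l • w - v‖ ^ 2 = (l - m) ^ 2 + (‖v‖ ^ 2 - m ^ 2) := by
    rw [norm_sub_sq_real, norm_smul, hw, inner_smul_left, real_inner_comm, ← hm,
      Real.norm_eq_abs, mul_one, sq_abs]
    simp; ring
  have h2 : (‖v‖ ^ 2 - m ^ 2) = l * ((‖v‖ ^ 2 - m ^ 2) / l) := by field_simp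
  rw [h1]
  nlinarith

theorem norm_sq_smul_add_smul {u w : E} (huw : inner ℝ u w = 0) (hw : ‖w‖ = 1) (s a : ℝ) :
    ‖s • u + a • w‖ ^ 2 = s ^ 2 * ‖u‖ ^ 2 + a ^ 2 := by
  rw [norm_add_sq_real, norm_smul, norm_smul, inner_smul_left, inner_smul_right, huw, hw,
    Real.norm_eq_abs, Real.norm_eq_abs, mul_pow, mul_pow, sq_abs, sq_abs]
  simp

/-- Displacing the first vertex of a billiard-like polygonal line tangentially, the remaining
vertices can be moved so that all edges stay in the prescribed hyperplanes and the length obeys a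
second order upper bound. -/
theorem exists_transport (M : ℕ) : ∀ r ν : ℕ → E, (∀ j ≤ M, r j ≠ r (j + 1)) →
    (∀ j ≤ M, inner ℝ (ν j) (r (j + 1) - r j) = 0) →
    (∀ j < M, edgeDir r j ≠ edgeDir r (j + 1) ∧
      ∃ α : ℝ, α ≠ 0 ∧ edgeDir r j - edgeDir r (j + 1) = α • (ν j + ν (j + 1))) →
    ∃ δ : ℝ, 0 < δ ∧ ∀ v : E, inner ℝ (ν 0) v = 0 → ‖v‖ < δ →
      ∃ r' : ℕ → E, r' 0 = r 0 + v ∧ r' (M + 1) = r (M + 1) ∧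
        (∀ j ≤ M, inner ℝ (ν j) (r' j - r j) = 0 ∧
          inner ℝ (ν j) (r' (j + 1) - r (j + 1)) = 0) ∧
        polygonLength (M + 1) r' ≤ polygonLength (M + 1) r - inner ℝ v (edgeDir r 0) +
          (‖v‖ ^ 2 - inner ℝ v (edgeDir r 0) ^ 2) / polygonLength (M + 1) r := by
  induction M with
  | zero =>
    intro r ν hne hν _
    have h0 := hne 0 le_rfl
    have hpos : 0 < ‖r 1 - r 0‖ := norm_pos_iff.2 (sub_ne_zero.2 h0.symm)
    refine ⟨‖r 1 - r 0‖ / 2, by positivity, fun v hv hlt => ?_⟩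
    refine ⟨fun j => if j = 0 then r 0 + v else r j, by simp, by simp, ?_, ?_⟩
    · intro j hj
      obtain rfl : j = 0 := by omega
      simpa using hv
    · have h1 := norm_smul_sub_le (v := v) (norm_edgeDir h0) hpos (by
        have := real_inner_le_norm v (edgeDir r 0)
        rw [norm_edgeDir h0] at this
        linarith)
      have h2 := norm_smul_edgeDir h0
      simp only [zero_add] at h2
      rw [h2] at h1
      simp only [polygonLength, zero_add, Finset.sum_range_one, if_true, one_ne_zero, if_false]
      rw [norm_sub_rev (r 0) (r 1), norm_sub_rev (r 0 + v), ← sub_sub]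
      exact h1
  | succ M ih =>
    intro r ν hne hν hα
    obtain ⟨δ, hδ, H⟩ := ih (fun j => r (j + 1)) (fun j => ν (j + 1))
      (fun j hj => hne (j + 1) (by omega)) (fun j hj => hν (j + 1) (by omega))
      (fun j hj => hα (j + 1) (by omega))
    have h0 := hne 0 (Nat.zero_le _)
    have h1 := hne 1 (by omega)
    have hpos : 0 < ‖r 1 - r 0‖ := norm_pos_iff.2 (sub_ne_zero.2 h0.symm)
    set w := edgeDir r 0 with hw
    set w' := edgeDir r 1 with hw'
    have hw1 : ‖w‖ = 1 := norm_edgeDir h0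
    have hw1' : ‖w'‖ = 1 := norm_edgeDir h1
    have hdir : edgeDir (fun j => r (j + 1)) 0 = w' := rfl
    obtain ⟨hww, α, hα0, hαeq⟩ := hα 0 (Nat.succ_pos _)
    have hκ : 0 < 1 - inner ℝ w w' :=
      sub_pos.2 ((inner_lt_one_iff_real_of_norm_eq_one hw1 hw1').2 hww)
    set κ := 1 - inner ℝ w w' with hκdef
    set B := 2 * (1 + 1 / κ) with hB
    have hB0 : 0 < B := by positivity
    have hνw : inner ℝ (ν 0) w = 0 := by
      rw [hw, edgeDir, inner_smul_right]
      simp [hν 0 (Nat.zero_le _)]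
    set l := ‖r 1 - r 0‖ with hl
    set L := polygonLength (M + 1) (fun j => r (j + 1)) with hL
    have hL0 : 0 < L := by
      refine lt_of_lt_of_le (norm_pos_iff.2 (sub_ne_zero.2 h1)) ?_
      rw [hL, polygonLength_succ]
      exact le_add_of_nonneg_right (polygonLength_nonneg _ _)
    have hLr : polygonLength (M + 1 + 1) r = l + L := by
      rw [polygonLength_succ, norm_sub_rev]
    refine ⟨min δ (l / 2) / B, by positivity, fun v hv hvδ => ?_⟩
    rw [lt_div_iff₀ hB0, lt_min_iff] at hvδ
    set m := inner ℝ v w with hm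
    set u := v - m • w with hu
    set θ := L / (l + L) with hθ
    have hθ0 : 0 ≤ θ := by positivity
    have hθ1 : θ ≤ 1 := by rw [hθ, div_le_one (by positivity)]; linarith
    set a := θ * inner ℝ u w' / κ with ha
    set v' := θ • u + a • w with hv'
    have hww1 : inner ℝ w w = (1 : ℝ) := by rw [real_inner_self_eq_norm_sq, hw1, one_pow]
    have huw : inner ℝ u w = 0 := by
      rw [hu, inner_sub_left, inner_smul_left, hww1, ← hm]; simp
    have hm_le : |m| ≤ ‖v‖ := by
      have := abs_real_inner_le_norm v w
      rwa [hw1, mul_one] at this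
    have hu_le : ‖u‖ ≤ 2 * ‖v‖ := by
      refine (norm_sub_le _ _).trans ?_
      rw [norm_smul, hw1, mul_one, Real.norm_eq_abs]
      linarith
    have ha_le : |a| ≤ 2 * ‖v‖ * (1 / κ) := by
      rw [ha, abs_div, abs_mul, abs_of_nonneg hθ0, abs_of_pos hκ, mul_one_div]
      have := abs_real_inner_le_norm u w'
      rw [hw1', mul_one] at this
      have h2 : θ * |inner ℝ u w'| ≤ 2 * ‖v‖ := by nlinarith [abs_nonneg (inner ℝ u w' : ℝ)]
      exact div_le_div_of_nonneg_right h2 hκ.le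
    have hv'_le : ‖v'‖ ≤ ‖v‖ * B := by
      refine (norm_add_le _ _).trans ?_
      rw [norm_smul, norm_smul, hw1, mul_one, Real.norm_of_nonneg hθ0, Real.norm_eq_abs, hB]
      nlinarith [norm_nonneg u]
    have hv'w : inner ℝ v' w = a := by
      rw [hv', inner_add_left, inner_smul_left, inner_smul_left, huw, hww1]; simp
    have hvw_inner : inner ℝ v' w' = a := by
      rw [hv', inner_add_left, inner_smul_left, inner_smul_left]
      have : θ * inner ℝ u w' = a * κ := by rw [ha]; field_simp
      simp only [conj_trivial, this, hκdef]
      ring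
    have hu2 : ‖u‖ ^ 2 = ‖v‖ ^ 2 - m ^ 2 := by
      have h := norm_sq_smul_add_smul huw hw1 1 m
      have e : (1 : ℝ) • u + m • w = v := by rw [hu]; module
      rw [e] at h
      linarith
    have hvν0' : inner ℝ (ν 0) v' = 0 := by
      have : v' = θ • v + (a - θ * m) • w := by rw [hv', hu]; module
      rw [this, inner_add_right, inner_smul_right, inner_smul_right, hv, hνw]; simp
    have hvν1' : inner ℝ (ν 1) v' = 0 := by
      have h : inner ℝ (w - w') v' = 0 := by
        rw [inner_sub_left, real_inner_comm, hv'w, real_inner_comm, hvw_inner, sub_self]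
      rw [hαeq, inner_smul_left, inner_add_left, hvν0', zero_add] at h
      simpa [hα0] using h
    obtain ⟨r', hr0, hrM, hrν, hrL⟩ := H v' hvν1' (hv'_le.trans_lt hvδ.1)
    refine ⟨fun j => Nat.casesOn j (r 0 + v) r', rfl, hrM, ?_, ?_⟩
    · rintro (_ | j) hj
      · refine ⟨by simpa using hv, ?_⟩
        simpa [hr0] using hvν0'
      · exact hrν j (by omega)
    · rw [polygonLength_succ, hLr]
      change ‖r 0 + v - r' 0‖ + polygonLength (M + 1) r' ≤ _
      rw [hdir, hvw_inner] at hrL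
      have e : r 0 + v - r' 0 = -(l • w - (v - v')) := by
        rw [hr0, norm_smul_edgeDir h0]; simp only [zero_add]; abel
      have e2 : v - v' = (1 - θ) • u + (m - a) • w := by rw [hv', hu]; module
      have hin : inner ℝ (v - v') w = m - a := by rw [inner_sub_left, hv'w]
      have hfirst := norm_smul_sub_le (v := v - v') hw1 hpos (by
        rw [hin]
        have : m - a ≤ ‖v‖ * B := by
          rw [hB]; linarith [neg_abs_le a, le_abs_self m, norm_nonneg v]
        linarith)
      rw [hin, e2, norm_sq_smul_add_smul huw hw1, ← e2] at hfirst
      rw [hv', norm_sq_smul_add_smul huw hw1] at hrL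
      rw [e, norm_neg, ← hu2]
      have e3 : ((1 - θ) ^ 2 * ‖u‖ ^ 2 + (m - a) ^ 2 - (m - a) ^ 2) / l +
          (θ ^ 2 * ‖u‖ ^ 2 + a ^ 2 - a ^ 2) / L = ‖u‖ ^ 2 / (l + L) := by
        have : (1 - θ) = l / (l + L) := by rw [hθ]; field_simp; ring
        rw [this, hθ]
        field_simp
        ring
      linarith

end Transport

section Corners

variable {E : Type*} [NormedAddCommGroup E] [InnerProductSpace ℝ E] [FiniteDimensional ℝ E]

/-- The half-space `{x | ⟪ν, x⟫ < σ}`, with `ν` a unit vector, contains the interior of `C`, and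
its closure contains `C`. -/
structure IsOuterHalfSpace (C : Set E) (ν : E) (σ : ℝ) : Prop where
  norm_eq : ‖ν‖ = 1
  le : ∀ x ∈ C, inner ℝ ν x ≤ σ
  lt : ∀ x ∈ interior C, inner ℝ ν x < σ

variable {C : Set E}

theorem IsOuterHalfSpace.segment_subset {ν : E} {σ : ℝ} (h : IsOuterHalfSpace C ν σ) {a b : E}
    (ha : σ ≤ inner ℝ ν a) (hb : σ ≤ inner ℝ ν b) : segment ℝ a b ⊆ (interior C)ᶜ := by
  rintro _ ⟨s, t, hs, ht, hst, rfl⟩ hx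
  have := h.lt _ hx
  rw [inner_add_right, inner_smul_right, inner_smul_right] at this
  have h1 : s * σ + t * σ = σ := by rw [← add_mul, hst, one_mul]
  nlinarith [mul_le_mul_of_nonneg_left ha hs, mul_le_mul_of_nonneg_left hb ht]

theorem IsConvexBody.exists_isOuterHalfSpace (hC : IsConvexBody C) {a b : E}
    (h : segment ℝ a b ⊆ (interior C)ᶜ) :
    ∃ ν σ, IsOuterHalfSpace C ν σ ∧ σ ≤ inner ℝ ν a ∧ σ ≤ inner ℝ ν b := by
  obtain ⟨f, u, hf, hu⟩ := geometric_hahn_banach_open hC.2.1.interior isOpen_interior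
    (convex_segment (𝕜 := ℝ) a b) (Set.disjoint_left.2 fun x hx hx' => h hx' hx)
  set v := (InnerProductSpace.toDual ℝ E).symm f with hv
  have hfv : ∀ x, f x = inner ℝ v x := fun x => by
    rw [hv, InnerProductSpace.toDual_symm_apply]
  obtain ⟨o, ho⟩ := hC.2.2
  have hv0 : 0 < ‖v‖ := by
    rw [norm_pos_iff]
    intro h0
    have h1 := hf o ho
    have h2 := hu a (left_mem_segment ℝ a b)
    rw [hfv, h0, inner_zero_left] at h1 h2
    linarith
  have hin : ∀ x, inner ℝ (‖v‖⁻¹ • v) x = ‖v‖⁻¹ * f x := fun x => by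
    rw [inner_smul_left, hfv]; simp
  have hlt : ∀ x ∈ interior C, inner ℝ (‖v‖⁻¹ • v) x < ‖v‖⁻¹ * u := fun x hx => by
    rw [hin]; exact mul_lt_mul_of_pos_left (hf x hx) (inv_pos.2 hv0)
  refine ⟨‖v‖⁻¹ • v, ‖v‖⁻¹ * u, ⟨?_, fun x hx => ?_, hlt⟩, ?_, ?_⟩
  · rw [norm_smul, norm_inv, norm_norm, inv_mul_cancel₀ hv0.ne']
  · have hcl : x ∈ closure (interior C) := by
      rw [hC.2.1.closure_interior_eq_closure_of_nonempty_interior hC.2.2]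
      exact subset_closure hx
    exact closure_minimal (t := {x | inner ℝ (‖v‖⁻¹ • v) x ≤ ‖v‖⁻¹ * u}) (fun x hx => (hlt x hx).le)
      (isClosed_le (by fun_prop) continuous_const) hcl
  · rw [hin]; exact mul_le_mul_of_nonneg_left (hu a (left_mem_segment ℝ a b)) (by positivity)
  · rw [hin]; exact mul_le_mul_of_nonneg_left (hu b (right_mem_segment ℝ a b)) (by positivity)

/-- The broken line `a b c` avoids the interior of `C`, cannot be shortened by moving `b`, and
cannot be replaced by the segment from `a` to `c`. -/
structure IsTightCorner (C : Set E) (a b c : E) : Prop where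
  left : segment ℝ a b ⊆ (interior C)ᶜ
  right : segment ℝ b c ⊆ (interior C)ᶜ
  le : ∀ q, segment ℝ a q ⊆ (interior C)ᶜ → segment ℝ q c ⊆ (interior C)ᶜ →
    ‖a - b‖ + ‖b - c‖ ≤ ‖a - q‖ + ‖q - c‖
  not_subset : ¬segment ℝ a c ⊆ (interior C)ᶜ

namespace IsTightCorner

variable {a b c : E}

theorem symm (h : IsTightCorner C a b c) : IsTightCorner C c b a where
  left := segment_symm ℝ b c ▸ h.right
  right := segment_symm ℝ a b ▸ h.left
  le q h1 h2 := by
    rw [add_comm, norm_sub_rev c b, norm_sub_rev b a, add_comm ‖c - q‖, norm_sub_rev c q,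
      norm_sub_rev q a]
    exact h.le q (segment_symm ℝ q a ▸ h2) (segment_symm ℝ c q ▸ h1)
  not_subset := segment_symm ℝ a c ▸ h.not_subset

theorem left_ne (h : IsTightCorner C a b c) : a ≠ b := by
  rintro rfl
  exact h.not_subset h.right

theorem right_ne (h : IsTightCorner C a b c) : b ≠ c := h.symm.left_ne.symm

theorem not_wbtw (h : IsTightCorner C a b c) : ¬Wbtw ℝ a b c := by
  intro hw
  apply h.not_subset
  intro x hx
  rw [← insert_endpoints_openSegment] at hx
  rcases hx with rfl | rfl | hx
  · exact h.left (left_mem_segment ℝ _ _)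
  · exact h.right (right_mem_segment ℝ _ _)
  · rcases openSegment_subset_union a c (hw.imp fun _ ht => ht.2) hx with rfl | hx | hx
    · exact h.left (right_mem_segment ℝ _ _)
    · exact h.left (openSegment_subset_segment ℝ _ _ hx)
    · exact h.right (openSegment_subset_segment ℝ _ _ hx)

theorem active (h : IsTightCorner C a b c) {ν : E} {σ : ℝ} (hν : IsOuterHalfSpace C ν σ)
    (ha : σ ≤ inner ℝ ν a) (hb : σ ≤ inner ℝ ν b) : inner ℝ ν b = σ := by
  by_contra hne
  have hlt : σ < inner ℝ ν b := lt_of_le_of_ne hb (Ne.symm hne)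
  have hcont : Continuous fun t : ℝ => inner ℝ ν (AffineMap.lineMap b c t) := by fun_prop
  have hev : ∀ᶠ t in nhdsWithin (0 : ℝ) (Ioi 0),
      σ < inner ℝ ν (AffineMap.lineMap b c t) := by
    refine nhdsWithin_le_nhds ?_
    exact continuous_const.continuousAt.eventually_lt hcont.continuousAt (by simpa using hlt)
  have hev1 : ∀ᶠ t in nhdsWithin (0 : ℝ) (Ioi 0), t < 1 :=
    nhdsWithin_le_nhds (Iio_mem_nhds one_pos)
  obtain ⟨t, ⟨ht, ht1⟩, ht0⟩ := ((hev.and hev1).and self_mem_nhdsWithin).exists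
  have ht0 : 0 < t := ht0
  set q := AffineMap.lineMap b c t with hq
  have hbqc : Wbtw ℝ b q c := ⟨t, ⟨ht0.le, ht1.le⟩, rfl⟩
  have hbq : b ≠ q := by
    rw [hq, ne_comm, Ne, AffineMap.lineMap_eq_left_iff]
    exact not_or.2 ⟨h.right_ne, ht0.ne'⟩
  have hle := h.le q (hν.segment_subset ha ht.le) (by
    refine Subset.trans ?_ h.right
    exact (convex_segment b c).segment_subset (mem_segment_iff_wbtw.2 hbqc)
      (right_mem_segment ℝ b c))
  have h1 := hbqc.dist_add_dist
  have h2 : dist a b + dist b q = dist a q := by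
    refine le_antisymm ?_ (dist_triangle _ _ _)
    simp only [dist_eq_norm] at h1 ⊢
    linarith
  exact h.not_wbtw ((dist_add_dist_eq_iff.1 h2).trans_expand_left hbqc hbq)

/-- At a tight corner the two unit directions differ by a nonzero multiple of the sum of the
two separating normals. -/
theorem exists_sub_eq_smul (h : IsTightCorner C a b c) (hC : (interior C).Nonempty)
    {ν ν' : E} {σ σ' : ℝ}
    (hν : IsOuterHalfSpace C ν σ) (hν' : IsOuterHalfSpace C ν' σ')
    (ha : inner ℝ ν a = σ) (hb : inner ℝ ν b = σ)
    (hb' : inner ℝ ν' b = σ') (hc : inner ℝ ν' c = σ') :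
    ‖b - a‖⁻¹ • (b - a) ≠ ‖c - b‖⁻¹ • (c - b) ∧ ∃ α : ℝ, α ≠ 0 ∧
      ‖b - a‖⁻¹ • (b - a) - ‖c - b‖⁻¹ • (c - b) = α • (ν + ν') := by
  have hl : 0 < ‖b - a‖ := norm_pos_iff.2 (sub_ne_zero.2 h.left_ne.symm)
  have hl' : 0 < ‖c - b‖ := norm_pos_iff.2 (sub_ne_zero.2 h.right_ne.symm)
  set l := ‖b - a‖ with hldef
  set l' := ‖c - b‖ with hldef'
  set w := l⁻¹ • (b - a) with hw
  set w' := l'⁻¹ • (c - b) with hw'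
  have hlw : l • w = b - a := by rw [hw, smul_inv_smul₀ hl.ne']
  have hlw' : l' • w' = c - b := by rw [hw', smul_inv_smul₀ hl'.ne']
  have hw1 : ‖w‖ = 1 := by rw [hw, norm_smul, norm_inv, Real.norm_of_nonneg hl.le, ← hldef,
    inv_mul_cancel₀ hl.ne']
  have hw1' : ‖w'‖ = 1 := by rw [hw', norm_smul, norm_inv, Real.norm_of_nonneg hl'.le, ← hldef',
    inv_mul_cancel₀ hl'.ne']
  have hνw : inner ℝ ν w = 0 := by
    rw [hw, inner_smul_right, inner_sub_right, ha, hb]; simp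
  have hνw' : inner ℝ ν' w' = 0 := by
    rw [hw', inner_smul_right, inner_sub_right, hb', hc]; simp
  have hne : w ≠ w' := by
    intro heq
    apply h.not_wbtw
    rw [← mem_segment_iff_wbtw, mem_segment_iff_sameRay, ← hlw, ← hlw', ← heq]
    exact (SameRay.sameRay_nonneg_smul_left _ hl.le).trans
      (SameRay.sameRay_nonneg_smul_right _ hl'.le) (by
        intro h0; rw [h0, norm_zero] at hw1; exact absurd hw1 (by norm_num))
  refine ⟨hne, ?_⟩
  set D := w - w' with hD
  have hD0 : D ≠ 0 := sub_ne_zero.2 hne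
  have hvar : ∀ d : E, 0 ≤ inner ℝ ν d → 0 ≤ inner ℝ ν' d → 0 ≤ inner ℝ D d := by
    intro d hd hd'
    set k := (‖d‖ ^ 2 - inner ℝ d w ^ 2) / l + (‖d‖ ^ 2 - inner ℝ d w' ^ 2) / l' with hk
    have key : ∀ᶠ t in nhdsWithin (0 : ℝ) (Ioi 0), 0 ≤ inner ℝ D d + t * k := by
      have e1 : ∀ᶠ t in nhdsWithin (0 : ℝ) (Ioi 0), -(t * inner ℝ d w) < l / 2 := by
        refine nhdsWithin_le_nhds (ContinuousAt.eventually_lt (by fun_prop) continuousAt_const ?_)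
        simpa using hl
      have e2 : ∀ᶠ t in nhdsWithin (0 : ℝ) (Ioi 0), t * inner ℝ d w' < l' / 2 := by
        refine nhdsWithin_le_nhds (ContinuousAt.eventually_lt (by fun_prop) continuousAt_const ?_)
        simpa using hl'
      filter_upwards [e1, e2, self_mem_nhdsWithin] with t h1 h2 ht
      have ht : 0 < t := ht
      have hq : σ ≤ inner ℝ ν (b + t • d) := by
        rw [inner_add_right, hb, inner_smul_right]
        exact le_add_of_nonneg_right (by positivity)
      have hq' : σ' ≤ inner ℝ ν' (b + t • d) := by
        rw [inner_add_right, hb', inner_smul_right]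
        exact le_add_of_nonneg_right (by positivity)
      have h3 := h.le (b + t • d) (hν.segment_subset ha.ge hq) (hν'.segment_subset hq' hc.ge)
      have h4 := norm_smul_sub_le (v := -(t • d)) hw1 hl (by
        rw [inner_neg_left, inner_smul_left]; simpa using h1.le)
      have h5 := norm_smul_sub_le (v := t • d) hw1' hl' (by
        rw [inner_smul_left]; simpa using h2.le)
      rw [hlw, show b - a - -(t • d) = b + t • d - a by abel, norm_sub_rev, norm_neg,
        inner_neg_left] at h4
      rw [hlw', show c - b - t • d = c - (b + t • d) by abel, norm_sub_rev] at h5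
      rw [norm_sub_rev a b, norm_sub_rev b c] at h3
      simp only [inner_smul_left, conj_trivial, norm_smul, Real.norm_eq_abs, mul_pow, sq_abs,
        neg_sq] at h4 h5
      have e : inner ℝ D d = inner ℝ d w - inner ℝ d w' := by
        rw [hD, real_inner_comm, inner_sub_right]
      have e6 : (t ^ 2 * ‖d‖ ^ 2 - t ^ 2 * inner ℝ d w ^ 2) / l +
          (t ^ 2 * ‖d‖ ^ 2 - t ^ 2 * inner ℝ d w' ^ 2) / l' = t * (t * k) := by
        rw [hk]; ring
      have : 0 ≤ t * (inner ℝ D d + t * k) := by rw [e, mul_add, ← e6]; linarith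
      exact nonneg_of_mul_nonneg_right this ht
    have hlim : Filter.Tendsto (fun t : ℝ => inner ℝ D d + t * k) (nhdsWithin 0 (Ioi 0))
        (nhds (inner ℝ D d)) := by
      have : ContinuousAt (fun t : ℝ => inner ℝ D d + t * k) 0 := by fun_prop
      have h2 := this.tendsto.mono_left (nhdsWithin_le_nhds (s := Ioi (0 : ℝ)))
      simpa using h2
    exact ge_of_tendsto hlim key
  have hspan : D ∈ Submodule.span ℝ {ν, ν'} := by
    rw [← Submodule.orthogonal_orthogonal (Submodule.span ℝ {ν, ν'}), Submodule.mem_orthogonal]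
    intro d hd
    rw [Submodule.mem_orthogonal] at hd
    have h1 := hd ν (Submodule.subset_span (by simp))
    have h2 := hd ν' (Submodule.subset_span (by simp))
    have h3 := hvar d h1.ge h2.ge
    have h4 := hvar (-d) (by rw [inner_neg_right, h1, neg_zero]) (by
      rw [inner_neg_right, h2, neg_zero])
    rw [inner_neg_right] at h4
    rw [real_inner_comm]
    linarith
  obtain ⟨α, β, hαβ⟩ := Submodule.mem_span_pair.1 hspan
  set g := inner ℝ ν ν' with hg
  have hνν : inner ℝ ν ν = (1 : ℝ) := by rw [real_inner_self_eq_norm_sq, hν.norm_eq, one_pow]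
  have hνν' : inner ℝ ν' ν' = (1 : ℝ) := by
    rw [real_inner_self_eq_norm_sq, hν'.norm_eq, one_pow]
  have hww : inner ℝ w w = (1 : ℝ) := by rw [real_inner_self_eq_norm_sq, hw1, one_pow]
  have hww' : inner ℝ w' w' = (1 : ℝ) := by rw [real_inner_self_eq_norm_sq, hw1', one_pow]
  have hg' : inner ℝ ν' ν = g := by rw [real_inner_comm]
  have hDν : inner ℝ ν D = α + β * g := by
    rw [← hαβ, inner_add_right, inner_smul_right, inner_smul_right, hνν]; ring
  have hDν' : inner ℝ ν' D = α * g + β := by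
    rw [← hαβ, inner_add_right, inner_smul_right, inner_smul_right, hνν', hg']; ring
  have hDD : 0 < inner ℝ D D := by
    rw [real_inner_self_eq_norm_sq]
    have := norm_pos_iff.2 hD0
    positivity
  have hgm : g ≠ -1 := by
    intro hgm
    obtain ⟨o, ho⟩ := hC
    have hν'eq : ν' = -ν := by
      have : -g = 1 := by rw [hgm]; norm_num
      rw [hg, ← inner_neg_left] at this
      exact ((inner_eq_one_iff_of_norm_eq_one (by rw [norm_neg, hν.norm_eq]) hν'.norm_eq).1
        this).symm
    have h1 := hν.lt o ho
    have h2 := hν'.lt o ho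
    rw [← hb] at h1
    rw [← hb', hν'eq, inner_neg_left, inner_neg_left] at h2
    linarith
  have hgp : g ≠ 1 := by
    intro hgp
    have hν'eq : ν = ν' := (inner_eq_one_iff_of_norm_eq_one hν.norm_eq hν'.norm_eq).1 hgp
    have : inner ℝ ν D = 0 := by
      rw [hD, inner_sub_right, hνw, hν'eq, hνw', sub_zero]
    rw [← hαβ, inner_add_left, inner_smul_left, inner_smul_left, hαβ, ← hν'eq, this] at hDD
    simp at hDD
  have habs : |g| ≤ 1 := by
    have := abs_real_inner_le_norm ν ν'
    rwa [hν.norm_eq, hν'.norm_eq, mul_one] at this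
  have hg2 : 0 < 1 - g ^ 2 := by
    have h1 : g < 1 := lt_of_le_of_ne (abs_le.1 habs).2 hgp
    have h2 : -1 < g := lt_of_le_of_ne (abs_le.1 habs).1 (Ne.symm hgm)
    nlinarith
  have hα : 0 ≤ α := by
    have h1 := hvar (ν - g • ν') (by
      rw [inner_sub_right, inner_smul_right, hνν]; nlinarith) (by
      rw [inner_sub_right, inner_smul_right, hg', hνν']; linarith)
    rw [real_inner_comm, inner_sub_left, inner_smul_left, hDν, hDν'] at h1
    simp only [conj_trivial] at h1
    have : 0 ≤ (1 - g ^ 2) * α := by linarith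
    exact nonneg_of_mul_nonneg_right this hg2
  have hβ : 0 ≤ β := by
    have h1 := hvar (ν' - g • ν) (by
      rw [inner_sub_right, inner_smul_right, hνν]; linarith) (by
      rw [inner_sub_right, inner_smul_right, hg', hνν']; nlinarith)
    rw [real_inner_comm, inner_sub_left, inner_smul_left, hDν, hDν'] at h1
    simp only [conj_trivial] at h1
    have : 0 ≤ (1 - g ^ 2) * β := by linarith
    exact nonneg_of_mul_nonneg_right this hg2
  have h1 : inner ℝ w D = 1 - inner ℝ w w' := by rw [hD, inner_sub_right, hww]
  have h2 : inner ℝ w' D = inner ℝ w w' - 1 := by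
    rw [hD, inner_sub_right, hww', real_inner_comm]
  have h3 : inner ℝ w D = β * (α * g + β) := by
    conv_lhs => rw [← hαβ]
    rw [inner_add_right, inner_smul_right, inner_smul_right, real_inner_comm, hνw, ← hDν', hD,
      inner_sub_right, hνw', real_inner_comm w]
    ring
  have h4 : inner ℝ w' D = -(α * (α + β * g)) := by
    conv_lhs => rw [← hαβ]
    rw [inner_add_right, inner_smul_right, inner_smul_right, real_inner_comm ν' w', hνw', ← hDν,
      hD, inner_sub_right, hνw, real_inner_comm w']
    ring
  have hsq : α ^ 2 = β ^ 2 := by linarith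
  have heq : α = β := (sq_eq_sq₀ hα hβ).1 hsq
  refine ⟨α, ?_, ?_⟩
  · rintro rfl
    rw [← heq] at hαβ
    simp at hαβ
    exact hD0 hαβ.symm
  · rw [← hαβ, ← heq, smul_add]

end IsTightCorner

end Corners

section ShortestPolygons

theorem polygonLength_add {E : Type*} [NormedAddCommGroup E] [NormedSpace ℝ E] (a b : ℕ)
    (r : ℕ → E) :
    polygonLength (a + b) r = polygonLength a r + polygonLength b (fun i => r (a + i)) := by
  simp only [polygonLength, Finset.sum_range_add, add_assoc]

theorem polygonLength_congr {E : Type*} [NormedAddCommGroup E] [NormedSpace ℝ E] {a : ℕ}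
    {r r' : ℕ → E} (h : ∀ i ≤ a, r i = r' i) : polygonLength a r = polygonLength a r' :=
  Finset.sum_congr rfl fun i hi => by
    have := Finset.mem_range.1 hi
    rw [h i (by omega), h (i + 1) (by omega)]

theorem norm_sub_le_polygonLength {E : Type*} [NormedAddCommGroup E] [NormedSpace ℝ E] (N : ℕ)
    (r : ℕ → E) : ‖r 0 - r N‖ ≤ polygonLength N r := by
  simpa only [polygonLength, dist_eq_norm] using dist_le_range_sum_dist r N

variable {E : Type*} [NormedAddCommGroup E] [InnerProductSpace ℝ E] [FiniteDimensional ℝ E]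
  {C : Set E}

theorem isTightCorner_of_shortest {M : ℕ} {r : ℕ → E} (hr : PolygonIn (interior C)ᶜ M r)
    (hopt : ∀ r' : ℕ → E, r' 0 = r 0 → r' M = r M → PolygonIn (interior C)ᶜ M r' →
      polygonLength M r ≤ polygonLength M r')
    (hmin : ∀ M' < M, ∀ r' : ℕ → E, r' 0 = r 0 → r' M' = r M →
      PolygonIn (interior C)ᶜ M' r' → polygonLength M r < polygonLength M' r')
    {j : ℕ} (hj : j + 1 < M) : IsTightCorner C (r j) (r (j + 1)) (r (j + 2)) := by
  obtain ⟨k, rfl⟩ := Nat.exists_eq_add_of_le (show j + 2 ≤ M by omega)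
  have hsplit : ∀ r' : ℕ → E, polygonLength (j + 2 + k) r' = polygonLength j r' +
      (‖r' j - r' (j + 1)‖ + ‖r' (j + 1) - r' (j + 2)‖) +
      polygonLength k (fun i => r' (j + 2 + i)) := by
    intro r'
    rw [polygonLength_add, polygonLength_add]
    simp [polygonLength, Finset.sum_range_succ, add_assoc]
  refine ⟨hr j (by omega), hr (j + 1) (by omega), fun q h1 h2 => ?_, fun hsub => ?_⟩
  · have h := hopt (Function.update r (j + 1) q) (Function.update_of_ne (by omega) _ _)
      (Function.update_of_ne (by omega) _ _) (fun i hi => ?_)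
    · rw [hsplit, hsplit, Function.update_self, Function.update_of_ne (by omega),
        Function.update_of_ne (by omega), polygonLength_congr (r := Function.update r (j + 1) q)
        (a := j) (fun i hi => Function.update_of_ne (by omega) _ _),
        polygonLength_congr (a := k) (r := fun i => Function.update r (j + 1) q (j + 2 + i))
        (fun i hi => Function.update_of_ne (by omega) _ _)] at h
      linarith
    · by_cases hi1 : i = j
      · subst hi1
        rwa [Function.update_self, Function.update_of_ne (by omega)]
      by_cases hi2 : i = j + 1
      · subst hi2
        rwa [Function.update_self, Function.update_of_ne (by omega)]
      rw [Function.update_of_ne hi2, Function.update_of_ne (by omega)]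
      exact hr i hi
  · set r' : ℕ → E := fun i => if i ≤ j then r i else r (i + 1) with hr'
    have h := hmin (j + 1 + k) (by omega) r' (by simp [hr']) (by
      rw [hr']; simp only [show ¬(j + 1 + k ≤ j) by omega, if_false]; congr 1; omega)
      (fun i hi => ?_)
    · have e : polygonLength (j + 1 + k) r' = polygonLength j r + ‖r j - r (j + 2)‖ +
          polygonLength k (fun i => r (j + 2 + i)) := by
        rw [polygonLength_add, polygonLength_add]
        congr 1
        · congr 1
          · exact polygonLength_congr fun i hi => by simp [hr', hi]
          · simp [polygonLength, hr']
        · exact polygonLength_congr fun i hi => by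
            simp only [hr', show ¬(j + 1 + i ≤ j) by omega, if_false]; congr 1; omega
      rw [e, hsplit] at h
      have := norm_sub_le_norm_sub_add_norm_sub (r j) (r (j + 1)) (r (j + 2))
      linarith
    · rcases lt_trichotomy i j with hij | rfl | hij
      · simp only [hr', hij.le, Nat.succ_le_of_lt hij, if_true]
        exact hr i (by omega)
      · simpa [hr'] using hsub
      · simp only [hr', show ¬(i ≤ j) by omega, show ¬(i + 1 ≤ j) by omega, if_false]
        exact hr (i + 1) (by omega)

/-- A shortest polygonal line outside a convex body, with the least number of edges, is supported
by hyperplanes touching the body along it, and obeys the reflection law at its corners. -/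
theorem IsConvexBody.shortest_polygon (hC : IsConvexBody C) {M : ℕ} {r : ℕ → E}
    (hr : PolygonIn (interior C)ᶜ M r) (hend : r M ∈ C) (hne : r 0 ≠ r M)
    (hstart : ∀ ν σ, IsOuterHalfSpace C ν σ → σ ≤ inner ℝ ν (r 0) → σ ≤ inner ℝ ν (r 1) →
      inner ℝ ν (r 0) ≤ σ)
    (hopt : ∀ r' : ℕ → E, r' 0 = r 0 → r' M = r M → PolygonIn (interior C)ᶜ M r' →
      polygonLength M r ≤ polygonLength M r')
    (hmin : ∀ M' < M, ∀ r' : ℕ → E, r' 0 = r 0 → r' M' = r M →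
      PolygonIn (interior C)ᶜ M' r' → polygonLength M r < polygonLength M' r') :
    ∃ (ν : ℕ → E) (σ : ℕ → ℝ), (∀ j < M, IsOuterHalfSpace C (ν j) (σ j) ∧
        inner ℝ (ν j) (r j) = σ j ∧ inner ℝ (ν j) (r (j + 1)) = σ j ∧ r j ≠ r (j + 1)) ∧
      ∀ j, j + 1 < M → edgeDir r j ≠ edgeDir r (j + 1) ∧
        ∃ α : ℝ, α ≠ 0 ∧ edgeDir r j - edgeDir r (j + 1) = α • (ν j + ν (j + 1)) := by
  have htight := fun j (hj : j + 1 < M) => isTightCorner_of_shortest hr hopt hmin hj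
  have hex : ∀ j, ∃ ν σ, j < M → IsOuterHalfSpace C ν σ ∧ σ ≤ inner ℝ ν (r j) ∧
      σ ≤ inner ℝ ν (r (j + 1)) := by
    intro j
    by_cases hj : j < M
    · obtain ⟨ν, σ, h⟩ := hC.exists_isOuterHalfSpace (hr j hj)
      exact ⟨ν, σ, fun _ => h⟩
    · exact ⟨0, 0, fun h => absurd h hj⟩
  choose ν σ hνσ using hex
  have hl : ∀ j < M, inner ℝ (ν j) (r j) = σ j := by
    intro j hj
    obtain ⟨h1, h2, h3⟩ := hνσ j hj
    rcases j with _ | j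
    · exact le_antisymm (hstart _ _ h1 h2 h3) h2
    · exact (htight j hj).symm.active h1 h3 h2
  have hrt : ∀ j < M, inner ℝ (ν j) (r (j + 1)) = σ j := by
    intro j hj
    obtain ⟨h1, h2, h3⟩ := hνσ j hj
    rcases (Nat.succ_le_of_lt hj).eq_or_lt with h | h
    · refine le_antisymm ?_ h3
      have h4 : j + 1 = M := h
      rw [h4]
      exact h1.le _ hend
    · exact (htight j h).active h1 h2 h3
  refine ⟨ν, σ, fun j hj => ⟨(hνσ j hj).1, hl j hj, hrt j hj, ?_⟩, fun j hj => ?_⟩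
  · by_cases h : j + 1 < M
    · exact (htight j h).left_ne
    · obtain rfl : M = j + 1 := by omega
      rcases j with _ | j
      · exact hne
      · exact (htight j (by omega)).right_ne
  · exact (htight j hj).exists_sub_eq_smul hC.2.2 (hνσ j (by omega)).1 (hνσ (j + 1) hj).1
      (hl j (by omega)) (hrt j (by omega)) (hl (j + 1) hj) (hrt (j + 1) hj)

end ShortestPolygons

section Probes

variable {E : Type*} [NormedAddCommGroup E] [NormedSpace ℝ E]

/-- A polygonal line in `S` with `N` edges, ending in `K` and starting at distance `s` from the
point `P t`, in direction `-e`. -/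
structure IsProbe (S K : Set E) (e : E) (P : ℝ → E) (N : ℕ) (t s : ℝ) (r : ℕ → E) : Prop where
  mem_Icc : t ∈ Icc (0 : ℝ) 1
  nonneg : 0 ≤ s
  start : r 0 = P t - s • e
  polygonIn : PolygonIn S N r
  mem : r N ∈ K

variable {S K : Set E} {e : E} {P : ℝ → E} {G : ℝ → ℝ}

theorem isClosed_polygonIn (hS : IsClosed S) (N : ℕ) : IsClosed {r : ℕ → E | PolygonIn S N r} := by
  have : {r : ℕ → E | PolygonIn S N r} = ⋂ j ∈ Finset.range N, ⋂ θ ∈ Icc (0 : ℝ) 1,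
      {r : ℕ → E | r j + θ • (r (j + 1) - r j) ∈ S} := by
    ext r
    simp only [PolygonIn, segment_eq_image', image_subset_iff, mem_ofPred_eq, mem_iInter,
      Finset.mem_range]
    rfl
  rw [this]
  refine isClosed_biInter fun j _ => isClosed_biInter fun θ _ => hS.preimage ?_
  fun_prop

theorem IsProbe.truncate (hKS : K ⊆ S) {N M : ℕ} {t s : ℝ} {r : ℕ → E} (h : IsProbe S K e P N t s r)
    (hNM : N ≤ M) : IsProbe S K e P M t s (fun j => r (min j N)) ∧
      polygonLength M (fun j => r (min j N)) = polygonLength N r := by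
  refine ⟨⟨h.mem_Icc, h.nonneg, by simpa using h.start, fun j hj => ?_, by
    simpa [hNM] using h.mem⟩, ?_⟩
  · rcases lt_or_ge j N with hjN | hjN
    · simp only [min_eq_left hjN.le, min_eq_left (Nat.succ_le_of_lt hjN)]
      exact h.polygonIn j hjN
    · simp only [min_eq_right hjN, min_eq_right (hjN.trans (Nat.le_succ j)), segment_same,
        singleton_subset_iff]
      exact hKS h.mem
  · obtain ⟨k, rfl⟩ := Nat.exists_eq_add_of_le hNM
    rw [polygonLength_add]
    have h1 : polygonLength k (fun i => r (min (N + i) N)) = 0 :=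
      Finset.sum_eq_zero fun i _ => by simp
    rw [h1, add_zero]
    exact polygonLength_congr fun i hi => by simp [hi]

/-- Among the probes of negative cost there is one of least cost and with the least number of
edges. -/
theorem exists_minimal_probe [ProperSpace E] (hS : IsClosed S) (hK : IsClosed K) (hKS : K ⊆ S)
    (he : ‖e‖ = 1)
    (hP : ContinuousOn P (Icc 0 1)) (hG : ContinuousOn G (Icc 0 1))
    (hneg : ∃ N t s r, IsProbe S K e P N t s r ∧ 2 * s + polygonLength N r - G t < 0) :
    ∃ M t s r, IsProbe S K e P M t s r ∧ 2 * s + polygonLength M r - G t < 0 ∧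
      (∀ t' s' r', IsProbe S K e P M t' s' r' →
        2 * s + polygonLength M r - G t ≤ 2 * s' + polygonLength M r' - G t') ∧
      ∀ M' < M, ∀ t' s' r', IsProbe S K e P M' t' s' r' →
        2 * s + polygonLength M r - G t < 2 * s' + polygonLength M' r' - G t' := by
  obtain ⟨N, t₀, s₀, r₀, hprobe₀, hneg₀⟩ := hneg
  obtain ⟨g, hg⟩ := (isCompact_Icc.image_of_continuousOn hG).bddAbove
  obtain ⟨b, hb⟩ := (isCompact_Icc.image_of_continuousOn hP.norm).bddAbove
  have hgt : ∀ t ∈ Icc (0 : ℝ) 1, G t ≤ g := fun t ht => hg (mem_image_of_mem _ ht)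
  have hbt : ∀ t ∈ Icc (0 : ℝ) 1, ‖P t‖ ≤ b := fun t ht => hb (mem_image_of_mem _ ht)
  set B : Set (ℝ × ℝ × (ℕ → E)) :=
    Icc 0 1 ×ˢ Icc 0 g ×ˢ Set.pi univ (fun _ : ℕ => Metric.closedBall (0 : E) (b + g)) with hB
  set A : Set (ℝ × ℝ × (ℕ → E)) := B ∩ {x | IsProbe S K e P N x.1 x.2.1 x.2.2} with hA
  have hBc : IsCompact B := isCompact_Icc.prod (isCompact_Icc.prod
    (isCompact_univ_pi fun _ => isCompact_closedBall _ _))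
  have hmaps : MapsTo (fun x : ℝ × ℝ × (ℕ → E) => x.1) B (Icc 0 1) := fun x hx => hx.1
  have hPB : ContinuousOn (fun x : ℝ × ℝ × (ℕ → E) => x.2.2 0 - (P x.1 - x.2.1 • e)) B :=
    ContinuousOn.sub (by fun_prop) ((hP.comp (by fun_prop) hmaps).sub (by fun_prop))
  have hAeq : A = (B ∩ (fun x : ℝ × ℝ × (ℕ → E) => x.2.2 0 - (P x.1 - x.2.1 • e)) ⁻¹' {0}) ∩
      ((fun x : ℝ × ℝ × (ℕ → E) => x.2.2) ⁻¹' {r | PolygonIn S N r} ∩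
        (fun x : ℝ × ℝ × (ℕ → E) => x.2.2 N) ⁻¹' K) := by
    ext x
    constructor
    · rintro ⟨hx, hx'⟩
      exact ⟨⟨hx, sub_eq_zero.2 hx'.start⟩, hx'.polygonIn, hx'.mem⟩
    · rintro ⟨⟨hx, hx1⟩, hx2, hx3⟩
      exact ⟨hx, hx.1, hx.2.1.1, sub_eq_zero.1 hx1, hx2, hx3⟩
  have hAc : IsCompact A := by
    refine hBc.of_isClosed_subset ?_ inter_subset_left
    rw [hAeq]
    refine (hPB.preimage_isClosed_of_isClosed hBc.isClosed isClosed_singleton).inter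
      (((isClosed_polygonIn hS N).preimage (by fun_prop)).inter (hK.preimage (by fun_prop)))
  have hJ : ContinuousOn (fun x : ℝ × ℝ × (ℕ → E) =>
      2 * x.2.1 + polygonLength N x.2.2 - G x.1) A := by
    refine ContinuousOn.sub ?_ (hG.comp (by fun_prop) fun x hx => hmaps hx.1)
    unfold polygonLength
    fun_prop
  have hmem : ∀ t s r, IsProbe S K e P N t s r → 2 * s + polygonLength N r - G t < 0 →
      (t, s, fun j => r (min j N)) ∈ A := by
    intro t s r h hlt
    have h1 := (h.truncate hKS le_rfl)
    have hL := polygonLength_nonneg N r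
    have hGt := hgt t h.mem_Icc
    have hPt := hbt t h.mem_Icc
    refine ⟨⟨h.mem_Icc, ⟨h.nonneg, by linarith [h.nonneg]⟩, fun j _ => ?_⟩, h1.1⟩
    rw [mem_closedBall_zero_iff]
    have h2 : ‖r 0 - r (min j N)‖ ≤ polygonLength N r := by
      refine (norm_sub_le_polygonLength (min j N) r).trans ?_
      obtain ⟨k, hk⟩ := Nat.exists_eq_add_of_le (min_le_right j N)
      conv_rhs => rw [hk]
      rw [polygonLength_add]
      exact le_add_of_nonneg_right (polygonLength_nonneg _ _)
    have h3 : ‖r 0‖ ≤ ‖P t‖ + s := by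
      rw [h.start]
      refine (norm_sub_le _ _).trans ?_
      rw [norm_smul, he, mul_one, Real.norm_of_nonneg h.nonneg]
    have h4 := norm_sub_norm_le (r (min j N)) (r 0)
    rw [norm_sub_rev] at h4
    show ‖r (min j N)‖ ≤ b + g
    linarith [h.nonneg]
  obtain ⟨⟨t₁, s₁, r₁⟩, hx₁, hmin⟩ := hAc.exists_isMinOn ⟨_, hmem _ _ _ hprobe₀ hneg₀⟩ hJ
  have hmin' : ∀ t s r, IsProbe S K e P N t s r → 2 * s + polygonLength N r - G t < 0 →
      2 * s₁ + polygonLength N r₁ - G t₁ ≤ 2 * s + polygonLength N r - G t := by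
    intro t s r h hlt
    have := hmin (hmem t s r h hlt)
    simpa [(h.truncate hKS le_rfl).2] using this
  set J₁ := 2 * s₁ + polygonLength N r₁ - G t₁ with hJ₁
  have hJneg : J₁ < 0 := (hmin' _ _ _ hprobe₀ hneg₀).trans_lt hneg₀
  have hminN : ∀ M ≤ N, ∀ t s r, IsProbe S K e P M t s r →
      J₁ ≤ 2 * s + polygonLength M r - G t := by
    intro M hM t s r h
    obtain ⟨h1, h2⟩ := h.truncate hKS hM
    rcases lt_or_ge (2 * s + polygonLength M r - G t) 0 with hlt | hge
    · rw [← h2] at hlt ⊢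
      exact hmin' _ _ _ h1 hlt
    · exact hJneg.le.trans hge
  classical
  have hex : ∃ M, ∃ t s r, IsProbe S K e P M t s r ∧ 2 * s + polygonLength M r - G t ≤ J₁ :=
    ⟨N, t₁, s₁, r₁, hx₁.2, le_rfl⟩
  have hfind : Nat.find hex ≤ N := Nat.find_min' hex ⟨t₁, s₁, r₁, hx₁.2, le_rfl⟩
  obtain ⟨t, s, r, h, hle⟩ := Nat.find_spec hex
  refine ⟨Nat.find hex, t, s, r, h, hle.trans_lt hJneg, fun t' s' r' h' =>
    hle.trans (hminN _ hfind _ _ _ h'), fun M' hM' t' s' r' h' => ?_⟩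
  refine hle.trans_lt (lt_of_not_ge fun hge => Nat.find_min hex hM' ⟨t', s', r', h', hge⟩)

end Probes

section Semiconcavity

variable {E : Type*} [NormedAddCommGroup E] [InnerProductSpace ℝ E] [FiniteDimensional ℝ E]

/-- Quantitative data for graphing `frontier C` over the ball `ball p ε` in direction `e`, away
from `K`. -/
structure IsSurfaceChart (C K : Set E) (e p : E) (ε ρ η δ : ℝ) : Prop where
  norm_eq : ‖e‖ = 1
  ρ_pos : 0 < ρ
  η_pos : 0 < η
  δ_pos : 0 < δ
  ball_subset : Metric.ball p ε ⊆ shadow C e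
  closedBall_subset : ∀ z ∈ Metric.ball p ε, Metric.closedBall (lowerPoint C e z + ρ • e) η ⊆ C
  le_norm : ∀ z ∈ Metric.ball p ε, ∀ s : ℝ, 0 ≤ s → ∀ y ∈ K,
    δ ≤ ‖lowerPoint C e z - s • e - y‖

namespace IsSurfaceChart

variable {C K : Set E} {e p : E} {ε ρ η δ : ℝ}

theorem add_mem_interior (hch : IsSurfaceChart C K e p ε ρ η δ) {z : E}
    (hz : z ∈ Metric.ball p ε) : lowerPoint C e z + ρ • e ∈ interior C :=
  mem_interior.2 ⟨_, Metric.ball_subset_closedBall.trans (hch.closedBall_subset z hz),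
    Metric.isOpen_ball, Metric.mem_ball_self hch.η_pos⟩

theorem lowerPoint_mem_frontier (hch : IsSurfaceChart C K e p ε ρ η δ) (h : SurfacePair C K)
    {z : E} (hz : z ∈ Metric.ball p ε) : lowerPoint C e z ∈ frontier C :=
  h.body.lowerPoint_mem_frontier hch.norm_eq (hch.ball_subset hz)

theorem segment_subset (hch : IsSurfaceChart C K e p ε ρ η δ) (h : SurfacePair C K)
    {z : E} (hz : z ∈ Metric.ball p ε) {s : ℝ} (hs : 0 ≤ s) :
    segment ℝ (lowerPoint C e z) (lowerPoint C e z - s • e) ⊆ (interior C)ᶜ := by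
  have h1 := segment_ray_subset h.body.2.1
    (SurfacePair.notMem_interior (hch.lowerPoint_mem_frontier h hz)) (hch.add_mem_interior hz)
    (div_nonneg hs hch.ρ_pos.le)
  have e1 : lowerPoint C e z + (s / ρ) • (lowerPoint C e z - (lowerPoint C e z + ρ • e)) =
      lowerPoint C e z - s • e := by
    rw [sub_add_cancel_left, smul_neg, smul_smul, div_mul_cancel₀ _ hch.ρ_pos.ne', ← sub_eq_add_neg]
  rwa [e1] at h1

theorem surfDist_le (hch : IsSurfaceChart C K e p ε ρ η δ) (h : SurfacePair C K)
    {z : E} (hz : z ∈ Metric.ball p ε) {s : ℝ} (hs : 0 ≤ s) {r : ℕ → E} {N : ℕ}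
    (h0 : r 0 = lowerPoint C e z - s • e) (hr : PolygonIn (interior C)ᶜ N r) (hN : r N ∈ K) :
    surfDist (frontier C) K (lowerPoint C e z) ≤ s + polygonLength N r := by
  have hj : PolygonJoin (interior C)ᶜ (lowerPoint C e z - s • e) (r N) (polygonLength N r) :=
    ⟨N, r, h0, rfl, hr, le_rfl⟩
  have h1 := h.surfDist_le_of_polygonJoin (hch.lowerPoint_mem_frontier h hz) hN
    (PolygonJoin.cons (hch.segment_subset h hz hs) hj)
  rwa [sub_sub_cancel, norm_smul, hch.norm_eq, mul_one, Real.norm_of_nonneg hs] at h1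

/-- The normal of a supporting half-space touched on the ray below the lower boundary is
quantitatively transversal to `e`. -/
theorem inner_le (hch : IsSurfaceChart C K e p ε ρ η δ) {z : E}
    (hz : z ∈ Metric.ball p ε) {s : ℝ} {ν : E} {σ : ℝ} (hν : IsOuterHalfSpace C ν σ)
    (h0 : inner ℝ ν (lowerPoint C e z - s • e) = σ) : (ρ + s) * inner ℝ ν e ≤ -η := by
  have h1 := hν.le (lowerPoint C e z + ρ • e + η • ν) (hch.closedBall_subset z hz (by
    rw [Metric.mem_closedBall, dist_self_add_left, norm_smul, hν.norm_eq, mul_one,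
      Real.norm_of_nonneg hch.η_pos.le]))
  rw [← h0, inner_add_right, inner_add_right, inner_sub_right, inner_smul_right,
    inner_smul_right, inner_smul_right, real_inner_self_eq_norm_sq, hν.norm_eq] at h1
  linarith

/-- The first edge of an optimal probe lies in a hyperplane touching `C` at its start. -/
theorem start_active (hch : IsSurfaceChart C K e p ε ρ η δ) {P : ℝ → E}
    {G : ℝ → ℝ} {M : ℕ} {t s : ℝ} {r : ℕ → E}
    (hP : P t ∈ C)
    (hpr : IsProbe (interior C)ᶜ K e P (M + 1) t s r)
    (hopt : ∀ t' s' r', IsProbe (interior C)ᶜ K e P (M + 1) t' s' r' →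
        2 * s + polygonLength (M + 1) r - G t ≤ 2 * s' + polygonLength (M + 1) r' - G t')
    {ν : E} {σ : ℝ} (hν : IsOuterHalfSpace C ν σ)
    (h1 : σ ≤ inner ℝ ν (r 1)) : inner ℝ ν (r 0) ≤ σ := by
  by_contra hlt
  rw [not_le] at hlt
  rcases hpr.nonneg.eq_or_lt with hs | hs
  · have := hpr.start
    rw [← hs, zero_smul, sub_zero] at this
    rw [this] at hlt
    exact absurd (hν.le _ hP) (not_le.2 hlt)
  have e1 : ∀ᶠ τ in nhdsWithin (0 : ℝ) (Ioi 0), σ < inner ℝ ν (r 0 + τ • e) := by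
    refine nhdsWithin_le_nhds (ContinuousAt.eventually_lt continuousAt_const (by fun_prop) ?_)
    simpa using hlt
  have e2 : ∀ᶠ τ in nhdsWithin (0 : ℝ) (Ioi 0), τ < s :=
    nhdsWithin_le_nhds (Iio_mem_nhds hs)
  obtain ⟨τ, ⟨hτ1, hτs⟩, hτ0⟩ := ((e1.and e2).and self_mem_nhdsWithin).exists
  have hτ0 : 0 < τ := hτ0
  have hprobe : IsProbe (interior C)ᶜ K e P (M + 1) t (s - τ)
      (Function.update r 0 (r 0 + τ • e)) := by
    refine ⟨hpr.mem_Icc, by linarith, ?_, ?_, ?_⟩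
    · rw [Function.update_self, hpr.start]; module
    · rintro (_ | j) hj
      · rw [Function.update_self, Function.update_of_ne (by omega)]
        exact hν.segment_subset hτ1.le h1
      · rw [Function.update_of_ne (by omega), Function.update_of_ne (by omega)]
        exact hpr.polygonIn _ hj
    · rw [Function.update_of_ne (by omega)]
      exact hpr.mem
  have hcost := hopt _ _ _ hprobe
  have hcongr : polygonLength M (fun j => Function.update r 0 (r 0 + τ • e) (j + 1)) =
      polygonLength M (fun j => r (j + 1)) :=
    polygonLength_congr fun i _ => Function.update_of_ne (by omega) _ _
  rw [polygonLength_succ, polygonLength_succ, hcongr, Function.update_self,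
    Function.update_of_ne (by omega)] at hcost
  have h3 := norm_add_le (r 0 - r (0 + 1)) (τ • e)
  rw [norm_smul, hch.norm_eq, mul_one, Real.norm_of_nonneg hτ0.le, ← add_sub_right_comm] at h3
  simp only [zero_add] at h3 hcost
  linarith

/-- A chord with respect to which the surface distance fails to be semiconcave would carry an
optimal probe in its interior; this is impossible. -/
theorem not_exists_optimal_probe (hch : IsSurfaceChart C K e p ε ρ η δ) (h : SurfacePair C K)
    {x y : E} (hx : x ∈ Metric.ball p ε) (hy : y ∈ Metric.ball p ε) (hxy : x ≠ y) {D c a b : ℝ}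
    (hc : (1 + (ρ + D) / η) ^ 2 / δ < c) {M : ℕ} {t s : ℝ} {r : ℕ → E} (ht : t ∈ Ioo (0 : ℝ) 1)
    (hsD : s ≤ D)
    (hpr : IsProbe (interior C)ᶜ K e (fun t => lowerPoint C e (x + t • (y - x))) M t s r)
    (hopt : ∀ t' s' r',
      IsProbe (interior C)ᶜ K e (fun t => lowerPoint C e (x + t • (y - x))) M t' s' r' →
        2 * s + polygonLength M r -
            (2 * height C e (x + t • (y - x)) + c * ‖x + t • (y - x)‖ ^ 2 + (a + t * b)) ≤
          2 * s' + polygonLength M r' -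
            (2 * height C e (x + t' • (y - x)) + c * ‖x + t' • (y - x)‖ ^ 2 + (a + t' * b)))
    (hmin : ∀ M' < M, ∀ t' s' r',
      IsProbe (interior C)ᶜ K e (fun t => lowerPoint C e (x + t • (y - x))) M' t' s' r' →
        2 * s + polygonLength M r -
            (2 * height C e (x + t • (y - x)) + c * ‖x + t • (y - x)‖ ^ 2 + (a + t * b)) <
          2 * s' + polygonLength M' r' -
            (2 * height C e (x + t' • (y - x)) + c * ‖x + t' • (y - x)‖ ^ 2 + (a + t' * b))) :
    False := by
  set k := y - x with hk
  have hk0 : 0 < ‖k‖ := norm_pos_iff.2 (sub_ne_zero.2 hxy.symm)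
  have hu : ∀ t ∈ Icc (0 : ℝ) 1, x + t • k ∈ Metric.ball p ε := fun t ht =>
    (convex_ball p ε).add_smul_sub_mem hx hy ht
  have htI : t ∈ Icc (0 : ℝ) 1 := ⟨ht.1.le, ht.2.le⟩
  set φ := height C e with hφ
  have hne : δ ≤ ‖r 0 - r M‖ := by
    rw [hpr.start]
    exact hch.le_norm _ (hu t htI) s hpr.nonneg _ hpr.mem
  have hM : M ≠ 0 := by
    rintro rfl
    rw [sub_self, norm_zero] at hne
    exact absurd hch.δ_pos (not_lt.2 hne)
  obtain ⟨m, rfl⟩ := Nat.exists_eq_succ_of_ne_zero hM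
  rw [Nat.succ_eq_add_one] at *
  obtain ⟨ν, σ, hν, hcorner⟩ := h.body.shortest_polygon hpr.polygonIn
    (h.mem_of_frontier (h.subset hpr.mem))
    (fun h0 => by rw [h0, sub_self, norm_zero] at hne; exact absurd hch.δ_pos (not_lt.2 hne))
    (fun ν σ hν _ h1 => hch.start_active (P := fun t => lowerPoint C e (x + t • k))
      (G := fun t => 2 * φ (x + t • k) + c * ‖x + t • k‖ ^ 2 + (a + t * b))
      (h.mem_of_frontier (hch.lowerPoint_mem_frontier h (hu t htI))) hpr hopt hν h1)
    (fun r' h0 hM hr' => by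
      have := hopt t s r' ⟨htI, hpr.nonneg, h0.trans hpr.start, hr', hM ▸ hpr.mem⟩
      linarith)
    (fun M' hM' r' h0 hM hr' => by
      have := hmin M' hM' t s r' ⟨htI, hpr.nonneg, h0.trans hpr.start, hr', hM ▸ hpr.mem⟩
      linarith)
  obtain ⟨δ', hδ', htrans⟩ := exists_transport m r ν (fun j hj => (hν j (by omega)).2.2.2)
    (fun j hj => by
      obtain ⟨-, h1, h2, -⟩ := hν j (by omega)
      rw [inner_sub_right, h1, h2, sub_self])
    (fun j hj => hcorner j (by omega))
  obtain ⟨hν0, hact, -, -⟩ := hν 0 (Nat.succ_pos m)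
  have htr := hch.inner_le (hu t htI) hν0 (by
    rwa [hpr.start] at hact)
  have hρs : 0 < ρ + s := add_pos_of_pos_of_nonneg hch.ρ_pos hpr.nonneg
  have hνe : inner ℝ (ν 0) e < 0 := by
    by_contra hcon
    have := mul_nonneg hρs.le (not_lt.1 hcon)
    linarith [hch.η_pos]
  set c₁ := -(inner ℝ (ν 0) k / inner ℝ (ν 0) e) with hc₁
  set v := k + c₁ • e with hv
  have hνv : inner ℝ (ν 0) v = 0 := by
    rw [hv, inner_add_right, inner_smul_right, hc₁, neg_mul, div_mul_cancel₀ _ hνe.ne,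
      add_neg_cancel]
  have hc₁_le : |c₁| ≤ ‖k‖ * ((ρ + D) / η) := by
    rw [hc₁, abs_neg, abs_div, abs_of_neg hνe, div_le_iff₀ (by linarith)]
    have h1 := abs_real_inner_le_norm (ν 0) k
    rw [hν0.norm_eq, one_mul] at h1
    refine h1.trans ?_
    have h2 : 1 ≤ (ρ + D) / η * -inner ℝ (ν 0) e := by
      rw [div_mul_eq_mul_div, le_div_iff₀ hch.η_pos]
      nlinarith
    nlinarith
  have hvle : ‖v‖ ≤ ‖k‖ * (1 + (ρ + D) / η) := by
    refine (norm_add_le _ _).trans ?_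
    rw [norm_smul, hch.norm_eq, mul_one, Real.norm_eq_abs]
    linarith
  set L := polygonLength (m + 1) r with hL
  have hLδ : δ ≤ L := hne.trans (norm_sub_le_polygonLength _ _)
  have hL0 : 0 < L := hch.δ_pos.trans_le hLδ
  have hquad : ‖v‖ ^ 2 / L - c * ‖k‖ ^ 2 < 0 := by
    have h1 : ‖v‖ ^ 2 / L ≤ ‖k‖ ^ 2 * ((1 + (ρ + D) / η) ^ 2 / δ) := by
      rw [← mul_div_assoc, ← mul_pow]
      exact div_le_div₀ (by positivity) (pow_le_pow_left₀ (norm_nonneg _) hvle 2) hch.δ_pos hLδ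
    have h2 := mul_lt_mul_of_pos_left hc (pow_pos hk0 2)
    linarith
  set w := edgeDir r 0 with hw
  set lin := -2 * c₁ - inner ℝ v w - 2 * c * inner ℝ (x + t • k) k - b with hlin
  have hmain : ∀ᶠ τ in nhds (0 : ℝ),
      0 ≤ τ * lin + τ ^ 2 * (‖v‖ ^ 2 / L - c * ‖k‖ ^ 2) := by
    have hcont : ContinuousAt (fun τ : ℝ => φ (x + (t + τ) • k)) 0 := by
      have h1 : ContinuousAt φ (x + (t + 0) • k) := by
        rw [add_zero]
        exact (h.body.continuousOn_height hch.norm_eq).continuousAt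
          ((isOpen_shadow C e).mem_nhds (hch.ball_subset (hu t htI)))
      exact ContinuousAt.comp (f := fun τ : ℝ => x + (t + τ) • k) h1 (by fun_prop)
    have ev1 : ∀ᶠ τ in nhds (0 : ℝ), t + τ ∈ Icc (0 : ℝ) 1 := by
      have : ContinuousAt (fun τ : ℝ => t + τ) 0 := by fun_prop
      exact this.eventually_mem (by rw [add_zero]; exact Icc_mem_nhds ht.1 ht.2)
    have ev2 : ∀ᶠ τ in nhds (0 : ℝ), ‖τ • v‖ < δ' :=
      ContinuousAt.eventually_lt (by fun_prop) continuousAt_const (by simpa using hδ')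
    have ev3 : ∀ᶠ τ in nhds (0 : ℝ), 0 < s →
        0 < s + φ (x + (t + τ) • k) - φ (x + t • k) - τ * c₁ := by
      by_cases hs : 0 < s
      · have : ContinuousAt
            (fun τ : ℝ => s + φ (x + (t + τ) • k) - φ (x + t • k) - τ * c₁) 0 :=
          ((continuousAt_const.add hcont).sub continuousAt_const).sub (by fun_prop)
        filter_upwards [this.eventually_const_lt (by simpa using hs)] with τ hτ _ using hτ
      · exact Filter.Eventually.of_forall fun τ h => absurd h hs
    filter_upwards [ev1, ev2, ev3] with τ h1 h2 h3
    set s' := s + φ (x + (t + τ) • k) - φ (x + t • k) - τ * c₁ with hs'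
    obtain ⟨r', hr0, hrM, hrν, hrL⟩ := htrans (τ • v) (by
      rw [inner_smul_right, hνv, mul_zero]) h2
    have hstart : r' 0 = lowerPoint C e (x + (t + τ) • k) - s' • e := by
      rw [hr0, hpr.start, lowerPoint, lowerPoint, hs', hv, ← hφ]
      module
    have hs'0 : 0 ≤ s' := by
      rcases hpr.nonneg.eq_or_lt with hs | hs
      · have h4 := hν0.le _ (h.mem_of_frontier (hch.lowerPoint_mem_frontier h (hu _ h1)))
        have h5 : lowerPoint C e (x + (t + τ) • k) = r 0 + τ • v + s' • e := by
          rw [← hr0, hstart, sub_add_cancel]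
        rw [h5, inner_add_right, inner_add_right, hact, inner_smul_right, inner_smul_right, hνv,
          mul_zero, add_zero] at h4
        by_contra hcon
        have := mul_pos_of_neg_of_neg (not_le.1 hcon) hνe
        linarith
      · exact (h3 hs).le
    have hprobe : IsProbe (interior C)ᶜ K e (fun t => lowerPoint C e (x + t • k)) (m + 1)
        (t + τ) s' r' := by
      refine ⟨h1, hs'0, hstart, fun j hj => ?_, hrM ▸ hpr.mem⟩
      obtain ⟨hνj, hj1, hj2, -⟩ := hν j hj
      obtain ⟨hj3, hj4⟩ := hrν j (by omega)
      rw [inner_sub_right, sub_eq_zero] at hj3 hj4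
      exact hνj.segment_subset (by rw [hj3, hj1]) (by rw [hj4, hj2])
    have hcost := hopt _ _ _ hprobe
    have e1 : ‖x + (t + τ) • k‖ ^ 2 =
        ‖x + t • k‖ ^ 2 + 2 * τ * inner ℝ (x + t • k) k + τ ^ 2 * ‖k‖ ^ 2 := by
      have : x + (t + τ) • k = (x + t • k) + τ • k := by module
      rw [this, norm_add_sq_real, inner_smul_right, norm_smul, mul_pow, Real.norm_eq_abs, sq_abs]
      ring
    have e2 : (‖τ • v‖ ^ 2 - inner ℝ (τ • v) w ^ 2) / L ≤ τ ^ 2 * (‖v‖ ^ 2 / L) := by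
      rw [norm_smul, mul_pow, Real.norm_eq_abs, sq_abs, ← mul_div_assoc]
      exact div_le_div_of_nonneg_right (by linarith [sq_nonneg (inner ℝ (τ • v) w : ℝ)]) hL0.le
    rw [e1] at hcost
    have e3 : inner ℝ (τ • v) w = τ * inner ℝ v w := by rw [inner_smul_left]; simp
    rw [e3] at hrL
    rw [e3] at e2
    rw [hlin]
    linarith
  have hneg : ∀ᶠ τ in nhds (0 : ℝ),
      0 ≤ -τ * lin + (-τ) ^ 2 * (‖v‖ ^ 2 / L - c * ‖k‖ ^ 2) := by
    have : Filter.Tendsto (fun τ : ℝ => -τ) (nhds 0) (nhds 0) := by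
      simpa using (continuous_neg (G := ℝ)).tendsto 0
    exact this.eventually hmain
  obtain ⟨τ, ⟨h1, h2⟩, hτ⟩ := (((hmain.and hneg).filter_mono
    (nhdsWithin_le_nhds (s := Ioi (0 : ℝ)))).and self_mem_nhdsWithin).exists
  have hτ : 0 < τ := hτ
  have h3 := mul_neg_of_pos_of_neg (pow_pos hτ 2) hquad
  linarith

/-- In a chart, the surface distance minus twice the height is semiconcave. -/
theorem concaveOn (hch : IsSurfaceChart C K e p ε ρ η δ) (h : SurfacePair C K) {D c : ℝ}
    (hD : ∀ q ∈ frontier C, surfDist (frontier C) K q ≤ D)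
    (hc : (1 + (ρ + D) / η) ^ 2 / δ < c) :
    ConcaveOn ℝ (Metric.ball p ε) (fun z => surfDist (frontier C) K (lowerPoint C e z) -
      2 * height C e z - c * ‖z‖ ^ 2) := by
  set F : E → ℝ := fun z => surfDist (frontier C) K (lowerPoint C e z) -
      2 * height C e z - c * ‖z‖ ^ 2 with hF
  refine ⟨convex_ball p ε, fun x hx y hy a b ha hb hab => ?_⟩
  by_contra hlt
  rw [not_le, smul_eq_mul, smul_eq_mul] at hlt
  obtain rfl : a = 1 - b := by linarith
  have hxy : x ≠ y := by
    rintro rfl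
    rw [← add_smul, sub_add_cancel, one_smul] at hlt
    linarith
  have hcomb : (1 - b) • x + b • y = x + b • (y - x) := by module
  rw [hcomb] at hlt
  set k := y - x with hk
  have hu : ∀ t ∈ Icc (0 : ℝ) 1, x + t • k ∈ Metric.ball p ε := fun t ht =>
    (convex_ball p ε).add_smul_sub_mem hx hy ht
  set P : ℝ → E := fun t => lowerPoint C e (x + t • k) with hP
  set G : ℝ → ℝ := fun t => 2 * height C e (x + t • k) + c * ‖x + t • k‖ ^ 2 +
    (F x + t * (F y - F x)) with hG
  have hmaps : MapsTo (fun t : ℝ => x + t • k) (Icc 0 1) (shadow C e) := fun t ht =>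
    hch.ball_subset (hu t ht)
  have hPc : ContinuousOn P (Icc 0 1) :=
    (h.body.continuousOn_lowerPoint hch.norm_eq).comp (by fun_prop) hmaps
  have hφc : ContinuousOn (fun t : ℝ => height C e (x + t • k)) (Icc 0 1) :=
    (h.body.continuousOn_height hch.norm_eq).comp (by fun_prop) hmaps
  have hGc : ContinuousOn G (Icc 0 1) := by rw [hG]; fun_prop
  have hcost : ∀ N t s r, IsProbe (interior C)ᶜ K e P N t s r →
      s + (F (x + t • k) - (F x + t * (F y - F x))) ≤ 2 * s + polygonLength N r - G t := by
    intro N t s r hpr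
    have := hch.surfDist_le h (hu t hpr.mem_Icc) hpr.nonneg hpr.start hpr.polygonIn hpr.mem
    simp only [hF, hG] at this ⊢
    linarith
  have hbI : b ∈ Icc (0 : ℝ) 1 := ⟨hb, by linarith⟩
  obtain ⟨M, t, s, r, hpr, hneg, hopt, hmin⟩ := exists_minimal_probe
    (isClosed_compl_iff.2 isOpen_interior) h.closed
    (fun y hy hy' => SurfacePair.notMem_interior (h.subset hy) hy') hch.norm_eq hPc hGc (by
      have hgap : 0 < (F x + b * (F y - F x) - F (x + b • k)) / 2 := by linarith
      obtain ⟨y', hy', N, r, h0, hN, hr, hL⟩ := h.exists_polygonJoin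
        (hch.lowerPoint_mem_frontier h (hu b hbI)) hgap
      refine ⟨N, b, 0, r, ⟨hbI, le_rfl, by simpa using h0, hr, hN ▸ hy'⟩, ?_⟩
      simp only [hF, hG] at hL hgap ⊢
      linarith)
  have ht0 : t ≠ 0 := by
    rintro rfl
    have := hcost _ _ _ _ hpr
    simp only [zero_smul, add_zero, zero_mul, sub_self] at this
    linarith [hpr.nonneg]
  have ht1 : t ≠ 1 := by
    rintro rfl
    have := hcost _ _ _ _ hpr
    rw [one_smul, hk, add_sub_cancel] at this
    linarith [hpr.nonneg]
  have htI := hpr.mem_Icc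
  refine hch.not_exists_optimal_probe h hx hy hxy hc
    ⟨lt_of_le_of_ne htI.1 ht0.symm, lt_of_le_of_ne htI.2 ht1⟩ ?_ hpr hopt hmin
  have hcv := (h.body.convexOn_height hch.norm_eq).2 (hch.ball_subset hx) (hch.ball_subset hy)
    (sub_nonneg.2 htI.2) htI.1 (sub_add_cancel 1 t)
  have hsq := (convexOn_univ_norm (E := E)).pow (fun _ _ => norm_nonneg _) 2
  have hsq' := hsq.2 (mem_univ x) (mem_univ y) (sub_nonneg.2 htI.2) htI.1 (sub_add_cancel 1 t)
  have hcomb : (1 - t) • x + t • y = x + t • k := by rw [hk]; module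
  rw [hcomb] at hcv hsq'
  simp only [smul_eq_mul, Pi.pow_apply] at hcv hsq'
  have hc0 : 0 ≤ c := (le_of_lt ((div_nonneg (sq_nonneg _) hch.δ_pos.le).trans_lt hc))
  have h1 := mul_le_mul_of_nonneg_left hsq' hc0
  have h2 := hD _ (hch.lowerPoint_mem_frontier h hx)
  have h3 := hD _ (hch.lowerPoint_mem_frontier h hy)
  have h4 := mul_le_mul_of_nonneg_left h2 (sub_nonneg.2 htI.2)
  have h5 := mul_le_mul_of_nonneg_left h3 htI.1
  have hL := polygonLength_nonneg M r
  simp only [hG, hF] at hneg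
  have := hpr.nonneg
  linarith

end IsSurfaceChart

end Semiconcavity

section ChartExistence

variable {E : Type*} [NormedAddCommGroup E] [InnerProductSpace ℝ E] [FiniteDimensional ℝ E]
  {C K : Set E} {e p : E} {ρ : ℝ}

theorem SurfacePair.exists_isSurfaceChart (h : SurfacePair C K) (hp : p ∈ frontier C)
    (hpK : p ∉ K) (he : ‖e‖ = 1) (hρ : 0 < ρ) (hint : p + ρ • e ∈ interior C) :
    ∃ ε η δ : ℝ, 0 < ε ∧ IsSurfaceChart C K e p ε ρ η δ := by
  have hsh : p ∈ shadow C e := ⟨ρ, hint⟩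
  have hself := h.body.lowerPoint_eq_self he hp hρ hint
  obtain ⟨η, hη, hball⟩ := Metric.nhds_basis_closedBall.mem_iff.1 (mem_interior_iff_mem_nhds.1 hint)
  set ray : Set E := {x | x = p - inner ℝ e (p - x) • e ∧ 0 ≤ inner ℝ e (p - x)} with hray
  have hrayc : IsClosed ray :=
    (isClosed_eq (f := fun x : E => x) (g := fun x => p - inner ℝ e (p - x) • e)
      (by fun_prop) (by fun_prop)).inter
    (isClosed_le (f := fun _ : E => (0 : ℝ)) (g := fun x => inner ℝ e (p - x))
      (by fun_prop) (by fun_prop))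
  have hee : inner ℝ e e = (1 : ℝ) := by rw [real_inner_self_eq_norm_sq, he, one_pow]
  have hmem : ∀ s : ℝ, 0 ≤ s → p - s • e ∈ ray := by
    intro s hs
    have : inner ℝ e (p - (p - s • e)) = s := by
      rw [sub_sub_cancel, inner_smul_right, hee, mul_one]
    exact ⟨by rw [this], by rwa [this]⟩
  have hKray : K ⊆ rayᶜ := by
    rintro y hy ⟨h1, h2⟩
    rcases h2.eq_or_lt with h3 | h3
    · rw [← h3, zero_smul, sub_zero] at h1
      exact hpK (h1 ▸ hy)
    · set s := inner ℝ e (p - y) with hs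
      have hyC : y ∈ C := h.mem_of_frontier (h.subset hy)
      refine hp.2 (h.body.2.1.openSegment_self_interior_subset_interior hyC hint ?_)
      refine ⟨ρ / (ρ + s), s / (ρ + s), by positivity, by positivity, by field_simp, ?_⟩
      rw [h1]
      have e1 : ρ / (ρ + s) = 1 - s / (ρ + s) := by field_simp; ring
      have e2 : s / (ρ + s) * ρ - (1 - s / (ρ + s)) * s = 0 := by field_simp; ring
      rw [e1]
      have : (1 - s / (ρ + s)) • (p - s • e) + (s / (ρ + s)) • (p + ρ • e) =
        p + (s / (ρ + s) * ρ - (1 - s / (ρ + s)) * s) • e := by module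
      rw [this, e2, zero_smul, add_zero]
  obtain ⟨δ, hδ, hthick⟩ := (h.body.1.of_isClosed_subset h.closed
    (fun y hy => h.mem_of_frontier (h.subset hy))).exists_thickening_subset_open
    hrayc.isOpen_compl hKray
  have hdist : ∀ s : ℝ, 0 ≤ s → ∀ y ∈ K, δ ≤ ‖p - s • e - y‖ := by
    intro s hs y hy
    by_contra hlt
    refine hthick (Metric.mem_thickening_iff.2 ⟨y, hy, ?_⟩) (hmem s hs)
    rw [dist_eq_norm]
    exact not_le.1 hlt
  have hcont : ContinuousAt (lowerPoint C e) p :=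
    (h.body.continuousOn_lowerPoint he).continuousAt ((isOpen_shadow C e).mem_nhds hsh)
  have hev : ∀ᶠ z in nhds p, z ∈ shadow C e ∧ ‖lowerPoint C e z - p‖ < min (η / 2) (δ / 2) := by
    have hmem : ∀ᶠ z in nhds p, z ∈ shadow C e := (isOpen_shadow C e).mem_nhds hsh
    refine hmem.and ?_
    have : ContinuousAt (fun z => ‖lowerPoint C e z - p‖) p := by fun_prop
    exact this.eventually_lt continuousAt_const (by
      rw [hself, sub_self, norm_zero]; positivity)
  obtain ⟨ε, hε, hεsub⟩ := Metric.eventually_nhds_iff_ball.1 hev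
  refine ⟨ε, η / 2, δ / 2, hε, he, hρ, by positivity, by positivity, fun z hz => (hεsub z hz).1,
    fun z hz => ?_, fun z hz s hs y hy => ?_⟩
  · refine Subset.trans ?_ hball
    have := (hεsub z hz).2.trans_le (min_le_left _ _)
    refine Metric.closedBall_subset_closedBall' ?_
    rw [dist_add_right, dist_eq_norm]
    linarith
  · have h1 := (hεsub z hz).2.trans_le (min_le_right _ _)
    have h2 := hdist s hs y hy
    have h3 := norm_add_le (p - lowerPoint C e z) (lowerPoint C e z - s • e - y)
    rw [show p - lowerPoint C e z + (lowerPoint C e z - s • e - y) = p - s • e - y by abel,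
      norm_sub_rev p] at h3
    linarith

/-- Every point of a chart has nearby points where the surface distance is smaller, at a
definite rate. -/
theorem IsSurfaceChart.exists_descent {ε η δ : ℝ} (hch : IsSurfaceChart C K e p ε ρ η δ)
    (h : SurfacePair C K) {z : E} (hz : z ∈ Metric.ball p ε) {r : ℝ} (hr : 0 < r) :
    ∃ w : E, inner ℝ e w = 0 ∧ w ≠ 0 ∧ ‖w‖ < r ∧
      surfDist (frontier C) K (lowerPoint C e (z + w)) ≤
        surfDist (frontier C) K (lowerPoint C e z) - ‖w‖ / 2 := by
  have he := hch.norm_eq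
  obtain ⟨R, hR, hball⟩ := Metric.isOpen_iff.1 isOpen_interior _ (hch.add_mem_interior hz)
  set q₀ := lowerPoint C e z with hq₀
  set τ := min (δ / 2) (min (r / 2) (R / 2)) with hτ
  have hδ := hch.δ_pos
  have hτ0 : 0 < τ := by positivity
  have hτδ : τ ≤ δ / 2 := min_le_left _ _
  have hτr : τ ≤ r / 2 := (min_le_right _ _).trans (min_le_left _ _)
  have hτR : τ ≤ R / 2 := (min_le_right _ _).trans (min_le_right _ _)
  obtain ⟨q, hq, hqd, hqf⟩ := h.exists_descent (hch.lowerPoint_mem_frontier h hz) hτ0 (by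
    intro y hy
    have := hch.le_norm z hz 0 le_rfl y hy
    rw [zero_smul, sub_zero, ← dist_eq_norm, dist_comm] at this
    linarith) (half_pos hτ0)
  have hqint : q + ρ • e ∈ interior C := by
    refine hball ?_
    rw [Metric.mem_ball, dist_add_right, hqd]
    linarith
  have hself := h.body.lowerPoint_eq_self he hq hch.ρ_pos hqint
  set w := (q - q₀) - inner ℝ e (q - q₀) • e with hw
  have hee : inner ℝ e e = (1 : ℝ) := by rw [real_inner_self_eq_norm_sq, he, one_pow]
  have hwe : inner ℝ e w = 0 := by rw [hw, inner_sub_right, inner_smul_right, hee]; ring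
  have hzw : lowerPoint C e (z + w) = q := by
    have : z + w = q + (-(height C e z + inner ℝ e (q - q₀))) • e := by
      rw [hw, hq₀, lowerPoint]; module
    rw [this, h.body.lowerPoint_add_smul he ⟨ρ, hqint⟩, hself]
  have hwle : ‖w‖ ≤ τ := by
    rw [← hqd, dist_eq_norm]
    have h1 := norm_add_sq_real w (inner ℝ e (q - q₀) • e)
    have hwe' : inner ℝ w e = 0 := by rw [real_inner_comm, hwe]
    have hsum : w + inner ℝ e (q - q₀) • e = q - q₀ := by rw [hw, sub_add_cancel]
    rw [inner_smul_right, hwe', hsum] at h1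
    refine le_of_sq_le_sq ?_ (norm_nonneg _)
    nlinarith [sq_nonneg ‖inner ℝ e (q - q₀) • e‖]
  refine ⟨w, hwe, ?_, by linarith, by rw [hzw]; linarith⟩
  intro h0
  rw [h0, add_zero] at hzw
  rw [← hzw] at hqf
  linarith

end ChartExistence

section QuadraticSard

open Filter Topology
open scoped ENNReal

theorem hausdorffMeasure_image_le_of_dist_lt {X Y : Type*} [MetricSpace X] [MeasurableSpace X]
    [BorelSpace X] [TopologicalSpace.SeparableSpace X] [MetricSpace Y] [MeasurableSpace Y]
    [BorelSpace Y] {φ : X → Y} {Z : Set X} {δ : ℝ} {ε : ℝ≥0} (hδ : 0 < δ)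
    (hφ : ∀ z ∈ Z, ∀ z' ∈ Z, dist z z' < δ → dist (φ z) (φ z') ≤ ε * dist z z' ^ 2) {d : ℝ}
    (hd : 0 ≤ d) : μH[d] (φ '' Z) ≤ (ε : ℝ≥0∞) ^ d * μH[2 * d] Z := by
  rcases Z.eq_empty_or_nonempty with rfl | ⟨z₀, -⟩
  · simp
  have : Nonempty X := ⟨z₀⟩
  set B : ℕ → Set X := fun i => Metric.ball (TopologicalSpace.denseSeq X i) (δ / 2) with hB
  have hBm : ∀ i, MeasurableSet (B i) := fun i => Metric.isOpen_ball.measurableSet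
  have hcover : ⋃ i, disjointed B i = univ := by
    rw [iUnion_disjointed]
    refine eq_univ_of_forall fun x => ?_
    obtain ⟨i, hi⟩ := (TopologicalSpace.denseRange_denseSeq X).exists_dist_lt x (half_pos hδ)
    exact mem_iUnion.2 ⟨i, hi⟩
  have hDm := MeasurableSet.disjointed hBm
  have hpiece : ∀ i, μH[d] (φ '' (disjointed B i ∩ Z)) ≤
      (ε : ℝ≥0∞) ^ d * μH[2 * d] (disjointed B i ∩ Z) := by
    intro i
    have hH : HolderOnWith ε 2 φ (disjointed B i ∩ Z) := by
      intro x hx y hy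
      have hx' : dist x _ < δ / 2 := disjointed_subset B i hx.1
      have hy' : dist y _ < δ / 2 := disjointed_subset B i hy.1
      have := hφ x hx.2 y hy.2
        ((dist_triangle_right x y (TopologicalSpace.denseSeq X i)).trans_lt (by linarith))
      rw [edist_dist, edist_dist]
      refine (ENNReal.ofReal_le_ofReal this).trans ?_
      rw [ENNReal.ofReal_mul ε.coe_nonneg, ENNReal.ofReal_coe_nnreal,
        ENNReal.ofReal_pow dist_nonneg]
      simp
    simpa using hH.hausdorffMeasure_image_le (by norm_num) hd
  calc μH[d] (φ '' Z) = μH[d] (⋃ i, φ '' (disjointed B i ∩ Z)) := by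
        rw [← image_iUnion, ← iUnion_inter, hcover, univ_inter]
    _ ≤ ∑' i, μH[d] (φ '' (disjointed B i ∩ Z)) := measure_iUnion_le _
    _ ≤ ∑' i, (ε : ℝ≥0∞) ^ d * μH[2 * d] (disjointed B i ∩ Z) := ENNReal.tsum_le_tsum hpiece
    _ = (ε : ℝ≥0∞) ^ d * ∑' i, (μH[2 * d].restrict Z) (disjointed B i) := by
        rw [ENNReal.tsum_mul_left]
        simp_rw [Measure.restrict_apply (hDm _)]
    _ = (ε : ℝ≥0∞) ^ d * μH[2 * d] Z := by
        rw [← measure_iUnion (disjoint_disjointed B) hDm, hcover, Measure.restrict_apply_univ]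

variable {W : Type*} [NormedAddCommGroup W] [NormedSpace ℝ W] [FiniteDimensional ℝ W]
  [MeasurableSpace W] [BorelSpace W] {Y : Type*} [MetricSpace Y] {φ : W → Y} {Z : Set W}

/-- Near a density point of `Z`, a quadratic oscillation bound on `Z` improves by chaining. -/
theorem eventually_dist_le_of_density {μ : Measure W} [μ.IsAddHaarMeasure] {C : ℝ}
    (hC : 0 ≤ C) (hφ : ∀ z ∈ Z, ∀ z' ∈ Z, dist (φ z) (φ z') ≤ C * dist z z' ^ 2) {z : W}
    (hz : z ∈ Z)
    (hdens : Tendsto (fun r => μ (Z ∩ Metric.closedBall z r) / μ (Metric.closedBall z r))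
      (𝓝[>] 0) (𝓝 1)) {ε : ℝ} (hε : 0 < ε) :
    ∃ δ : ℝ, 0 < δ ∧ ∀ z' ∈ Z, dist z z' < δ → dist (φ z) (φ z') ≤ ε * dist z z' ^ 2 := by
  rcases subsingleton_or_nontrivial W with hW | hW
  · exact ⟨1, one_pos, fun z' _ _ => by simp [Subsingleton.elim z' z]⟩
  obtain ⟨k, hk⟩ := exists_nat_gt (9 * C / ε)
  set N : ℕ := k + 1 with hN
  have hN0 : (0 : ℝ) < N := by positivity
  have hNε : 9 * C ≤ ε * N := by
    rw [div_lt_iff₀ hε] at hk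
    rw [hN]; push_cast; nlinarith
  set n := Module.finrank ℝ W
  set θ : ℝ := (1 / (2 * N)) ^ n with hθ
  have hθ0 : 0 < θ := by positivity
  have hθ1 : ENNReal.ofReal (1 - θ) < 1 := by
    rw [ENNReal.ofReal_lt_one]; linarith
  have hev := hdens.eventually (lt_mem_nhds hθ1)
  obtain ⟨δ, hδ, hδs⟩ := Metric.mem_nhdsWithin_iff.1 hev
  refine ⟨δ / 2, half_pos hδ, fun z' hz' hd => ?_⟩
  rcases eq_or_ne z z' with rfl | hne
  · simp
  set ρ := dist z z' with hρ
  have hρ0 : 0 < ρ := dist_pos.2 hne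
  have hlt : ENNReal.ofReal (1 - θ) <
      μ (Z ∩ Metric.closedBall z (2 * ρ)) / μ (Metric.closedBall z (2 * ρ)) := by
    refine hδs ⟨?_, ?_⟩
    · rw [Metric.mem_ball, Real.dist_eq, sub_zero, abs_of_pos (by positivity)]; linarith
    · exact mem_Ioi.2 (by positivity)
  have hfin : μ (Metric.closedBall z (2 * ρ)) ≠ ∞ :=
    (isCompact_closedBall z (2 * ρ)).measure_lt_top.ne
  have hnear : ∀ y : W, dist y z ≤ ρ → ∃ x ∈ Z, dist x y < ρ / N := by
    intro y hy
    by_contra! hempty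
    have hsub : Metric.ball y (ρ / N) ⊆ Metric.closedBall z (2 * ρ) := by
      refine Metric.ball_subset_closedBall.trans (Metric.closedBall_subset_closedBall' ?_)
      have : ρ / N ≤ ρ :=
        div_le_self hρ0.le (by rw [hN]; push_cast; linarith [k.cast_nonneg (α := ℝ)])
      linarith
    have hdisj : Disjoint (Z ∩ Metric.closedBall z (2 * ρ)) (Metric.ball y (ρ / N)) :=
      Set.disjoint_left.2 fun x hx hx' => (hempty x hx.1).not_gt hx'
    have hμball : μ (Metric.ball y (ρ / N)) =
        ENNReal.ofReal θ * μ (Metric.closedBall z (2 * ρ)) := by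
      rw [Measure.addHaar_ball _ _ (by positivity), Measure.addHaar_closedBall _ _ (by positivity),
        ← mul_assoc, ← ENNReal.ofReal_mul hθ0.le, hθ, ← mul_pow]
      congr 3
      field_simp
    have hsum : μ (Z ∩ Metric.closedBall z (2 * ρ)) + μ (Metric.ball y (ρ / N)) ≤
        μ (Metric.closedBall z (2 * ρ)) := by
      rw [← measure_union hdisj Metric.isOpen_ball.measurableSet]
      exact measure_mono (union_subset inter_subset_right hsub)
    have hpos : 0 < μ (Metric.closedBall z (2 * ρ)) :=
      Metric.measure_closedBall_pos μ z (by positivity)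
    rw [ENNReal.lt_div_iff_mul_lt (Or.inl hpos.ne') (Or.inl hfin)] at hlt
    have := ENNReal.add_lt_add_right (a := ENNReal.ofReal θ * μ (Metric.closedBall z (2 * ρ)))
      (ENNReal.mul_ne_top ENNReal.ofReal_ne_top hfin) hlt
    rw [hμball] at hsum
    have h2 := this.trans_le hsum
    rw [← add_mul, ← ENNReal.ofReal_add (by
      rw [hθ, sub_nonneg]
      exact pow_le_one₀ (by positivity) (by
        rw [div_le_one (by positivity), hN]; push_cast; linarith [k.cast_nonneg (α := ℝ)]))
      hθ0.le, sub_add_cancel, ENNReal.ofReal_one, one_mul] at h2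
    exact lt_irrefl _ h2
  have hchain : ∀ j : ℕ, j ≤ N → ∃ x ∈ Z, dist x (AffineMap.lineMap z z' (j / N : ℝ)) < ρ / N ∧
      (j = 0 → x = z) ∧ (j = N → x = z') := by
    intro j hj
    rcases eq_or_ne j 0 with rfl | h0
    · exact ⟨z, hz, by simp; positivity, fun _ => rfl, fun h => by omega⟩
    rcases eq_or_ne j N with rfl | h1
    · refine ⟨z', hz', ?_, fun h => by omega, fun _ => rfl⟩
      rw [div_self hN0.ne']; simp; positivity
    · obtain ⟨x, hx, hxd⟩ := hnear (AffineMap.lineMap z z' (j / N : ℝ)) (by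
        rw [dist_lineMap_left, Real.norm_of_nonneg (by positivity)]
        refine mul_le_of_le_one_left hρ0.le ?_
        rw [div_le_one hN0]; exact_mod_cast hj)
      exact ⟨x, hx, hxd, fun h => absurd h h0, fun h => absurd h h1⟩
  choose! x hxZ hxd hx0 hxN using hchain
  have hstep : ∀ {j : ℕ}, j < N → dist (φ (x j)) (φ (x (j + 1))) ≤ C * (3 * (ρ / N)) ^ 2 := by
    intro j hj
    refine (hφ _ (hxZ _ hj.le) _ (hxZ _ hj)).trans ?_
    have h1 := hxd j hj.le
    have h2 := hxd (j + 1) hj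
    have h3 : dist (AffineMap.lineMap z z' (j / N : ℝ) : W)
        (AffineMap.lineMap z z' ((j + 1 : ℕ) / N : ℝ)) = ρ / N := by
      rw [dist_lineMap_lineMap, Real.dist_eq, ← sub_div]
      push_cast
      rw [sub_add_cancel_left, abs_div, abs_neg, abs_one, abs_of_pos hN0]
      ring
    have h4 := dist_triangle4_right (x j) (x (j + 1)) (AffineMap.lineMap z z' (j / N : ℝ) : W)
      (AffineMap.lineMap z z' ((j + 1 : ℕ) / N : ℝ))
    gcongr
    linarith
  have htot := dist_le_range_sum_of_dist_le (f := fun j => φ (x j)) N hstep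
  simp only [hx0 0 (Nat.zero_le _) rfl, hxN N le_rfl rfl, Finset.sum_const, Finset.card_range,
    nsmul_eq_mul] at htot
  refine htot.trans ?_
  have : (N : ℝ) * (C * (3 * (ρ / N)) ^ 2) = 9 * C / N * ρ ^ 2 := by field_simp; ring
  rw [this]
  gcongr
  rwa [div_le_iff₀ hN0]

/-- A map with quadratic oscillation on a subset of an `m`-dimensional space has an image of zero
`m / 2`-dimensional measure. -/
theorem hausdorffMeasure_image_eq_zero_of_quadratic [MeasurableSpace Y] [BorelSpace Y]
    (hW : 0 < Module.finrank ℝ W) {C : ℝ≥0}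
    (hφ : ∀ z ∈ Z, ∀ z' ∈ Z, dist (φ z) (φ z') ≤ C * dist z z' ^ 2) :
    μH[(Module.finrank ℝ W : ℝ) / 2] (φ '' Z) = 0 := by
  set m := Module.finrank ℝ W with hm
  have hm0 : (0 : ℝ) < (m : ℝ) / 2 := by positivity
  have h2m : 2 * ((m : ℝ) / 2) = m := by ring
  suffices hbdd : ∀ R : ℕ, μH[(m : ℝ) / 2] (φ '' (Z ∩ Metric.closedBall 0 R)) = 0 by
    have : Z = ⋃ R : ℕ, Z ∩ Metric.closedBall 0 R := by
      rw [← inter_iUnion, Metric.iUnion_closedBall_nat, inter_univ]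
    rw [this, image_iUnion]
    exact measure_iUnion_null hbdd
  intro R
  set T := Z ∩ Metric.closedBall (0 : W) R with hT
  have hφT : ∀ z ∈ T, ∀ z' ∈ T, dist (φ z) (φ z') ≤ C * dist z z' ^ 2 :=
    fun z hz z' hz' => hφ z hz.1 z' hz'.1
  set μ : Measure W := μH[m] with hμ
  have : μ.IsAddHaarMeasure := isAddHaarMeasure_hausdorffMeasure
  have hTfin : μ T ≠ ∞ :=
    ((measure_mono inter_subset_right).trans_lt (isCompact_closedBall 0 _).measure_lt_top).ne
  set S : Set W := {z | Tendsto (fun r => μ (T ∩ Metric.closedBall z r) /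
    μ (Metric.closedBall z r)) (𝓝[>] 0) (𝓝 1)} with hS
  have hnull : μ (Sᶜ ∩ T) = 0 :=
    le_antisymm ((Measure.le_restrict_apply T Sᶜ).trans
      (Besicovitch.ae_tendsto_measure_inter_div μ T).le) zero_le
  have h1 : μH[(m : ℝ) / 2] (φ '' (Sᶜ ∩ T)) = 0 := by
    have := hausdorffMeasure_image_le_of_dist_lt (Z := Sᶜ ∩ T) (ε := C) one_pos
      (fun z hz z' hz' _ => hφT z hz.2 z' hz'.2) hm0.le
    rw [h2m, ← hμ, hnull, mul_zero] at this
    exact le_antisymm this zero_le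
  have h2 : ∀ ε : ℝ≥0, 0 < ε → μH[(m : ℝ) / 2] (φ '' (S ∩ T)) ≤
      (ε : ℝ≥0∞) ^ ((m : ℝ) / 2) * μ T := by
    intro ε hε
    set A : ℕ → Set W := fun k => {z ∈ T | ∀ z' ∈ T, dist z z' < 1 / ((k : ℝ) + 1) →
      dist (φ z) (φ z') ≤ ε * dist z z' ^ 2} with hA
    have hAmono : Monotone A := by
      intro k l hkl z hz
      refine ⟨hz.1, fun z' hz' hd => hz.2 z' hz' (hd.trans_le ?_)⟩
      gcongr
    have hsub : S ∩ T ⊆ ⋃ k, A k := by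
      rintro z ⟨hzS, hzT⟩
      obtain ⟨δ, hδ, h⟩ := eventually_dist_le_of_density C.coe_nonneg hφT hzT hzS (ε := ε) hε
      obtain ⟨k, hk⟩ := exists_nat_one_div_lt hδ
      exact mem_iUnion.2 ⟨k, hzT, fun z' hz' hd => h z' hz' (hd.trans hk)⟩
    refine (measure_mono (image_mono hsub)).trans ?_
    rw [image_iUnion, Monotone.measure_iUnion (fun k l hkl => image_mono (hAmono hkl))]
    refine iSup_le fun k => ?_
    refine (hausdorffMeasure_image_le_of_dist_lt (δ := 1 / ((k : ℝ) + 1)) (by positivity)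
      (fun z hz z' hz' hd => hz.2 z' hz'.1 hd) hm0.le).trans ?_
    rw [h2m, ← hμ]
    gcongr
    exact fun z hz => hz.1
  have h3 : μH[(m : ℝ) / 2] (φ '' (S ∩ T)) = 0 := by
    have hlim : Tendsto (fun ε : ℝ≥0 => (ε : ℝ≥0∞) ^ ((m : ℝ) / 2) * μ T) (𝓝[>] 0) (𝓝 0) := by
      have e1 : Tendsto (fun ε : ℝ≥0 => (ε : ℝ≥0∞)) (𝓝[>] 0) (𝓝 0) :=
        (ENNReal.tendsto_coe.2 tendsto_id).mono_left nhdsWithin_le_nhds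
      have e2 := (ENNReal.continuous_rpow_const (y := (m : ℝ) / 2)).tendsto 0 |>.comp e1
      have e3 := ENNReal.Tendsto.mul_const (b := μ T) e2 (Or.inr hTfin)
      rw [ENNReal.zero_rpow_of_pos hm0, zero_mul] at e3
      exact e3
    refine le_antisymm (ge_of_tendsto hlim ?_) zero_le
    filter_upwards [self_mem_nhdsWithin] with ε hε using h2 ε hε
  have : T = Sᶜ ∩ T ∪ S ∩ T := by rw [← union_inter_distrib_right, compl_union_self, univ_inter]
  rw [this, image_union]
  exact measure_union_null h1 h3

end QuadraticSard

section Subgradients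

open Filter Topology

variable {H : Type*} [NormedAddCommGroup H] [InnerProductSpace ℝ H]

/-- `s` is a subgradient at `u` of the function `A` on `U`. -/
def IsSubgradientOn (U : Set H) (A : H → ℝ) (s u : H) : Prop :=
  ∀ v ∈ U, A u + inner ℝ s (v - u) ≤ A v

theorem IsSubgradientOn.combo {U : Set H} {A : H → ℝ} {s s' u : H} (hs : IsSubgradientOn U A s u)
    (hs' : IsSubgradientOn U A s' u) {a b : ℝ} (ha : 0 ≤ a) (hb : 0 ≤ b) (hab : a + b = 1) :
    IsSubgradientOn U A (a • s + b • s') u := by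
  intro v hv
  have h1 := mul_le_mul_of_nonneg_left (hs v hv) ha
  have h2 := mul_le_mul_of_nonneg_left (hs' v hv) hb
  rw [inner_add_left, inner_smul_left, inner_smul_left]
  simp only [conj_trivial]
  have h3 : A u = a * A u + b * A u := by rw [← add_mul, hab, one_mul]
  have h4 : A v = a * A v + b * A v := by rw [← add_mul, hab, one_mul]
  linarith

variable [FiniteDimensional ℝ H] {U W : Set H} {A B D : H → ℝ} {u : H}

/-- A convex and a concave function touching at a point are separated by an affine function. -/
theorem ConvexOn.exists_sandwich (hU : IsOpen U) (hA : ConvexOn ℝ U A) (hD : ConcaveOn ℝ W D)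
    (huU : u ∈ U) (huW : u ∈ W) (hu : D u = A u) (hle : ∀ v ∈ U, v ∈ W → D v ≤ A v) :
    ∃ s : H, IsSubgradientOn U A s u ∧ ∀ v ∈ W, D v ≤ A u + inner ℝ s (v - u) := by
  have hAc : ContinuousOn A U := hA.continuousOn hU
  have hopen : IsOpen {q : H × ℝ | q.1 ∈ U ∧ A q.1 < q.2} := by
    have h1 : ContinuousOn (fun q : H × ℝ => q.2 - A q.1) (Prod.fst ⁻¹' U) :=
      continuousOn_snd.sub (hAc.comp continuousOn_fst fun q hq => hq)
    have h2 := h1.isOpen_inter_preimage (hU.preimage continuous_fst) (isOpen_Ioi (a := (0 : ℝ)))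
    convert h2 using 1
    ext q
    simp [sub_pos]
  obtain ⟨f, c, hf1, hf2⟩ := geometric_hahn_banach_open hA.convex_strict_epigraph hopen
    hD.convex_hypograph (Set.disjoint_left.2 fun q hq hq' =>
      (hq'.2.trans (hle q.1 hq.1 hq'.1)).not_gt hq.2)
  set m := f (0, 1) with hm
  have hsplit : ∀ (v : H) (t : ℝ), f (v, t) = f (v, 0) + t * m := by
    intro v t
    have : (v, t) = (v, (0 : ℝ)) + t • ((0 : H), (1 : ℝ)) := by ext <;> simp
    rw [this, map_add, map_smul, smul_eq_mul]
  have hc2 : c ≤ f (u, 0) + A u * m := by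
    rw [← hsplit, ← hu]; exact hf2 (u, D u) ⟨huW, le_rfl⟩
  have hm0 : m < 0 := by
    have := hf1 (u, A u + 1) ⟨huU, by simp⟩
    rw [hsplit] at this
    linarith
  have hle1 : ∀ v ∈ U, f (v, 0) + A v * m ≤ c := by
    intro v hv
    refine le_of_forall_pos_le_add fun ε hε => ?_
    have := hf1 (v, A v + ε / (-m)) ⟨hv, by
      have : 0 < ε / (-m) := div_pos hε (neg_pos.2 hm0)
      simpa using this⟩
    rw [hsplit] at this
    have e1 : (A v + ε / (-m)) * m = A v * m - ε := by
      rw [add_mul, div_neg, neg_mul, div_mul_cancel₀ _ hm0.ne]; ring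
    linarith
  have hle2 : ∀ v ∈ W, c ≤ f (v, 0) + D v * m := by
    intro v hv
    rw [← hsplit]; exact hf2 (v, D v) ⟨hv, le_rfl⟩
  set L : H →L[ℝ] ℝ := f.comp (ContinuousLinearMap.inl ℝ H ℝ) with hL
  have hLf : ∀ v, L v = f (v, 0) := fun v => by simp [hL]
  refine ⟨(-m)⁻¹ • (InnerProductSpace.toDual ℝ H).symm L, fun v hv => ?_, fun v hv => ?_⟩
  · have := hle1 v hv
    rw [inner_smul_left, InnerProductSpace.toDual_symm_apply, map_sub, hLf, hLf, conj_trivial,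
      ← le_sub_iff_add_le', inv_mul_le_iff₀ (neg_pos.2 hm0)]
    linarith
  · have := hle2 v hv
    have h2 := hle1 u huU
    rw [inner_smul_left, InnerProductSpace.toDual_symm_apply, map_sub, hLf, hLf, conj_trivial,
      ← sub_le_iff_le_add', le_inv_mul_iff₀ (neg_pos.2 hm0)]
    linarith

theorem ConvexOn.exists_isSubgradientOn (hU : IsOpen U) (hA : ConvexOn ℝ U A) (hu : u ∈ U) :
    ∃ s : H, IsSubgradientOn U A s u := by
  obtain ⟨s, hs, -⟩ := hA.exists_sandwich hU (D := fun _ => A u)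
    (concaveOn_const (A u) (convex_singleton u)) hu rfl rfl (fun v _ hv => by
      rw [mem_singleton_iff.1 hv])
  exact ⟨s, hs⟩

/-- Points where no perturbation `u - y`, `u + y` makes `A (u - y) + B (u + y)` smaller than
`A u + B u`. -/
def IsDCCritical (U : Set H) (A B : H → ℝ) (u : H) : Prop :=
  ∀ y : H, u - y ∈ U → u + y ∈ U → A u + B u ≤ A (u - y) + B (u + y)

theorem IsDCCritical.exists_common_subgradient (hU : IsOpen U) (hA : ConvexOn ℝ U A)
    (hB : ConvexOn ℝ U B) (hu : u ∈ U) (hcrit : IsDCCritical U A B u) :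
    ∃ s : H, IsSubgradientOn U A s u ∧ IsSubgradientOn U B s u := by
  set g : H →ᵃ[ℝ] H := AffineMap.const ℝ H ((2 : ℝ) • u) - AffineMap.id ℝ H with hg
  have hgv : ∀ v, g v = (2 : ℝ) • u - v := fun v => by simp [hg]
  have hgu : g u = u := by rw [hgv]; module
  have hD : ConcaveOn ℝ (g ⁻¹' U) (fun v => (A u + B u) - B (g v)) :=
    (concaveOn_const _ (hB.comp_affineMap g).1).sub (hB.comp_affineMap g)
  obtain ⟨s, hs, hs'⟩ := hA.exists_sandwich hU hD hu (by rwa [mem_preimage, hgu])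
    (by rw [hgu]; ring) (fun v hv hv' => by
      rw [mem_preimage, hgv] at hv'
      have := hcrit (u - v) (by rwa [sub_sub_cancel])
        (by convert hv' using 1; module)
      rw [sub_sub_cancel, show u + (u - v) = (2 : ℝ) • u - v by module] at this
      rw [hgv]
      linarith)
  refine ⟨s, hs, fun v hv => ?_⟩
  have hgg : g (g v) = v := by rw [hgv, hgv]; module
  have := hs' (g v) (by rwa [mem_preimage, hgg])
  simp only [hgg] at this
  rw [hgv, show (2 : ℝ) • u - v - u = -(v - u) by module, inner_neg_right] at this
  linarith

/-- A convex function which exceeds one of its tangent hyperplanes at a linear rate, at points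
arbitrarily close to the point of contact, has a second subgradient there. -/
theorem ConvexOn.exists_second_subgradient (hU : IsOpen U) (hB : ConvexOn ℝ U B) (hu : u ∈ U)
    {s : H} {c : ℝ} (hc : 0 < c)
    (hfar : ∀ r : ℝ, 0 < r → ∃ w ∈ U, w ≠ u ∧ ‖w - u‖ < r ∧
      B u + inner ℝ s (w - u) + c * ‖w - u‖ ≤ B w) :
    ∃ s' : H, s' ≠ s ∧ IsSubgradientOn U B s' u := by
  have hBc : ContinuousOn B U := hB.continuousOn hU
  obtain ⟨L, T, hT, hLip⟩ := hB.locallyLipschitzOn hU hu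
  rw [hU.nhdsWithin_eq hu] at hT
  obtain ⟨R, hR, hRT⟩ := Metric.mem_nhds_iff.1 (inter_mem hT (hU.mem_nhds hu))
  have hex : ∀ k : ℕ, ∃ w s', w ∈ U ∧ ‖w - u‖ < 1 / ((k : ℝ) + 1) ∧ IsSubgradientOn U B s' w ∧
      c ≤ ‖s' - s‖ ∧ ‖s'‖ ≤ L := by
    intro k
    obtain ⟨w, hw, hne, hlt, hle⟩ := hfar (min (1 / ((k : ℝ) + 1)) R) (by positivity)
    obtain ⟨s', hs'⟩ := hB.exists_isSubgradientOn hU hw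
    have hpos : 0 < ‖w - u‖ := norm_pos_iff.2 (sub_ne_zero.2 hne)
    refine ⟨w, s', hw, hlt.trans_le (min_le_left _ _), hs', ?_, ?_⟩
    · have h1 := hs' u hu
      rw [← neg_sub w u, inner_neg_right] at h1
      have h2 := real_inner_le_norm (s' - s) (w - u)
      rw [inner_sub_left] at h2
      refine le_of_mul_le_mul_right (?_ : c * ‖w - u‖ ≤ _) hpos
      linarith
    · rcases eq_or_ne s' 0 with h0 | h0
      · rw [h0, norm_zero]; exact L.2
      have hs0 : 0 < ‖s'‖ := norm_pos_iff.2 h0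
      have hwR : w ∈ Metric.ball u R := by
        rw [Metric.mem_ball, dist_eq_norm]; exact hlt.trans_le (min_le_right _ _)
      obtain ⟨r, hr, hrb⟩ := Metric.isOpen_iff.1 Metric.isOpen_ball w hwR
      have hv : w + (r / 2 / ‖s'‖) • s' ∈ Metric.ball w r := by
        rw [Metric.mem_ball, dist_eq_norm, add_sub_cancel_left, norm_smul,
          Real.norm_of_nonneg (by positivity), div_mul_cancel₀ _ hs0.ne']
        linarith
      have hv' := hRT (hrb hv)
      have h1 := hs' _ hv'.2
      have h2 := hLip.dist_le_mul _ hv'.1 _ (hRT hwR).1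
      rw [Real.dist_eq, dist_eq_norm] at h2
      rw [add_sub_cancel_left] at h1 h2
      rw [norm_smul, Real.norm_of_nonneg (by positivity), div_mul_cancel₀ _ hs0.ne'] at h2
      rw [inner_smul_right, real_inner_self_eq_norm_sq] at h1
      have h3 := (le_abs_self _).trans h2
      have h4 : r / 2 / ‖s'‖ * ‖s'‖ ^ 2 = ‖s'‖ * (r / 2) := by field_simp
      rw [h4] at h1
      refine le_of_mul_le_mul_right (?_ : ‖s'‖ * (r / 2) ≤ _) (half_pos hr)
      linarith
  choose w σ hwU hwlt hσ hσc hσL using hex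
  obtain ⟨s', -, φ, hφ, hlim⟩ := (isCompact_closedBall (0 : H) L).tendsto_subseq
    (x := σ) (fun k => by rw [mem_closedBall_zero_iff]; exact hσL k)
  have hwlim : Tendsto w atTop (𝓝 u) := by
    rw [tendsto_iff_norm_sub_tendsto_zero]
    exact squeeze_zero (fun _ => norm_nonneg _) (fun k => (hwlt k).le)
      tendsto_one_div_add_atTop_nhds_zero_nat
  have hwφ := hwlim.comp hφ.tendsto_atTop
  refine ⟨s', ?_, fun v hv => ?_⟩
  · have : Tendsto (fun k => ‖(σ ∘ φ) k - s‖) atTop (𝓝 ‖s' - s‖) := (hlim.sub_const s).norm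
    have hge := ge_of_tendsto' this fun k => hσc (φ k)
    rintro rfl
    rw [sub_self, norm_zero] at hge
    linarith
  · have h1 : Tendsto (fun k => B ((w ∘ φ) k)) atTop (𝓝 (B u)) :=
      ((hBc.continuousAt (hU.mem_nhds hu)).tendsto).comp hwφ
    have h2 : Tendsto (fun k => inner ℝ ((σ ∘ φ) k) (v - (w ∘ φ) k)) atTop
        (𝓝 (inner ℝ s' (v - u))) := hlim.inner (tendsto_const_nhds.sub hwφ)
    exact le_of_tendsto' (h1.add h2) fun k => hσ (φ k) v hv

end Subgradients

section CriticalValues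

open Filter Topology

theorem hausdorffMeasure_image_eq_zero_of_dist_le_sq {W : Type*} [NormedAddCommGroup W]
    [NormedSpace ℝ W] [FiniteDimensional ℝ W] {ι Y : Type*} [MetricSpace Y] [MeasurableSpace Y]
    [BorelSpace Y] {S : Set ι} {z : ι → W} {F : ι → Y} (hW : 0 < Module.finrank ℝ W) {c : ℝ≥0}
    (hF : ∀ i ∈ S, ∀ j ∈ S, dist (F i) (F j) ≤ c * dist (z i) (z j) ^ 2) :
    μH[(Module.finrank ℝ W : ℝ) / 2] (F '' S) = 0 := by
  rcases S.eq_empty_or_nonempty with rfl | ⟨i₀, -⟩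
  · simp
  have : Nonempty ι := ⟨i₀⟩
  borelize W
  have hinv : ∀ w ∈ z '' S, Function.invFunOn z S w ∈ S ∧ z (Function.invFunOn z S w) = w :=
    fun w hw => ⟨Function.invFunOn_mem hw, Function.invFunOn_eq hw⟩
  have hnull := hausdorffMeasure_image_eq_zero_of_quadratic (Z := z '' S)
    (φ := F ∘ Function.invFunOn z S) hW (C := c) (fun w hw w' hw' => by
      have := hF _ (hinv w hw).1 _ (hinv w' hw').1
      rwa [(hinv w hw).2, (hinv w' hw').2] at this)
  refine measure_mono_null ?_ hnull
  rintro _ ⟨i, hi, rfl⟩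
  refine ⟨z i, mem_image_of_mem z hi, ?_⟩
  obtain ⟨h1, h2⟩ := hinv _ (mem_image_of_mem z hi)
  have := hF _ h1 _ hi
  rw [h2, dist_self, zero_pow two_ne_zero, mul_zero] at this
  exact dist_le_zero.1 this

variable {H : Type*} [NormedAddCommGroup H] [InnerProductSpace ℝ H]

theorem exists_orthogonal_complement_map {d : H} (hd : ‖d‖ = 1) :
    ∃ P : H →ₗ[ℝ] (ℝ ∙ d)ᗮ, ∀ a b : H,
      inner ℝ a b = inner ℝ (P a) (P b) + inner ℝ a d * inner ℝ b d := by
  have hdd : inner ℝ d d = (1 : ℝ) := by rw [real_inner_self_eq_norm_sq, hd, one_pow]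
  refine ⟨LinearMap.codRestrict _ (LinearMap.id - (innerₛₗ ℝ d).smulRight d) (fun a => ?_),
    fun a b => ?_⟩
  · rw [Submodule.mem_orthogonal_singleton_iff_inner_right]
    simp [inner_sub_right, inner_smul_right, hd]
  · rw [Submodule.coe_inner]
    simp only [LinearMap.codRestrict_apply, LinearMap.sub_apply, LinearMap.id_apply,
      LinearMap.smulRight_apply, innerₛₗ_apply_apply, inner_sub_left, inner_sub_right,
      inner_smul_left, inner_smul_right, hdd, conj_trivial]
    rw [real_inner_comm d a, real_inner_comm d b]
    ring

/-- Points at which `A` and `B` have a common subgradient and `B` has subgradients with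
prescribed components `α`, `β` along `d`. -/
def kinkSet (U : Set H) (A B : H → ℝ) (d : H) (α β M : ℝ) : Set H :=
  {u | u ∈ U ∧ ∃ s s₁ s₂ : H, IsSubgradientOn U A s u ∧ IsSubgradientOn U B s u ∧
    IsSubgradientOn U B s₁ u ∧ IsSubgradientOn U B s₂ u ∧ inner ℝ s₁ d = α ∧ inner ℝ s₂ d = β ∧
    |inner ℝ s d| ≤ M}

variable [FiniteDimensional ℝ H] {U : Set H} {A B : H → ℝ}

theorem hausdorffMeasure_image_kinkSet {m : ℕ} (hm : 0 < m) (hH : Module.finrank ℝ H = m + 1)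
    {d : H} (hd : ‖d‖ = 1) {α β M : ℝ} (hαβ : α < β) :
    μH[(m : ℝ) / 2] ((fun u => A u - B u) '' kinkSet U A B d α β M) = 0 := by
  obtain ⟨P, hP⟩ := exists_orthogonal_complement_map hd
  have hfr : Module.finrank ℝ (ℝ ∙ d)ᗮ = m := by
    have : Fact (Module.finrank ℝ H = m + 1) := ⟨hH⟩
    exact Submodule.finrank_orthogonal_span_singleton (by rintro rfl; simp at hd)
  set S := kinkSet U A B d α β M with hS
  have hex : ∀ u : H, ∃ s s₁ s₂ : H, u ∈ S → u ∈ U ∧ IsSubgradientOn U A s u ∧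
      IsSubgradientOn U B s u ∧ IsSubgradientOn U B s₁ u ∧ IsSubgradientOn U B s₂ u ∧
      inner ℝ s₁ d = α ∧ inner ℝ s₂ d = β ∧ |inner ℝ s d| ≤ M := by
    intro u
    by_cases hu : u ∈ S
    · obtain ⟨h0, s, s₁, s₂, h⟩ := hu
      exact ⟨s, s₁, s₂, fun _ => ⟨h0, h⟩⟩
    · exact ⟨0, 0, 0, fun h => absurd h hu⟩
  choose s s₁ s₂ hs using hex
  set ζ : H → (ℝ ∙ d)ᗮ := fun u => P (s u) + (β - α)⁻¹ •
    ((M + inner ℝ (s u) d) • P (s₁ u) + (M - inner ℝ (s u) d) • P (s₂ u)) with hζ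
  have hκ : 0 < (β - α)⁻¹ := inv_pos.2 (sub_pos.2 hαβ)
  have key : ∀ u ∈ S, ∀ v ∈ S,
      (A v - B v) - (A u - B u) ≤ inner ℝ (ζ v - ζ u) (P v - P u) := by
    intro u hu v hv
    obtain ⟨huU, hA, hB, hB1, hB2, e1, e2, habs⟩ := hs u hu
    obtain ⟨hvU, hA', hB', hB1', hB2', e1', e2', habs'⟩ := hs v hv
    have f1 := hA' u huU
    have f2 := hB v hvU
    have f3 := hB1 v hvU
    have f4 := hB2 v hvU
    have f5 := hB1' u huU
    have f6 := hB2' u huU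
    rw [← neg_sub v u, inner_neg_right] at f1 f5 f6
    rw [hP, map_sub] at f1 f2 f3 f4 f5 f6
    rw [e1] at f3
    rw [e2] at f4
    rw [e1'] at f5
    rw [e2'] at f6
    set Δ := P v - P u with hΔ
    set τ : ℝ := inner ℝ (v - u) d with hτ
    have hb := abs_le.1 habs
    have hb' := abs_le.1 habs'
    rw [hζ]
    simp only [inner_sub_left, inner_add_left, inner_smul_left, conj_trivial]
    set σ : ℝ := inner ℝ (s u) d
    set σ' : ℝ := inner ℝ (s v) d
    have g1 := mul_le_mul_of_nonneg_left f3 (by linarith : 0 ≤ M + σ)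
    have g2 := mul_le_mul_of_nonneg_left f4 (by linarith : 0 ≤ M - σ)
    have g3 := mul_le_mul_of_nonneg_left f5 (by linarith : 0 ≤ M + σ')
    have g4 := mul_le_mul_of_nonneg_left f6 (by linarith : 0 ≤ M - σ')
    have hmain : (σ' - σ) * τ * (β - α) ≤
        ((M + σ') * inner ℝ (P (s₁ v)) Δ + (M - σ') * inner ℝ (P (s₂ v)) Δ) -
          ((M + σ) * inner ℝ (P (s₁ u)) Δ + (M - σ) * inner ℝ (P (s₂ u)) Δ) := by
      linarith
    have hmain' := mul_le_mul_of_nonneg_left hmain hκ.le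
    have e3 : (β - α)⁻¹ * ((σ' - σ) * τ * (β - α)) = (σ' - σ) * τ := by
      field_simp [(sub_pos.2 hαβ).ne']
    linarith
  have := hausdorffMeasure_image_eq_zero_of_dist_le_sq (S := S) (z := fun u => P u + ζ u)
    (F := fun u => A u - B u) (c := 1) (by rwa [hfr]) (fun u hu v hv => by
      have h1 := key u hu v hv
      have h2 := key v hv u hu
      rw [← neg_sub (ζ v), ← neg_sub (P v), inner_neg_neg] at h2
      have h3 : inner ℝ (ζ v - ζ u) (P v - P u) ≤ ‖P v - P u + (ζ v - ζ u)‖ ^ 2 := by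
        have e1 := norm_add_sq_real (P v - P u) (ζ v - ζ u)
        have e2 := norm_sub_sq_real (P v - P u) (ζ v - ζ u)
        rw [real_inner_comm]
        nlinarith [sq_nonneg ‖P v - P u + (ζ v - ζ u)‖, sq_nonneg ‖P v - P u - (ζ v - ζ u)‖]
      rw [NNReal.coe_one, one_mul, dist_comm (P u + ζ u), dist_eq_norm (P v + ζ v),
        add_sub_add_comm, Real.dist_eq]
      exact (abs_le.2 ⟨by linarith, by linarith⟩).trans h3)
  rwa [hfr] at this

/-- The critical values of a difference `A - B` of convex functions which decreases at a definite
rate near every point form a set of vanishing Hausdorff measure. -/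
theorem hausdorffMeasure_critical_values {m : ℕ} (hm : 0 < m)
    (hH : Module.finrank ℝ H = m + 1) (hU : IsOpen U) (hA : ConvexOn ℝ U A) (hB : ConvexOn ℝ U B)
    (hdesc : ∀ u ∈ U, ∀ r : ℝ, 0 < r → ∃ w ∈ U, w ≠ u ∧ ‖w - u‖ < r ∧
      A w - B w ≤ A u - B u - ‖w - u‖ / 2) :
    μH[(m : ℝ) / 2] ((fun u => A u - B u) '' {u | u ∈ U ∧ IsDCCritical U A B u}) = 0 := by
  set b := stdOrthonormalBasis ℝ H
  have hcover : {u | u ∈ U ∧ IsDCCritical U A B u} ⊆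
      ⋃ (i : Fin (Module.finrank ℝ H)) (q : ℚ × ℚ) (M : ℕ) (_ : q.1 < q.2),
        kinkSet U A B (b i) q.1 q.2 M := by
    rintro u ⟨hu, hcrit⟩
    obtain ⟨s, hsA, hsB⟩ := hcrit.exists_common_subgradient hU hA hB hu
    obtain ⟨s', hne, hs'⟩ := hB.exists_second_subgradient hU hu (s := s) (c := 1 / 2)
      (by norm_num) (fun r hr => by
        obtain ⟨w, hw, hwne, hwr, hle⟩ := hdesc u hu r hr
        exact ⟨w, hw, hwne, hwr, by linarith [hsA w hw]⟩)
    obtain ⟨i, hi⟩ : ∃ i, inner ℝ s (b i) ≠ inner ℝ s' (b i) := by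
      by_contra! hall
      exact hne (InnerProductSpace.ext_inner_right_basis b.toBasis fun i => by
        simpa using (hall i).symm)
    obtain ⟨M, hM⟩ := exists_nat_ge |inner ℝ s (b i)|
    have hex : ∀ a a' : H, IsSubgradientOn U B a u → IsSubgradientOn U B a' u →
        ∀ γ : ℝ, inner ℝ a (b i) < γ → γ < inner ℝ a' (b i) →
        ∃ t : H, IsSubgradientOn U B t u ∧ inner ℝ t (b i) = γ := by
      intro a a' ha ha' γ h1 h2
      have h3 : (0 : ℝ) < inner ℝ a' (b i) - inner ℝ a (b i) := by linarith
      refine ⟨_, ha.combo ha' (a := (inner ℝ a' (b i) - γ) / (inner ℝ a' (b i) - inner ℝ a (b i)))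
        (b := (γ - inner ℝ a (b i)) / (inner ℝ a' (b i) - inner ℝ a (b i)))
        (div_nonneg (by linarith) h3.le) (div_nonneg (by linarith) h3.le)
        (by rw [← add_div, sub_add_sub_cancel, div_self h3.ne']), ?_⟩
      rw [inner_add_left, inner_smul_left, inner_smul_left]
      simp only [conj_trivial]
      rw [div_mul_eq_mul_div, div_mul_eq_mul_div, ← add_div, div_eq_iff h3.ne']
      ring
    have hfin : ∀ a a' : H, IsSubgradientOn U B a u → IsSubgradientOn U B a' u →
        inner ℝ a (b i) < inner ℝ a' (b i) → ∃ q : ℚ × ℚ, q.1 < q.2 ∧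
          u ∈ kinkSet U A B (b i) q.1 q.2 M := by
      intro a a' ha ha' hlt
      obtain ⟨α, hα1, hα2⟩ := exists_rat_btwn hlt
      obtain ⟨β, hβ1, hβ2⟩ := exists_rat_btwn hα2
      obtain ⟨s₁, hs₁, e1⟩ := hex a a' ha ha' α hα1 hα2
      obtain ⟨s₂, hs₂, e2⟩ := hex a a' ha ha' β (hα1.trans hβ1) hβ2
      exact ⟨(α, β), by exact_mod_cast hβ1, hu, s, s₁, s₂, hsA, hsB, hs₁, hs₂, e1, e2, hM⟩
    obtain ⟨q, hq, hmem⟩ : ∃ q : ℚ × ℚ, q.1 < q.2 ∧ u ∈ kinkSet U A B (b i) q.1 q.2 M := by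
      rcases hi.lt_or_gt with hlt | hlt
      · exact hfin s s' hsB hs' hlt
      · exact hfin s' s hs' hsB hlt
    simp only [mem_iUnion]
    exact ⟨i, q, M, hq, hmem⟩
  refine measure_mono_null (image_mono hcover) ?_
  simp only [image_iUnion, measure_iUnion_null_iff]
  intro i q M hq
  exact hausdorffMeasure_image_kinkSet hm hH (b.orthonormal.1 i) (by exact_mod_cast hq)

end CriticalValues

section DCFunctions

variable {X : Type*} [NormedAddCommGroup X] [NormedSpace ℝ X] {G : Set X} {f f' : X → ℝ}

theorem IsDCOn.add (hf : IsDCOn G f) (hf' : IsDCOn G f') : IsDCOn G (fun x => f x + f' x) := by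
  obtain ⟨g, k, hg, hk, hgc, hkc, he⟩ := hf
  obtain ⟨g', k', hg', hk', hgc', hkc', he'⟩ := hf'
  refine ⟨g + g', k + k', hg.add hg', hk.add hk', hgc.add hgc', hkc.add hkc', fun x hx => ?_⟩
  simp only [he x hx, he' x hx, Pi.add_apply]
  ring

theorem IsDCOn.neg (hf : IsDCOn G f) : IsDCOn G (fun x => -f x) := by
  obtain ⟨g, k, hg, hk, hgc, hkc, he⟩ := hf
  exact ⟨k, g, hk, hg, hkc, hgc, fun x hx => by simp only [he x hx, neg_sub]⟩

theorem IsDCOn.mul_const_of_nonneg (hf : IsDCOn G f) {c : ℝ} (hc : 0 ≤ c) :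
    IsDCOn G (fun x => f x * c) := by
  obtain ⟨g, k, hg, hk, hgc, hkc, he⟩ := hf
  refine ⟨fun x => c • g x, fun x => c • k x, hg.smul hc, hk.smul hc, hgc.const_smul c,
    hkc.const_smul c, fun x hx => ?_⟩
  simp only [he x hx, smul_eq_mul]
  ring

theorem IsDCOn.mul_const (hf : IsDCOn G f) (c : ℝ) : IsDCOn G (fun x => f x * c) := by
  rcases le_total 0 c with hc | hc
  · exact hf.mul_const_of_nonneg hc
  · simpa using (hf.mul_const_of_nonneg (neg_nonneg.2 hc)).neg

theorem isDCOn_const (hG : Convex ℝ G) (c : ℝ) : IsDCOn G (fun _ => c) :=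
  ⟨fun _ => c, fun _ => 0, convexOn_const c hG, convexOn_const 0 hG, continuousOn_const,
    continuousOn_const, fun _ _ => (sub_zero c).symm⟩

end DCFunctions

section ImplicitFunction

open Filter Topology

variable {X : Type*} [NormedAddCommGroup X] [NormedSpace ℝ X]

theorem ConvexOn.slice {V : Set (X × ℝ)} {f : X × ℝ → ℝ} (hf : ConvexOn ℝ V f) (x : X) :
    ConvexOn ℝ {t : ℝ | (x, t) ∈ V} (fun t => f (x, t)) := by
  refine ⟨fun t ht t' ht' a b ha hb hab => ?_, fun t ht t' ht' a b ha hb hab => ?_⟩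
  · have := hf.1 ht ht' ha hb hab
    rwa [Prod.smul_mk, Prod.smul_mk, Prod.mk_add_mk, Convex.combo_self hab] at this
  · have := hf.2 ht ht' ha hb hab
    rwa [Prod.smul_mk, Prod.smul_mk, Prod.mk_add_mk, Convex.combo_self hab] at this

variable [FiniteDimensional ℝ X]

/-- An implicit function theorem for a difference `A - B` of convex functions: if `A` increases
strictly faster than `B` in the last variable, then its level sets are graphs of DC functions. -/
theorem exists_dc_implicit_function {V : Set (X × ℝ)} (hV : IsOpen V) {A B φ : X × ℝ → ℝ}
    (hA : ConvexOn ℝ V A) (hB : ConvexOn ℝ V B) (hφ : ConvexOn ℝ V φ) {x₀ : X} {t₀ : ℝ}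
    (h₀ : (x₀, t₀) ∈ V) (hm : (x₀, t₀ - 1) ∈ V) (hp : (x₀, t₀ + 1) ∈ V)
    (hlt : A (x₀, t₀ - 1) + B (x₀, t₀ + 1) < A (x₀, t₀) + B (x₀, t₀)) {R : ℝ} (hR : 0 < R) :
    ∃ (δ τ : ℝ) (g : X → ℝ), 0 < δ ∧ 0 < τ ∧ δ ≤ R ∧ τ ≤ R ∧
      (∀ x ∈ Metric.ball x₀ δ, |g x - t₀| < τ ∧ ∀ t : ℝ, |t - t₀| < τ →
        (A (x, t) - B (x, t) = A (x₀, t₀) - B (x₀, t₀) ↔ t = g x)) ∧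
      IsDCOn (Metric.ball x₀ δ) g ∧ IsDCOn (Metric.ball x₀ δ) (fun x => φ (x, g x)) := by
  have hAc := hA.continuousOn hV
  have hBc := hB.continuousOn hV
  set κ := (A (x₀, t₀) - A (x₀, t₀ - 1) + (B (x₀, t₀ + 1) - B (x₀, t₀))) / 2 with hκ
  set η := (A (x₀, t₀) - A (x₀, t₀ - 1) - (B (x₀, t₀ + 1) - B (x₀, t₀))) / 4 with hη
  have hη0 : 0 < η := by rw [hη]; linarith
  obtain ⟨L, T, hT, hLip⟩ := hφ.locallyLipschitzOn hV h₀
  rw [hV.nhdsWithin_eq h₀] at hT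
  have hcm : ContinuousAt (fun q : X × ℝ => (q.1, q.2 - 1)) (x₀, t₀) := by fun_prop
  have hcp : ContinuousAt (fun q : X × ℝ => (q.1, q.2 + 1)) (x₀, t₀) := by fun_prop
  have hA0 := hAc.continuousAt (hV.mem_nhds h₀)
  have hB0 := hBc.continuousAt (hV.mem_nhds h₀)
  have hAm : ContinuousAt (fun q : X × ℝ => A (q.1, q.2 - 1)) (x₀, t₀) :=
    ContinuousAt.comp (g := A) (hAc.continuousAt (hV.mem_nhds hm)) hcm
  have hBp : ContinuousAt (fun q : X × ℝ => B (q.1, q.2 + 1)) (x₀, t₀) :=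
    ContinuousAt.comp (g := B) (hBc.continuousAt (hV.mem_nhds hp)) hcp
  have ev1 : ∀ᶠ q in 𝓝 (x₀, t₀), q ∈ V := hV.mem_nhds h₀
  have ev2 : ∀ᶠ q in 𝓝 (x₀, t₀), (q.1, q.2 - 1) ∈ V := hcm (hV.mem_nhds hm)
  have ev3 : ∀ᶠ q in 𝓝 (x₀, t₀), (q.1, q.2 + 1) ∈ V := hcp (hV.mem_nhds hp)
  have ev4 : ∀ᶠ q in 𝓝 (x₀, t₀), κ + η < A q - A (q.1, q.2 - 1) :=
    continuousAt_const.eventually_lt (hA0.sub hAm) (by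
      simp only [hκ, hη]; linarith)
  have ev5 : ∀ᶠ q in 𝓝 (x₀, t₀), B (q.1, q.2 + 1) - B q < κ - η :=
    (hBp.sub hB0).eventually_lt continuousAt_const (by
      simp only [Pi.sub_apply, hκ, hη]; linarith)
  have ev6 : ∀ᶠ q in 𝓝 (x₀, t₀), q ∈ T := hT
  obtain ⟨R', hR', hbox⟩ := Metric.eventually_nhds_iff_ball.1
    (ev1.and (ev2.and (ev3.and (ev4.and (ev5.and ev6)))))
  have hmemb : ∀ x t, x ∈ Metric.ball x₀ R' → |t - t₀| < R' → (x, t) ∈ Metric.ball (x₀, t₀) R' :=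
    fun x t hx ht => by rw [← ball_prod_same]; exact ⟨hx, ht⟩
  have hAslope : ∀ x ∈ Metric.ball x₀ R', ∀ t t' : ℝ, |t - t₀| < R' → |t' - t₀| < R' → t ≤ t' →
      (κ + η) * (t' - t) ≤ A (x, t') - A (x, t) := by
    intro x hx t t' ht ht' hle
    rcases hle.eq_or_lt with rfl | hlt
    · simp
    obtain ⟨-, k2, -, k4, -⟩ := hbox _ (hmemb x t hx ht)
    have := (hA.slice x).slope_mono_adjacent (x := t - 1) (y := t) (z := t') k2
      (hbox _ (hmemb x t' hx ht')).1 (by linarith) hlt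
    rw [sub_sub_cancel, div_one, le_div_iff₀ (sub_pos.2 hlt)] at this
    refine le_trans ?_ this
    have : 0 < t' - t := sub_pos.2 hlt
    gcongr
  have hBslope : ∀ x ∈ Metric.ball x₀ R', ∀ t t' : ℝ, |t - t₀| < R' → |t' - t₀| < R' → t ≤ t' →
      B (x, t') - B (x, t) ≤ (κ - η) * (t' - t) := by
    intro x hx t t' ht ht' hle
    rcases hle.eq_or_lt with rfl | hlt
    · simp
    obtain ⟨-, -, k3, -, k5, -⟩ := hbox _ (hmemb x t' hx ht')
    have := (hB.slice x).slope_mono_adjacent (x := t) (y := t') (z := t' + 1)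
      (hbox _ (hmemb x t hx ht)).1 k3 hlt (by linarith)
    rw [add_sub_cancel_left, div_one, div_le_iff₀ (sub_pos.2 hlt)] at this
    refine this.trans ?_
    have : 0 < t' - t := sub_pos.2 hlt
    gcongr
  set r := A (x₀, t₀) - B (x₀, t₀) with hr
  have hFslope : ∀ x ∈ Metric.ball x₀ R', ∀ t t' : ℝ, |t - t₀| < R' → |t' - t₀| < R' → t ≤ t' →
      2 * η * (t' - t) ≤ (A (x, t') - B (x, t')) - (A (x, t) - B (x, t)) := by
    intro x hx t t' ht ht' hle
    have := hAslope x hx t t' ht ht' hle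
    have := hBslope x hx t t' ht ht' hle
    linarith
  set τ := min R (R' / 2) with hτ
  have hτ0 : 0 < τ := by positivity
  have hτR : τ < R' := (min_le_right _ _).trans_lt (by linarith)
  have hx₀R : x₀ ∈ Metric.ball x₀ R' := Metric.mem_ball_self hR'
  have habs0 : |t₀ - t₀| < R' := by simpa using hR'
  have habsm : |t₀ - τ - t₀| < R' := by rw [sub_sub_cancel_left, abs_neg, abs_of_pos hτ0]; exact hτR
  have habsp : |t₀ + τ - t₀| < R' := by rw [add_sub_cancel_left, abs_of_pos hτ0]; exact hτR
  have hcF : ∀ t : ℝ, |t - t₀| < R' →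
      ContinuousAt (fun x => A (x, t) - B (x, t)) x₀ := by
    intro t ht
    have hmem := hV.mem_nhds (hbox _ (hmemb x₀ t hx₀R ht)).1
    have hc : ContinuousAt (fun x : X => (x, t)) x₀ := by fun_prop
    exact (ContinuousAt.comp (g := A) (f := fun x : X => (x, t)) (hAc.continuousAt hmem) hc).sub
      (ContinuousAt.comp (g := B) (f := fun x : X => (x, t)) (hBc.continuousAt hmem) hc)
  have evm : ∀ᶠ x in 𝓝 x₀, A (x, t₀ - τ) - B (x, t₀ - τ) < r :=
    (hcF _ habsm).eventually_lt continuousAt_const (by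
      have := hFslope x₀ hx₀R _ _ habsm habs0 (by linarith)
      have : 0 < 2 * η * (t₀ - (t₀ - τ)) := by rw [sub_sub_cancel]; positivity
      linarith)
  have evp : ∀ᶠ x in 𝓝 x₀, r < A (x, t₀ + τ) - B (x, t₀ + τ) :=
    continuousAt_const.eventually_lt (hcF _ habsp) (by
      have := hFslope x₀ hx₀R _ _ habs0 habsp (by linarith)
      have : 0 < 2 * η * (t₀ + τ - t₀) := by rw [add_sub_cancel_left]; positivity
      linarith)
  obtain ⟨δ', hδ', hδs⟩ := Metric.eventually_nhds_iff_ball.1 (evm.and evp)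
  set δ := min R (min R' δ') with hδ
  have hδ0 : 0 < δ := by positivity
  have hδR : ∀ x ∈ Metric.ball x₀ δ, x ∈ Metric.ball x₀ R' :=
    Metric.ball_subset_ball ((min_le_right _ _).trans (min_le_left _ _))
  have hδδ : ∀ x ∈ Metric.ball x₀ δ, x ∈ Metric.ball x₀ δ' :=
    Metric.ball_subset_ball ((min_le_right _ _).trans (min_le_right _ _))
  have hex : ∀ x ∈ Metric.ball x₀ δ, ∃ t : ℝ, |t - t₀| < τ ∧ A (x, t) - B (x, t) = r := by
    intro x hx
    obtain ⟨h1, h2⟩ := hδs x (hδδ x hx)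
    have hc : ContinuousOn (fun t : ℝ => A (x, t) - B (x, t)) (Icc (t₀ - τ) (t₀ + τ)) := by
      have hmaps : MapsTo (fun t : ℝ => (x, t)) (Icc (t₀ - τ) (t₀ + τ)) V := fun t ht =>
        (hbox _ (hmemb x t (hδR x hx) ((abs_le.2 ⟨by linarith [ht.1], by linarith [ht.2]⟩).trans_lt
          hτR))).1
      have hc' : ContinuousOn (fun t : ℝ => (x, t)) (Icc (t₀ - τ) (t₀ + τ)) := by fun_prop
      exact (hAc.comp hc' hmaps).sub (hBc.comp hc' hmaps)
    obtain ⟨t, ht, hteq⟩ := intermediate_value_Ioo (by linarith) hc ⟨h1, h2⟩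
    exact ⟨t, abs_lt.2 ⟨by linarith [ht.1], by linarith [ht.2]⟩, hteq⟩
  choose! g hgτ hgr using hex
  have hconv : Convex ℝ (Metric.ball x₀ δ) := convex_ball x₀ δ
  set a : X → ℝ := fun x => A (x, g x) - κ * g x with ha
  have haB : ∀ x ∈ Metric.ball x₀ δ, a x = B (x, g x) - κ * g x + r := by
    intro x hx
    rw [ha, ← hgr x hx]
    ring
  have hcombo : ∀ x ∈ Metric.ball x₀ δ, ∀ y ∈ Metric.ball x₀ δ, ∀ b c : ℝ, 0 ≤ b → 0 ≤ c →
      b + c = 1 → |b * g x + c * g y - t₀| < τ := by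
    intro x hx y hy b c hb hc hbc
    have := (convex_ball t₀ τ) (x := g x) (hgτ x hx) (y := g y) (hgτ y hy) hb hc hbc
    exact this
  have hkey : ∀ x ∈ Metric.ball x₀ δ, ∀ y ∈ Metric.ball x₀ δ, ∀ b c : ℝ, 0 ≤ b → 0 ≤ c →
      b + c = 1 → a (b • x + c • y) + η * |b * g x + c * g y - g (b • x + c • y)| ≤
        b * a x + c * a y := by
    intro x hx y hy b c hb hc hbc
    have hz := hconv hx hy hb hc hbc
    set z := b • x + c • y with hzdef
    set t := b * g x + c * g y with ht
    have htτ := (hcombo x hx y hy b c hb hc hbc).trans hτR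
    have hgz := (hgτ z hz).trans hτR
    have hxV := (hbox _ (hmemb x _ (hδR x hx) ((hgτ x hx).trans hτR))).1
    have hyV := (hbox _ (hmemb y _ (hδR y hy) ((hgτ y hy).trans hτR))).1
    have hpt : b • (x, g x) + c • (y, g y) = (z, t) := rfl
    rcases le_total (g z) t with hle | hle
    · have h1 := hA.2 hxV hyV hb hc hbc
      have h2 := hAslope z (hδR z hz) _ _ hgz htτ hle
      rw [hpt, smul_eq_mul, smul_eq_mul] at h1
      rw [abs_of_nonneg (sub_nonneg.2 hle), ha]
      simp only
      have h3 : κ * t = b * (κ * g x) + c * (κ * g y) := by rw [ht]; ring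
      linarith
    · have h1 := hB.2 hxV hyV hb hc hbc
      have h2 := hBslope z (hδR z hz) _ _ htτ hgz hle
      rw [hpt, smul_eq_mul, smul_eq_mul] at h1
      rw [abs_of_nonpos (sub_nonpos.2 hle), haB z hz, haB x hx, haB y hy]
      have h3 : κ * t = b * (κ * g x) + c * (κ * g y) := by rw [ht]; ring
      have h4 : r = b * r + c * r := by rw [← add_mul, hbc, one_mul]
      linarith
  have hopen : IsOpen (Metric.ball x₀ δ) := Metric.isOpen_ball
  have hconvex : ∀ f : X → ℝ, (∀ x ∈ Metric.ball x₀ δ, ∀ y ∈ Metric.ball x₀ δ, ∀ b c : ℝ, 0 ≤ b →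
      0 ≤ c → b + c = 1 → f (b • x + c • y) ≤ b * f x + c * f y) →
      ConvexOn ℝ (Metric.ball x₀ δ) f ∧ ContinuousOn f (Metric.ball x₀ δ) := by
    intro f hf
    have : ConvexOn ℝ (Metric.ball x₀ δ) f :=
      ⟨hconv, fun x hx y hy b c hb hc hbc => hf x hx y hy b c hb hc hbc⟩
    exact ⟨this, this.continuousOn hopen⟩
  have hadd : ∀ σ : ℝ, |σ| ≤ η → ConvexOn ℝ (Metric.ball x₀ δ) (fun x => a x + σ * g x) ∧
      ContinuousOn (fun x => a x + σ * g x) (Metric.ball x₀ δ) := by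
    intro σ hσ
    refine hconvex _ fun x hx y hy b c hb hc hbc => ?_
    have h1 := hkey x hx y hy b c hb hc hbc
    have h2 : -(σ * (b * g x + c * g y - g (b • x + c • y))) ≤
        η * |b * g x + c * g y - g (b • x + c • y)| :=
      (neg_le_abs _).trans (by rw [abs_mul]; gcongr)
    linarith
  refine ⟨δ, τ, g, hδ0, hτ0, min_le_left _ _, min_le_left _ _, fun x hx => ⟨hgτ x hx, fun t ht =>
    ⟨fun heq => ?_, fun heq => by rw [heq, hgr x hx]⟩⟩, ?_, ?_⟩
  · rcases le_total (g x) t with hle | hle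
    · have := hFslope x (hδR x hx) _ _ ((hgτ x hx).trans hτR) (ht.trans hτR) hle
      rw [heq, hgr x hx, sub_self] at this
      nlinarith
    · have := hFslope x (hδR x hx) _ _ (ht.trans hτR) ((hgτ x hx).trans hτR) hle
      rw [heq, hgr x hx, sub_self] at this
      nlinarith
  · obtain ⟨h1, h1'⟩ := hadd η (abs_of_pos hη0).le
    obtain ⟨h2, h2'⟩ := hadd (-η) (by rw [abs_neg, abs_of_pos hη0])
    have hdc : IsDCOn (Metric.ball x₀ δ) (fun x => g x * (2 * η)) :=
      ⟨_, _, h1, h2, h1', h2', fun x _ => by ring⟩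
    have := hdc.mul_const (2 * η)⁻¹
    simpa [mul_assoc, mul_inv_cancel_right₀, hη0.ne'] using this
  · set M : ℝ := L / η with hM
    have hM0 : 0 ≤ M := div_nonneg L.coe_nonneg hη0.le
    obtain ⟨h1, -⟩ := hadd 0 (by rw [abs_zero]; exact hη0.le)
    have ha' : ConvexOn ℝ (Metric.ball x₀ δ) (fun x => M * a x) := by
      simpa using h1.smul hM0
    obtain ⟨h2, h2'⟩ := hconvex (fun x => φ (x, g x) + M * a x) fun x hx y hy b c hb hc hbc => by
      have hz := hconv hx hy hb hc hbc
      set z := b • x + c • y with hzdef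
      set t := b * g x + c * g y with ht
      have htτ := (hcombo x hx y hy b c hb hc hbc).trans hτR
      have hgz := (hgτ z hz).trans hτR
      have hxV := (hbox _ (hmemb x _ (hδR x hx) ((hgτ x hx).trans hτR))).1
      have hyV := (hbox _ (hmemb y _ (hδR y hy) ((hgτ y hy).trans hτR))).1
      have k1 := hφ.2 hxV hyV hb hc hbc
      have hpt : b • (x, g x) + c • (y, g y) = (z, t) := rfl
      rw [hpt, smul_eq_mul, smul_eq_mul] at k1
      have hzT := (hbox _ (hmemb z _ (hδR z hz) hgz)).2.2.2.2.2
      have htT := (hbox _ (hmemb z _ (hδR z hz) htτ)).2.2.2.2.2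
      have k2 := hLip.dist_le_mul _ hzT _ htT
      rw [dist_prod_same_left, Real.dist_eq, Real.dist_eq, abs_sub_comm (g z)] at k2
      have k3 := (le_abs_self _).trans k2
      have k4 := mul_le_mul_of_nonneg_left (hkey x hx y hy b c hb hc hbc) hM0
      rw [mul_add, ← mul_assoc M η, hM, div_mul_cancel₀ _ hη0.ne', ← hM] at k4
      linarith
    exact ⟨_, _, h2, ha', h2', ha'.continuousOn hopen, fun x _ => by ring⟩

end ImplicitFunction

section DCCharts

variable {E : Type*} [NormedAddCommGroup E] [InnerProductSpace ℝ E] [FiniteDimensional ℝ E]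
  {C K : Set E} {e p : E} {ε ρ c : ℝ}

/-- The convex function whose sum with a concave one is the surface distance in a chart. -/
noncomputable def convexPart (C : Set E) (e : E) (c : ℝ) (z : E) : ℝ :=
  2 * height C e z + c * ‖z‖ ^ 2

/-- The convex function subtracted from `convexPart` to obtain the surface distance. -/
noncomputable def concavePart (C K : Set E) (e : E) (c : ℝ) (z : E) : ℝ :=
  convexPart C e c z - surfDist (frontier C) K (lowerPoint C e z)

/-- A parametrization of a piece of `frontier C` along `e` in which the surface distance to `K`
is a difference of convex functions. -/
structure IsDCChart (C K : Set E) (e p : E) (ε ρ c : ℝ) : Prop where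
  norm_eq : ‖e‖ = 1
  ρ_pos : 0 < ρ
  add_mem_interior : ∀ z ∈ Metric.ball p ε, lowerPoint C e z + ρ • e ∈ interior C
  ball_subset : Metric.ball p ε ⊆ shadow C e
  convexOn_convexPart : ConvexOn ℝ (Metric.ball p ε) (convexPart C e c)
  convexOn_concavePart : ConvexOn ℝ (Metric.ball p ε) (concavePart C K e c)
  exists_descent : ∀ z ∈ Metric.ball p ε, ∀ r : ℝ, 0 < r → ∃ w : E, inner ℝ e w = 0 ∧ w ≠ 0 ∧
    ‖w‖ < r ∧ surfDist (frontier C) K (lowerPoint C e (z + w)) ≤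
      surfDist (frontier C) K (lowerPoint C e z) - ‖w‖ / 2

theorem convexOn_norm_sq (s : Set E) (hs : Convex ℝ s) {c : ℝ} (hc : 0 ≤ c) :
    ConvexOn ℝ s (fun z => c * ‖z‖ ^ 2) :=
  ((convexOn_norm hs).pow (fun _ _ => norm_nonneg _) 2).smul hc

theorem SurfacePair.exists_isDCChart (h : SurfacePair C K) (hp : p ∈ frontier C) (hpK : p ∉ K) :
    ∃ (e : E) (ε ρ c : ℝ), 0 < ε ∧ IsDCChart C K e p ε ρ c ∧ p + ρ • e ∈ interior C := by
  obtain ⟨e, he, ρ, hρ, hint⟩ := h.body.exists_direction hp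
  obtain ⟨ε, η, δ, hε, hch⟩ := h.exists_isSurfaceChart hp hpK he hρ hint
  obtain ⟨D, hD0, hD⟩ := h.exists_surfDist_le
  set c := (1 + (ρ + D) / η) ^ 2 / δ + 1 with hc
  have hδ := hch.δ_pos
  have hc0 : 0 ≤ c := by positivity
  have hb : Convex ℝ (Metric.ball p ε) := convex_ball p ε
  have hh : ConvexOn ℝ (Metric.ball p ε) (height C e) :=
    (h.body.convexOn_height he).subset hch.ball_subset hb
  refine ⟨e, ε, ρ, c, hε, ⟨he, hρ, fun z hz => hch.add_mem_interior hz, hch.ball_subset,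
    (hh.smul zero_le_two).add (convexOn_norm_sq _ hb hc0), ?_,
    fun z hz r hr => hch.exists_descent h hz hr⟩, hint⟩
  refine (hch.concaveOn h hD (c := c) (by rw [hc]; linarith)).neg.congr fun z _ => ?_
  simp only [Pi.neg_apply, concavePart, convexPart]
  ring

/-- The projection along `e` onto the hyperplane through `p` orthogonal to `e`. -/
noncomputable def foot (e p q : E) : E := q - inner ℝ e (q - p) • e

theorem inner_foot_sub (he : ‖e‖ = 1) (q : E) : inner ℝ e (foot e p q - p) = 0 := by
  rw [foot, sub_right_comm, inner_sub_right, inner_smul_right, real_inner_self_eq_norm_sq, he]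
  ring

theorem IsDCChart.lowerPoint_foot (hch : IsDCChart C K e p ε ρ c) (h : SurfacePair C K) {q : E}
    (hq : q ∈ frontier C) (hint : q + ρ • e ∈ interior C) : lowerPoint C e (foot e p q) = q := by
  rw [foot, sub_eq_add_neg, ← neg_smul, h.body.lowerPoint_add_smul hch.norm_eq ⟨ρ, hint⟩,
    h.body.lowerPoint_eq_self hch.norm_eq hq hch.ρ_pos hint]

theorem finrank_orthogonal_span_pair {n : ℕ} (hE : Module.finrank ℝ E = n + 1) {e y : E}
    (he : e ≠ 0) (hy : y ≠ 0) (hey : inner ℝ e y = 0) :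
    Module.finrank ℝ (Submodule.span ℝ {e, y})ᗮ = n - 1 := by
  have hli : LinearIndependent ℝ ![e, y] := by
    refine linearIndependent_of_ne_zero_of_inner_eq_zero (𝕜 := ℝ) ?_ ?_
    · intro i; fin_cases i <;> simpa
    · intro i j hij
      fin_cases i <;> fin_cases j <;> simp_all [real_inner_comm]
  have h2 := finrank_span_eq_card hli
  rw [Matrix.range_cons_cons_empty, Fintype.card_fin] at h2
  have := Submodule.finrank_add_finrank_orthogonal (Submodule.span ℝ {e, y})
  omega

theorem mem_orthogonal_span_pair {e y x : E} :
    x ∈ (Submodule.span ℝ {e, y})ᗮ ↔ inner ℝ e x = 0 ∧ inner ℝ y x = 0 := by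
  rw [Submodule.span_insert, ← Submodule.inf_orthogonal, Submodule.mem_inf,
    Submodule.mem_orthogonal_singleton_iff_inner_right,
    Submodule.mem_orthogonal_singleton_iff_inner_right]

/-- Around a point which is not critical in the chart, the level set of the surface distance is a
DC graph. -/
theorem IsDCChart.exists_dc_graph {n : ℕ} (hE : Module.finrank ℝ E = n + 1)
    (hch : IsDCChart C K e p ε ρ c) (h : SurfacePair C K) {q : E} (hq : q ∈ frontier C)
    (hint : q + ρ • e ∈ interior C) (hfoot : foot e p q ∈ Metric.ball p ε) {y : E}
    (hey : inner ℝ e y = 0) (hm : foot e p q - y ∈ Metric.ball p ε)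
    (hp : foot e p q + y ∈ Metric.ball p ε)
    (hlt : convexPart C e c (foot e p q - y) + concavePart C K e c (foot e p q + y) <
      convexPart C e c (foot e p q) + concavePart C K e c (foot e p q)) :
    ∃ Q : Submodule ℝ E, Module.finrank ℝ Q = n - 1 ∧
      ∃ W : Set E, IsOpen W ∧ q ∈ W ∧ ∃ G : Set Q, IsOpen G ∧
        ∃ k : Q → Qᗮ, LocallyDCMapOn G k ∧
          {x ∈ frontier C | surfDist (frontier C) K x = surfDist (frontier C) K q} ∩ W =
            (fun u : Q => (u : E) + ((k u : Qᗮ) : E)) '' G := by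
  have he := hch.norm_eq
  have hee : inner ℝ e e = (1 : ℝ) := by rw [real_inner_self_eq_norm_sq, he, one_pow]
  have hye : inner ℝ y e = (0 : ℝ) := by rw [real_inner_comm, hey]
  have hy : y ≠ 0 := by
    rintro rfl
    simp at hlt
  have hyy : inner ℝ y y ≠ (0 : ℝ) := inner_self_ne_zero.2 hy
  set Q : Submodule ℝ E := (Submodule.span ℝ {e, y})ᗮ with hQ
  set τc : E → ℝ := fun x => inner ℝ y x / inner ℝ y y with hτc
  have hπmem : ∀ x : E, x - inner ℝ e x • e - τc x • y ∈ Q := by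
    intro x
    rw [hQ, mem_orthogonal_span_pair]
    simp only [inner_sub_right, inner_smul_right, hee, hey, hye, hτc]
    constructor
    · ring
    · field_simp
      ring
  set π : E → Q := fun x => ⟨x - inner ℝ e x • e - τc x • y, hπmem x⟩ with hπ
  set a₀ : ℝ := inner ℝ e p with ha₀
  set L : Q × ℝ →ₗ[ℝ] E := Q.subtype.coprod (LinearMap.toSpanSingleton ℝ E y) with hL
  set Ψ : Q × ℝ →ᵃ[ℝ] E := L.toAffineMap + AffineMap.const ℝ (Q × ℝ) (a₀ • e) with hΨ
  have hΨa : ∀ (x : Q) (t : ℝ), Ψ (x, t) = (x : E) + t • y + a₀ • e := fun x t => by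
    simp [hΨ, hL]
  have hΨc : Continuous Ψ := AffineMap.continuous_of_finiteDimensional Ψ
  have hπΨ : ∀ (x : Q) (t s : ℝ), π ((x : E) + t • y + s • e) = x ∧
      τc ((x : E) + t • y + s • e) = t := by
    intro x t s
    obtain ⟨h1, h2⟩ := mem_orthogonal_span_pair.1 x.2
    have h3 : τc ((x : E) + t • y + s • e) = t := by
      simp only [hτc, inner_add_right, inner_smul_right, h2, hye]
      field_simp
      ring
    refine ⟨Subtype.ext ?_, h3⟩
    simp only [hπ]
    rw [h3]
    simp only [inner_add_right, inner_smul_right, h1, hey, hee]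
    module
  have hdecomp : ∀ x : E, foot e p x = Ψ (π x, τc x) := by
    intro x
    rw [hΨa]
    simp only [hπ, foot, inner_sub_right]
    module
  set V : Set (Q × ℝ) := Ψ ⁻¹' Metric.ball p ε with hV
  have hVo : IsOpen V := Metric.isOpen_ball.preimage hΨc
  have hA := hch.convexOn_convexPart.comp_affineMap Ψ
  have hB := hch.convexOn_concavePart.comp_affineMap Ψ
  have hφ := ((h.body.convexOn_height he).subset hch.ball_subset
    (convex_ball p ε)).comp_affineMap Ψ
  have hΨm : Ψ (π q, τc q - 1) = foot e p q - y := by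
    rw [hdecomp, hΨa, hΨa]; module
  have hΨp : Ψ (π q, τc q + 1) = foot e p q + y := by
    rw [hdecomp, hΨa, hΨa]; module
  have hV0 : (π q, τc q) ∈ V := by rwa [hV, mem_preimage, ← hdecomp]
  obtain ⟨R, hR, hRV⟩ := Metric.isOpen_iff.1 hVo _ hV0
  obtain ⟨δ, τ, g, hδ, hτ, hδR, hτR, hg, hgdc, hφdc⟩ := exists_dc_implicit_function hVo hA hB hφ
    hV0 (by rwa [hV, mem_preimage, hΨm]) (by rwa [hV, mem_preimage, hΨp])
    (by simpa only [Function.comp_apply, hΨm, hΨp, ← hdecomp] using hlt) hR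
  have hgV : ∀ x ∈ Metric.ball (π q) δ, Ψ (x, g x) ∈ Metric.ball p ε := by
    intro x hx
    refine hRV ?_
    rw [← ball_prod_same]
    exact ⟨Metric.ball_subset_ball hδR hx, lt_of_lt_of_le (hg x hx).1 hτR⟩
  have hF : ∀ w : Q × ℝ, (convexPart C e c ∘ Ψ) w - (concavePart C K e c ∘ Ψ) w =
      surfDist (frontier C) K (lowerPoint C e (Ψ w)) := by
    intro w
    simp only [Function.comp_apply, concavePart]
    ring
  simp only [hF] at hg
  rw [← hdecomp, hch.lowerPoint_foot h hq hint] at hg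
  have hyQ : y ∈ Qᗮ := by
    rw [hQ]
    exact Submodule.le_orthogonal_orthogonal _ (Submodule.subset_span (by simp))
  have heQ : e ∈ Qᗮ := by
    rw [hQ]
    exact Submodule.le_orthogonal_orthogonal _ (Submodule.subset_span (by simp))
  set φ : Q × ℝ → ℝ := height C e ∘ Ψ with hφdef
  set k : Q → Qᗮ := fun u => g u • ⟨y, hyQ⟩ + (a₀ + φ (u, g u)) • ⟨e, heQ⟩ with hk
  have hkΨ : ∀ u : Q, (u : E) + (k u : E) = lowerPoint C e (Ψ (u, g u)) := by
    intro u
    simp only [hk, lowerPoint, hφdef, Function.comp_apply, Submodule.coe_add, Submodule.coe_smul]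
    rw [hΨa]
    module
  have hτcc : Continuous τc := by simp only [hτc]; fun_prop
  have hπc : Continuous π := by
    refine Continuous.subtype_mk ?_ _
    fun_prop
  refine ⟨Q, finrank_orthogonal_span_pair hE (norm_ne_zero_iff.1 (by rw [he]; exact one_ne_zero))
    hy hey, {x | x + ρ • e ∈ interior C} ∩ (π ⁻¹' Metric.ball (π q) δ ∩
      τc ⁻¹' Metric.ball (τc q) τ), ?_, ⟨hint, Metric.mem_ball_self hδ, Metric.mem_ball_self hτ⟩,
    Metric.ball (π q) δ, Metric.isOpen_ball, k, ?_, ?_⟩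
  · exact (isOpen_interior.preimage (by fun_prop : Continuous fun x : E => x + ρ • e)).inter
      ((Metric.isOpen_ball.preimage hπc).inter (Metric.isOpen_ball.preimage hτcc))
  · refine fun x hx => ⟨Metric.ball (π q) δ, Metric.isOpen_ball, convex_ball _ _, hx, Subset.rfl,
      fun ℓ => ?_⟩
    have := (hgdc.mul_const (ℓ ⟨y, hyQ⟩)).add
      (((isDCOn_const (convex_ball (π q) δ) a₀).add hφdc).mul_const (ℓ ⟨e, heQ⟩))
    simpa only [hk, map_add, map_smul, smul_eq_mul] using this
  · ext x
    constructor
    · rintro ⟨⟨hx, hxr⟩, hxint, hxπ, hxτ⟩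
      have hlow := hch.lowerPoint_foot h hx hxint
      rw [hdecomp] at hlow
      have := ((hg _ hxπ).2 (τc x) hxτ).1 (by rw [hlow, hxr])
      refine ⟨π x, hxπ, ?_⟩
      simp only [hkΨ]
      rw [← this, hlow]
    · rintro ⟨u, hu, rfl⟩
      simp only [hkΨ]
      have hmem := hgV u hu
      refine ⟨⟨h.body.lowerPoint_mem_frontier he (hch.ball_subset hmem),
        ((hg u hu).2 (g u) (hg u hu).1).2 rfl⟩, hch.add_mem_interior _ hmem, ?_⟩
      have e1 : lowerPoint C e (Ψ (u, g u)) = (u : E) + g u • y + (a₀ + φ (u, g u)) • e := by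
        simp only [lowerPoint, hφdef, Function.comp_apply]
        rw [hΨa]
        module
      obtain ⟨e2, e3⟩ := hπΨ u (g u) (a₀ + φ (u, g u))
      rw [e1]
      refine ⟨?_, ?_⟩
      · rw [mem_preimage, e2]; exact hu
      · rw [mem_preimage, e3]; exact (hg u hu).1

end DCCharts

section ChartCovering

variable {E : Type*} [NormedAddCommGroup E] [InnerProductSpace ℝ E] [FiniteDimensional ℝ E]
  {C K : Set E} {e p : E} {ε ρ c : ℝ}

/-- The points of `frontier C` covered by a chart. -/
def chartDomain (C : Set E) (e p : E) (ε ρ : ℝ) : Set E :=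
  {q | q ∈ frontier C ∧ q + ρ • e ∈ interior C ∧ foot e p q ∈ Metric.ball p ε}

/-- The points having a regular position with respect to the two convex functions of a chart. -/
def chartRegular (C K : Set E) (e p : E) (ε c : ℝ) : Set E :=
  {q | ∃ y : E, inner ℝ e y = 0 ∧ foot e p q - y ∈ Metric.ball p ε ∧
    foot e p q + y ∈ Metric.ball p ε ∧
    convexPart C e c (foot e p q - y) + concavePart C K e c (foot e p q + y) <
      convexPart C e c (foot e p q) + concavePart C K e c (foot e p q)}

theorem IsDCChart.hausdorffMeasure_critical_values {m : ℕ} (hm : 0 < m)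
    (hE : Module.finrank ℝ E = m + 2) (hch : IsDCChart C K e p ε ρ c) (h : SurfacePair C K) :
    μH[(m : ℝ) / 2] (surfDist (frontier C) K ''
      (chartDomain C e p ε ρ \ chartRegular C K e p ε c)) = 0 := by
  have he := hch.norm_eq
  have he0 : e ≠ 0 := by
    rintro rfl
    simp at he
  set H : Submodule ℝ E := (ℝ ∙ e)ᗮ with hH
  have hmem : ∀ x : E, x ∈ H ↔ inner ℝ e x = 0 := fun x =>
    Submodule.mem_orthogonal_singleton_iff_inner_right
  have hfin : Module.finrank ℝ H = m + 1 := by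
    have : Fact (Module.finrank ℝ E = (m + 1) + 1) := ⟨hE⟩
    exact Submodule.finrank_orthogonal_span_singleton he0
  set Φ : H →ᵃ[ℝ] E := H.subtype.toAffineMap + AffineMap.const ℝ H p with hΦ
  have hΦa : ∀ u : H, Φ u = (u : E) + p := fun u => by simp [hΦ]
  have hΦc : Continuous Φ := AffineMap.continuous_of_finiteDimensional Φ
  have hU : IsOpen (Φ ⁻¹' Metric.ball p ε) := Metric.isOpen_ball.preimage hΦc
  have hnull := _root_.hausdorffMeasure_critical_values hm hfin hU
    (hch.convexOn_convexPart.comp_affineMap Φ) (hch.convexOn_concavePart.comp_affineMap Φ) (by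
      intro u hu r hr
      obtain ⟨s, hs, hball⟩ := Metric.isOpen_iff.1 hU u hu
      obtain ⟨w, hw, hw0, hwr, hle⟩ := hch.exists_descent (Φ u) hu (min r s) (lt_min hr hs)
      have hΦw : Φ (u + ⟨w, (hmem w).2 hw⟩) = Φ u + w := by
        simp only [hΦa, Submodule.coe_add]
        abel
      refine ⟨u + ⟨w, (hmem w).2 hw⟩, hball ?_, ?_, ?_, ?_⟩
      · rw [Metric.mem_ball, dist_eq_norm, add_sub_cancel_left]
        exact hwr.trans_le (min_le_right _ _)
      · intro heq
        exact hw0 (congrArg Subtype.val (add_eq_left.1 heq))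
      · rw [add_sub_cancel_left]
        exact hwr.trans_le (min_le_left _ _)
      · rw [add_sub_cancel_left]
        simp only [Function.comp_apply, hΦw, concavePart, sub_sub_cancel]
        exact hle)
  refine measure_mono_null ?_ hnull
  rintro _ ⟨q, ⟨⟨hq, hint, hfoot⟩, hreg⟩, rfl⟩
  have hΦq : Φ ⟨foot e p q - p, (hmem _).2 (inner_foot_sub he q)⟩ = foot e p q := by
    rw [hΦa, sub_add_cancel]
  refine ⟨⟨foot e p q - p, (hmem _).2 (inner_foot_sub he q)⟩, ⟨?_, ?_⟩, ?_⟩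
  · rwa [mem_preimage, hΦq]
  · intro y hy₁ hy₂
    have h₁ : Φ (⟨foot e p q - p, (hmem _).2 (inner_foot_sub he q)⟩ - y) =
        foot e p q - y := by
      simp only [hΦa, Submodule.coe_sub]
      abel
    have h₂ : Φ (⟨foot e p q - p, (hmem _).2 (inner_foot_sub he q)⟩ + y) =
        foot e p q + y := by
      simp only [hΦa, Submodule.coe_add]
      abel
    rw [mem_preimage, h₁] at hy₁
    rw [mem_preimage, h₂] at hy₂
    simp only [Function.comp_apply, h₁, h₂, hΦq]
    by_contra hlt
    exact hreg ⟨y, (hmem _).1 y.2, hy₁, hy₂, not_le.1 hlt⟩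
  · simp only [Function.comp_apply, hΦq, concavePart, sub_sub_cancel]
    rw [hch.lowerPoint_foot h hq hint]

theorem continuous_foot (e p : E) : Continuous (foot e p) := by
  unfold foot
  fun_prop

theorem isOpen_chartPatch (C : Set E) (e p : E) (ε ρ : ℝ) :
    IsOpen {q : E | q + ρ • e ∈ interior C ∧ foot e p q ∈ Metric.ball p ε} :=
  (isOpen_interior.preimage (by fun_prop : Continuous fun q : E => q + ρ • e)).inter
    (Metric.isOpen_ball.preimage (continuous_foot e p))

theorem IsDCChart.isOpen_regular (hch : IsDCChart C K e p ε ρ c) :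
    IsOpen ({q : E | q + ρ • e ∈ interior C ∧ foot e p q ∈ Metric.ball p ε} ∩
      chartRegular C K e p ε c) := by
  have hA := hch.convexOn_convexPart.continuousOn Metric.isOpen_ball
  have hB := hch.convexOn_concavePart.continuousOn Metric.isOpen_ball
  rw [isOpen_iff_mem_nhds]
  rintro q ⟨⟨hint, hfoot⟩, y, hy, h₁, h₂, hlt⟩
  have hf := (continuous_foot e p).continuousAt (x := q)
  have hf₁ : ContinuousAt (fun q => foot e p q - y) q := hf.sub continuousAt_const
  have hf₂ : ContinuousAt (fun q => foot e p q + y) q := hf.add continuousAt_const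
  have hnhds : ∀ {x : E}, x ∈ Metric.ball p ε → Metric.ball p ε ∈ nhds x := fun hx =>
    Metric.isOpen_ball.mem_nhds hx
  have hL := (ContinuousAt.comp (g := convexPart C e c) (f := fun q => foot e p q - y)
    (hA.continuousAt (hnhds h₁)) hf₁).add
    (ContinuousAt.comp (g := concavePart C K e c) (f := fun q => foot e p q + y)
    (hB.continuousAt (hnhds h₂)) hf₂)
  have hR := (ContinuousAt.comp (g := convexPart C e c) (f := foot e p)
    (hA.continuousAt (hnhds hfoot)) hf).add
    (ContinuousAt.comp (g := concavePart C K e c) (f := foot e p)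
    (hB.continuousAt (hnhds hfoot)) hf)
  filter_upwards [(isOpen_chartPatch C e p ε ρ).mem_nhds ⟨hint, hfoot⟩,
    hf₁ (hnhds h₁), hf₂ (hnhds h₂), hL.eventually_lt hR hlt] with x hx hx₁ hx₂ hxlt
  exact ⟨hx, y, hy, hx₁, hx₂, hxlt⟩

/-- The points of `E` which are regular in some chart. -/
def regularSet (C K : Set E) : Set E :=
  ⋃ (e : E) (p : E) (ε : ℝ) (ρ : ℝ) (c : ℝ) (_ : IsDCChart C K e p ε ρ c),
    {q : E | q + ρ • e ∈ interior C ∧ foot e p q ∈ Metric.ball p ε} ∩ chartRegular C K e p ε c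

theorem isOpen_regularSet (C K : Set E) : IsOpen (regularSet C K) :=
  isOpen_iUnion fun _ => isOpen_iUnion fun _ => isOpen_iUnion fun _ => isOpen_iUnion fun _ =>
    isOpen_iUnion fun _ => isOpen_iUnion fun hch => hch.isOpen_regular

theorem SurfacePair.hausdorffMeasure_singular_values {m : ℕ} (hm : 0 < m)
    (hE : Module.finrank ℝ E = m + 2) (h : SurfacePair C K) :
    μH[(m : ℝ) / 2] (surfDist (frontier C) K '' (frontier C \ regularSet C K)) = 0 := by
  have hm' : (0 : ℝ) < (m : ℝ) / 2 := by positivity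
  have := Measure.nullSingletonClass_hausdorff ℝ hm'
  choose! e ε ρ c hε hch hint using fun p (hp : p ∈ frontier C \ K) =>
    h.exists_isDCChart hp.1 hp.2
  obtain ⟨t, ht, htc, hcover⟩ := TopologicalSpace.countable_cover_nhdsWithin
    (s := frontier C \ K)
    (f := fun p => {q : E | q + ρ p • e p ∈ interior C ∧ foot (e p) p q ∈ Metric.ball p (ε p)})
    fun p hp => mem_nhdsWithin_of_mem_nhds <| (isOpen_chartPatch C (e p) p (ε p) (ρ p)).mem_nhds
      ⟨hint p hp, by simpa [foot] using hε p hp⟩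
  have hK : μH[(m : ℝ) / 2] (surfDist (frontier C) K '' K) = 0 :=
    measure_mono_null (t := {0}) (by rintro _ ⟨y, hy, rfl⟩; exact h.surfDist_eq_zero hy)
      (measure_singleton 0)
  refine measure_mono_null ?_ (measure_union_null
    ((measure_biUnion_null_iff htc).2 fun p hp =>
      (hch p (ht hp)).hausdorffMeasure_critical_values hm hE h) hK)
  rintro _ ⟨q, ⟨hq, hreg⟩, rfl⟩
  by_cases hqK : q ∈ K
  · exact Or.inr ⟨q, hqK, rfl⟩
  · obtain ⟨p, hp, hqp⟩ := mem_iUnion₂.1 (hcover ⟨hq, hqK⟩)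
    refine Or.inl (mem_iUnion₂.2 ⟨p, hp, q, ⟨⟨hq, hqp⟩, fun hqr => hreg ?_⟩, rfl⟩)
    simp only [regularSet, mem_iUnion]
    exact ⟨e p, p, ε p, ρ p, c p, hch p (ht hp), hqp, hqr⟩

theorem SurfacePair.isDCSurface_level {n : ℕ} (hE : Module.finrank ℝ E = n + 1)
    (h : SurfacePair C K) {r : ℝ}
    (hr : r ∉ surfDist (frontier C) K '' (frontier C \ regularSet C K))
    (hne : {x ∈ frontier C | surfDist (frontier C) K x = r}.Nonempty) :
    IsDCSurface (n - 1) {x ∈ frontier C | surfDist (frontier C) K x = r} := by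
  refine ⟨hne, ?_⟩
  rintro q ⟨hq, rfl⟩
  have hreg : q ∈ regularSet C K := by
    by_contra hreg
    exact hr ⟨q, ⟨hq, hreg⟩, rfl⟩
  simp only [regularSet, mem_iUnion] at hreg
  obtain ⟨e, p, ε, ρ, c, hch, ⟨hint, hfoot⟩, y, hy, h₁, h₂, hlt⟩ := hreg
  exact hch.exists_dc_graph hE h hq hint hfoot hy h₁ h₂ hlt

end ChartCovering

/-- Let `n ∈ {2,3}`, `X ⊂ ℝ^{n+1}` a convex surface, `∅ ≠ K ⊆ X` closed,
`d_K(z) = inf_{y ∈ K} dist_X(z,y)` and `K_r = {x ∈ X : d_K(x) = r}`. Then there is a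
compact set `N ⊆ [0,∞)` with `H^{(n-1)/2}(N) = 0` such that for every `r ∈ (0,∞) ∖ N`,
`K_r` is empty or an `(n−1)`-dimensional DC surface in `ℝ^{n+1}`. -/
theorem distance_spheres_DC_surfaces (n : ℕ) (hn : n = 2 ∨ n = 3)
    (X : Set (EuclideanSpace ℝ (Fin (n + 1)))) (hX : IsConvexSurface X)
    (K : Set (EuclideanSpace ℝ (Fin (n + 1)))) (hKne : K.Nonempty) (hKcl : IsClosed K)
    (hKX : K ⊆ X) :
    ∃ N : Set ℝ, IsCompact N ∧ N ⊆ Set.Ici (0:ℝ) ∧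
      μH[((n : ℝ) - 1) / 2] N = 0 ∧
      ∀ r : ℝ, 0 < r → r ∉ N →
        ({x ∈ X | (⨅ y : K, intrinsicDist X x (y : EuclideanSpace ℝ (Fin (n + 1)))) = r}
            = ∅ ∨
          IsDCSurface (n - 1)
            {x ∈ X | (⨅ y : K, intrinsicDist X x (y : EuclideanSpace ℝ (Fin (n + 1)))) = r}) := by
  obtain ⟨C, hC, rfl⟩ := hX
  have hn2 : 2 ≤ n := by omega
  have hE : Module.finrank ℝ (EuclideanSpace ℝ (Fin (n + 1))) = n + 1 := by simp
  have h : SurfacePair C K := ⟨hC, by omega, hKne, hKcl, hKX⟩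
  have hcompact : IsCompact (frontier C \ regularSet C K) :=
    (hC.1.of_isClosed_subset isClosed_frontier hC.1.isClosed.frontier_subset).diff
      (isOpen_regularSet C K)
  refine ⟨surfDist (frontier C) K '' (frontier C \ regularSet C K),
    hcompact.image_of_continuousOn (h.continuousOn_surfDist.mono sdiff_subset), ?_, ?_, ?_⟩
  · rintro _ ⟨q, -, rfl⟩
    exact SurfacePair.surfDist_nonneg _ _ _
  · have := h.hausdorffMeasure_singular_values (m := n - 1) (by omega) (by omega)
    rwa [Nat.cast_sub (by omega), Nat.cast_one] at this
  · intro r _ hr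
    rcases eq_empty_or_nonempty {x ∈ frontier C | surfDist (frontier C) K x = r} with he | hne
    · exact Or.inl he
    · exact Or.inr (h.isDCSurface_level hE hr hne)
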